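/- Let S be a finite family of curves in the plane, each colored red or blue, such that no two curves of the same color intersect. Let C be a family of pairwise disjoint curves such that each c ∈ C intersects exactly two members of S (possibly each of them several times), distinct members of C intersect distinct pairs of members of S, and there is a face F of the arrangement A_S that is intersected by every curve in C. Then |C| ≤ 5|S| + 2|E_F| − 3. -/

import Mathlib

open Set

/-- Points of the plane. -/
abbrev Pt : Type := ℝ × ℝ

/-- A curve: the image of an injective continuous map from `[0,1]` to the plane. -/
def IsCurve (s : Set Pt) : Prop :=
  ∃ f : ℝ → Pt, ContinuousOn f (Set.Icc 0 1) ∧ Set.InjOn f (Set.Icc 0 1) ∧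
    s = f '' Set.Icc 0 1

/-- A simple polygonal chain consisting of finitely many line segments. -/
def IsPolygonalCurve (s : Set Pt) : Prop :=
  IsCurve s ∧ ∃ P : Finset (Pt × Pt), s = ⋃ p ∈ P, segment ℝ p.1 p.2

/-- `p` is an endpoint of the curve `s`. -/
def IsEndpoint (s : Set Pt) (p : Pt) : Prop :=
  ∃ f : ℝ → Pt, ContinuousOn f (Set.Icc 0 1) ∧ Set.InjOn f (Set.Icc 0 1) ∧
    s = f '' Set.Icc 0 1 ∧ (p = f 0 ∨ p = f 1)

/-- The vertices of the arrangement `A_S`: endpoints of the curves together with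
intersection points of pairs of curves. -/
def ArrVertices {ι : Type*} (S : ι → Set Pt) : Set Pt :=
  {p | ∃ i, IsEndpoint (S i) p} ∪ {p | ∃ i j, i ≠ j ∧ p ∈ S i ∧ p ∈ S j}

/-- The edges of the arrangement `A_S`: closures of the connected components of
`⋃ S` minus the vertex set. -/
def ArrEdges {ι : Type*} (S : ι → Set Pt) : Set (Set Pt) :=
  {e | ∃ x ∈ (⋃ i, S i) \ ArrVertices S,
    e = closure (connectedComponentIn ((⋃ i, S i) \ ArrVertices S) x)}

/-- The faces of the arrangement `A_S`: closures of the connected components of the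
complement of `⋃ S`. -/
def ArrFaces {ι : Type*} (S : ι → Set Pt) : Set (Set Pt) :=
  {F | ∃ x ∉ ⋃ i, S i, F = closure (connectedComponentIn (⋃ i, S i)ᶜ x)}

/-- `E_F`: the set of edges of `A_S` contained in the boundary of the face `F`. -/
def FaceEdges {ι : Type*} (S : ι → Set Pt) (F : Set Pt) : Set (Set Pt) :=
  {e | e ∈ ArrEdges S ∧ e ⊆ frontier F}

/-- The height at abscissa `x` of the line through `s` and `t`. -/
noncomputable def lineHeight (s t : Pt) (x : ℝ) : ℝ :=
  s.2 + (x - s.1) * ((t.2 - s.2) / (t.1 - s.1))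

/-- The parity indicator of `x < y`. -/
noncomputable def ltParity (x y : ℝ) : ZMod 2 := if x < y then 1 else 0

/-- The parity indicator of `p` lying strictly below the segment from `s` to `t`. -/
noncomputable def belowParity (p s t : Pt) : ZMod 2 :=
  if ((s.1 < p.1 ∧ p.1 < t.1) ∨ (t.1 < p.1 ∧ p.1 < s.1)) ∧ p.2 < lineHeight s t p.1 then 1 else 0

lemma lineHeight_comm {s t : Pt} (h : s.1 ≠ t.1) (x : ℝ) :
    lineHeight s t x = lineHeight t s x := by
  have h1 : t.1 - s.1 ≠ 0 := sub_ne_zero.2 h.symm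
  have h2 : s.1 - t.1 ≠ 0 := sub_ne_zero.2 h
  unfold lineHeight
  field_simp
  ring

lemma lineHeight_left (s t : Pt) : lineHeight s t s.1 = s.2 := by simp [lineHeight]

lemma lineHeight_right {s t : Pt} (h : s.1 ≠ t.1) : lineHeight s t t.1 = t.2 := by
  rw [lineHeight_comm h, lineHeight_left]

lemma lineHeight_mem_segment {s t : Pt} {x : ℝ} (hs : s.1 ≤ x) (ht : x ≤ t.1) (h : s.1 < t.1) :
    ((x, lineHeight s t x) : Pt) ∈ segment ℝ s t := by
  have h0 : 0 < t.1 - s.1 := sub_pos.2 h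
  rw [segment_eq_image']
  refine ⟨(x - s.1) / (t.1 - s.1), ⟨by apply div_nonneg <;> linarith,
    by rw [div_le_one h0]; linarith⟩, ?_⟩
  ext
  · simp; field_simp; ring
  · simp [lineHeight]; field_simp

lemma lineHeight_lt_iff_of_disjoint {a b c d : Pt} {l r : ℝ} (hab : a.1 < b.1) (hcd : c.1 < d.1)
    (hlr : l ≤ r) (hal : a.1 ≤ l) (hcl : c.1 ≤ l) (hbr : r ≤ b.1) (hdr : r ≤ d.1)
    (hdis : Disjoint (segment ℝ a b) (segment ℝ c d)) :
    lineHeight a b l < lineHeight c d l ↔ lineHeight a b r < lineHeight c d r := by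
  have hne : ∀ x ∈ Icc l r, lineHeight c d x - lineHeight a b x ≠ 0 := fun x hx h =>
    disjoint_left.1 hdis (lineHeight_mem_segment (hal.trans hx.1) (hx.2.trans hbr) hab)
      (by rw [← sub_eq_zero.1 h]
          exact lineHeight_mem_segment (hcl.trans hx.1) (hx.2.trans hdr) hcd)
  have hc : ContinuousOn (fun x => lineHeight c d x - lineHeight a b x) (Icc l r) := by
    unfold lineHeight; fun_prop
  constructor
  · intro h
    by_contra! h'
    obtain ⟨x, hx, h0⟩ := intermediate_value_Icc' hlr hc
      (show (0 : ℝ) ∈ Icc _ _ from ⟨by linarith, by linarith⟩)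
    exact hne x hx h0
  · intro h
    by_contra! h'
    obtain ⟨x, hx, h0⟩ := intermediate_value_Icc hlr hc
      (show (0 : ℝ) ∈ Icc _ _ from ⟨by linarith, by linarith⟩)
    exact hne x hx h0

lemma belowParity_comm (p s t : Pt) : belowParity p s t = belowParity p t s := by
  unfold belowParity
  by_cases h : s.1 = t.1
  · rw [if_neg, if_neg]
    · rintro ⟨(h1 | h1), -⟩ <;> linarith [h1.1, h1.2]
    · rintro ⟨(h1 | h1), -⟩ <;> linarith [h1.1, h1.2]
  · simp only [lineHeight_comm h, or_comm]

lemma belowParity_eq_zero_of_le {p s t : Pt} (hs : p.1 ≤ s.1) (ht : p.1 ≤ t.1) :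
    belowParity p s t = 0 := by
  unfold belowParity
  rw [if_neg]
  rintro ⟨(h1 | h1), -⟩ <;> linarith [h1.1, h1.2]

lemma belowParity_eq_zero_of_ge {p s t : Pt} (hs : s.1 ≤ p.1) (ht : t.1 ≤ p.1) :
    belowParity p s t = 0 := by
  unfold belowParity
  rw [if_neg]
  rintro ⟨(h1 | h1), -⟩ <;> linarith [h1.1, h1.2]

lemma ltParity_swap {x y : ℝ} (h : x ≠ y) : ltParity y x = 1 + ltParity x y := by
  unfold ltParity
  rcases lt_or_gt_of_ne h with h | h
  · rw [if_neg h.not_gt, if_pos h]; decide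
  · rw [if_pos h, if_neg h.not_gt]; decide

lemma zmod_two_eq_zero : (2 : ZMod 2) = 0 := by decide

/-- The crossing-parity identity for two disjoint segments. -/
lemma belowParity_segment_identity {a b c d : Pt} (hab : a.1 = b.1 → a = b)
    (hcd : c.1 = d.1 → c = d) (hac : a.1 ≠ c.1) (had : a.1 ≠ d.1) (hbc : b.1 ≠ c.1)
    (hbd : b.1 ≠ d.1) (hdis : Disjoint (segment ℝ a b) (segment ℝ c d)) :
    belowParity a c d + belowParity b c d + (belowParity c a b + belowParity d a b) =
      ltParity a.1 c.1 + ltParity b.1 c.1 + (ltParity a.1 d.1 + ltParity b.1 d.1) := by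
  wlog h1 : a.1 ≤ b.1 generalizing a b
  · have := this (a := b) (b := a) (fun h => (hab h.symm).symm) hbc hbd hac had
      (by rwa [segment_symm]) (le_of_not_ge h1)
    rw [belowParity_comm c b a, belowParity_comm d b a] at this
    linear_combination this
  wlog h2 : c.1 ≤ d.1 generalizing c d
  · have := this (c := d) (d := c) (fun h => (hcd h.symm).symm) had hac hbd hbc
      (by rwa [segment_symm ℝ d c]) (le_of_not_ge h2)
    rw [belowParity_comm a d c, belowParity_comm b d c] at this
    linear_combination this
  wlog h3 : a.1 < c.1 generalizing a b c d
  · have := this (a := c) (b := d) (c := a) (d := b) (hab := hcd) (hcd := hab) (hac := hac.symm)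
      (had := hbc.symm) (hbc := had.symm) (hbd := hbd.symm) (hdis := hdis.symm) (h1 := h2)
      (h2 := h1) (lt_of_le_of_ne (le_of_not_gt h3) hac.symm)
    rw [ltParity_swap hac, ltParity_swap hbc, ltParity_swap had, ltParity_swap hbd] at this
    linear_combination this + 2 * zmod_two_eq_zero
  have ha : belowParity a c d = 0 := belowParity_eq_zero_of_le h3.le (h3.le.trans h2)
  rcases lt_or_gt_of_ne hbc with h4 | h4
  · rw [ha, belowParity_eq_zero_of_le h4.le (h4.le.trans h2),
      belowParity_eq_zero_of_ge h3.le h4.le,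
      belowParity_eq_zero_of_ge (h3.le.trans h2) (h4.le.trans h2)]
    simp only [ltParity, if_pos h3, if_pos h4, if_pos (h3.trans_le h2), if_pos (h4.trans_le h2)]
    decide
  have hab' : a.1 < b.1 := h3.trans h4
  rcases lt_or_gt_of_ne hbd with h5 | h5
  · have hcd' : c.1 < d.1 := h4.trans h5
    have key := lineHeight_lt_iff_of_disjoint hab' hcd' h4.le h3.le le_rfl le_rfl h5.le hdis
    rw [lineHeight_left, lineHeight_right hab'.ne] at key
    have hne : lineHeight a b c.1 ≠ c.2 := fun h =>
      disjoint_left.1 hdis (lineHeight_mem_segment h3.le h4.le hab')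
        (by rw [h]; exact left_mem_segment ℝ c d)
    rw [ha, belowParity_eq_zero_of_ge (p := d) (h3.le.trans h2) h5.le]
    simp only [belowParity, ltParity, h3, h4, h5, h3.trans_le h2, h4.not_gt, h5.not_gt, and_self,
      true_or, true_and, if_true, if_false]
    by_cases h : b.2 < lineHeight c d b.1
    · rw [if_pos h, if_neg (by rw [← key] at h; exact h.not_gt)]; decide
    · rw [if_neg h, if_pos (lt_of_le_of_ne (not_lt.1 (key.not.2 h)) hne.symm)]; decide
  · rw [ha, belowParity_eq_zero_of_ge (p := b) h4.le h5.le]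
    rcases h2.lt_or_eq with h6 | h6
    · have key := lineHeight_lt_iff_of_disjoint hab' h6 h2 h3.le le_rfl h5.le le_rfl hdis
      rw [lineHeight_left, lineHeight_right h6.ne] at key
      have hne : lineHeight a b c.1 ≠ c.2 := fun h =>
        disjoint_left.1 hdis (lineHeight_mem_segment h3.le h4.le hab')
          (by rw [h]; exact left_mem_segment ℝ c d)
      have hne' : lineHeight a b d.1 ≠ d.2 := fun h =>
        disjoint_left.1 hdis (lineHeight_mem_segment (h3.le.trans h2) h5.le hab')
          (by rw [h]; exact right_mem_segment ℝ c d)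
      have key' : c.2 < lineHeight a b c.1 ↔ d.2 < lineHeight a b d.1 := by
        have e1 : c.2 < lineHeight a b c.1 ↔ ¬ lineHeight a b c.1 < c.2 :=
          ⟨fun h => h.not_gt, fun h => lt_of_le_of_ne (not_lt.1 h) hne.symm⟩
        have e2 : d.2 < lineHeight a b d.1 ↔ ¬ lineHeight a b d.1 < d.2 :=
          ⟨fun h => h.not_gt, fun h => lt_of_le_of_ne (not_lt.1 h) hne'.symm⟩
        rw [e1, e2, key]
      simp only [belowParity, ltParity, h3, h4, h5, h3.trans_le h2, h4.not_gt, h5.not_gt, and_self,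
        true_or, true_and, if_true, if_false, key']
      split_ifs <;> decide
    · rw [← hcd h6]
      linear_combination (belowParity c a b - ltParity a.1 c.1 - ltParity b.1 c.1)
        * zmod_two_eq_zero

lemma sum_range_add_succ_zmod (N : ℕ) (f : ℕ → ZMod 2) :
    ∑ k ∈ Finset.range N, (f k + f (k + 1)) = f 0 + f N := by
  induction N with
  | zero => simp; linear_combination -(f 0) * zmod_two_eq_zero
  | succ n ih => rw [Finset.sum_range_succ, ih]; linear_combination f n * zmod_two_eq_zero

/-- The crossing-parity identity for two disjoint polygonal lines. -/
lemma belowParity_polyline_identity (N : ℕ) (a b : ℕ → Pt)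
    (ha : ∀ k l, (a k).1 = (a l).1 → a k = a l) (hb : ∀ k l, (b k).1 = (b l).1 → b k = b l)
    (hne : ∀ k l, (a k).1 ≠ (b l).1)
    (hdis : ∀ k < N, ∀ l < N,
      Disjoint (segment ℝ (a k) (a (k + 1))) (segment ℝ (b l) (b (l + 1)))) :
    (∑ l ∈ Finset.range N, belowParity (a 0) (b l) (b (l + 1))) +
      (∑ l ∈ Finset.range N, belowParity (a N) (b l) (b (l + 1))) +
      ((∑ k ∈ Finset.range N, belowParity (b 0) (a k) (a (k + 1))) +
      (∑ k ∈ Finset.range N, belowParity (b N) (a k) (a (k + 1)))) =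
      ltParity (a 0).1 (b 0).1 + ltParity (a N).1 (b 0).1 +
        (ltParity (a 0).1 (b N).1 + ltParity (a N).1 (b N).1) := by
  have h := Finset.sum_congr rfl fun k (hk : k ∈ Finset.range N) =>
    Finset.sum_congr rfl fun l (hl : l ∈ Finset.range N) =>
      belowParity_segment_identity (ha k (k + 1)) (hb l (l + 1)) (hne _ _) (hne _ _) (hne _ _)
        (hne _ _) (hdis k (Finset.mem_range.1 hk) l (Finset.mem_range.1 hl))
  simp only [Finset.sum_add_distrib (s := Finset.range N)] at h
  have e1 : ∀ q : ℕ → ℕ → ZMod 2, ∑ k ∈ Finset.range N, ∑ l ∈ Finset.range N, q k l +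
      ∑ k ∈ Finset.range N, ∑ l ∈ Finset.range N, q (k + 1) l =
      ∑ l ∈ Finset.range N, q 0 l + ∑ l ∈ Finset.range N, q N l := by
    intro q
    rw [← Finset.sum_add_distrib]
    simp_rw [← Finset.sum_add_distrib (s := Finset.range N)]
    rw [Finset.sum_comm]
    exact Finset.sum_congr rfl fun l _ => sum_range_add_succ_zmod N (fun k => q k l)
  have e2 : ∀ q : ℕ → ℕ → ZMod 2, ∑ k ∈ Finset.range N, ∑ l ∈ Finset.range N, q k l +
      ∑ k ∈ Finset.range N, ∑ l ∈ Finset.range N, q k (l + 1) =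
      ∑ k ∈ Finset.range N, q k 0 + ∑ k ∈ Finset.range N, q k N := by
    intro q
    rw [← Finset.sum_add_distrib]
    simp_rw [← Finset.sum_add_distrib (s := Finset.range N)]
    exact Finset.sum_congr rfl fun k _ => sum_range_add_succ_zmod N (fun l => q k l)
  have h1 := e1 fun k l => belowParity (a k) (b l) (b (l + 1))
  have h2 := e2 fun k l => belowParity (b l) (a k) (a (k + 1))
  have h3 := e2 fun k l => ltParity (a k).1 (b l).1
  have h4 := e2 fun k l => ltParity (a (k + 1)).1 (b l).1
  have h5 := sum_range_add_succ_zmod N fun k => ltParity (a k).1 (b 0).1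
  have h6 := sum_range_add_succ_zmod N fun k => ltParity (a k).1 (b N).1
  simp only [Finset.sum_add_distrib (s := Finset.range N)] at h1 h2 h3 h4 h5 h6
  linear_combination h - h1 - h2 + h3 + h4 + h5 + h6

/-- There is no plane drawing of the complete graph on five vertices by polygonal lines in general
position. -/
lemma not_K5_polyline_of_generic (N : ℕ) (p : Fin 5 → Pt) (a : Fin 5 → Fin 5 → ℕ → Pt)
    (h0 : ∀ u v, u < v → a u v 0 = p u) (h1 : ∀ u v, u < v → a u v N = p v)
    (hgen : ∀ u v w z k l, u < v → w < z → (a u v k).1 = (a w z l).1 → a u v k = a w z l)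
    (hne : ∀ u v w z k l, u < v → w < z → u ≠ w → u ≠ z → v ≠ w → v ≠ z → a u v k ≠ a w z l)
    (hdis : ∀ u v w z, u < v → w < z → u ≠ w → u ≠ z → v ≠ w → v ≠ z → ∀ k < N, ∀ l < N,
      Disjoint (segment ℝ (a u v k) (a u v (k + 1))) (segment ℝ (a w z l) (a w z (l + 1)))) :
    False := by
  set r : Fin 5 → Fin 5 → Fin 5 → ZMod 2 := fun u w z =>
    ∑ l ∈ Finset.range N, belowParity (p u) (a w z l) (a w z (l + 1)) with hr
  have key : ∀ u v w z, u < v → w < z → u ≠ w → u ≠ z → v ≠ w → v ≠ z →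
      r u w z + r v w z + (r w u v + r z u v) = ltParity (p u).1 (p w).1 + ltParity (p v).1 (p w).1
        + (ltParity (p u).1 (p z).1 + ltParity (p v).1 (p z).1) := by
    intro u v w z huv hwz h2 h3 h4 h5
    have := belowParity_polyline_identity N (a u v) (a w z)
      (fun k l => hgen _ _ _ _ _ _ huv huv) (fun k l => hgen _ _ _ _ _ _ hwz hwz)
      (fun k l h => hne _ _ _ _ k l huv hwz h2 h3 h4 h5 (hgen _ _ _ _ _ _ huv hwz h))
      (hdis _ _ _ _ huv hwz h2 h3 h4 h5)
    rwa [h0 u v huv, h1 u v huv, h0 w z hwz, h1 w z hwz] at this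
  have hpne : ∀ u v, u < v → ltParity (p v).1 (p u).1 = 1 + ltParity (p u).1 (p v).1 := by
    intro u v huv
    obtain ⟨x, hx⟩ : ∃ x : Fin 5, x ≠ u ∧ x ≠ v := by
      revert u v; decide
    obtain ⟨y, hy⟩ : ∃ y : Fin 5, y ≠ u ∧ y ≠ v ∧ y ≠ x := by
      revert u v x; decide
    have hdd : ∀ s : Fin 5, ∀ t : Fin 5, s ≠ t → ∃ b c k, b < c ∧ p s = a b c k ∧
        (b = s ∧ c = t ∨ b = t ∧ c = s) := by
      intro s t hst
      rcases lt_or_gt_of_ne hst with h | h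
      · exact ⟨s, t, 0, h, (h0 _ _ h).symm, Or.inl ⟨rfl, rfl⟩⟩
      · exact ⟨t, s, N, h, (h1 _ _ h).symm, Or.inr ⟨rfl, rfl⟩⟩
    obtain ⟨b, c, k, hbc, e1, hb⟩ := hdd u x hx.1.symm
    obtain ⟨b', c', k', hbc', e2, hb'⟩ := hdd v y hy.2.1.symm
    apply ltParity_swap
    rw [e1, e2]
    intro h
    refine hne _ _ _ _ k k' hbc hbc' ?_ ?_ ?_ ?_ (hgen _ _ _ _ _ _ hbc hbc' h) <;> grind
  have k0123 := key 0 1 2 3 (by decide) (by decide) (by decide) (by decide) (by decide) (by decide)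
  have k0124 := key 0 1 2 4 (by decide) (by decide) (by decide) (by decide) (by decide) (by decide)
  have k0134 := key 0 1 3 4 (by decide) (by decide) (by decide) (by decide) (by decide) (by decide)
  have k0213 := key 0 2 1 3 (by decide) (by decide) (by decide) (by decide) (by decide) (by decide)
  have k0214 := key 0 2 1 4 (by decide) (by decide) (by decide) (by decide) (by decide) (by decide)
  have k0234 := key 0 2 3 4 (by decide) (by decide) (by decide) (by decide) (by decide) (by decide)
  have k0312 := key 0 3 1 2 (by decide) (by decide) (by decide) (by decide) (by decide) (by decide)
  have k0314 := key 0 3 1 4 (by decide) (by decide) (by decide) (by decide) (by decide) (by decide)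
  have k0324 := key 0 3 2 4 (by decide) (by decide) (by decide) (by decide) (by decide) (by decide)
  have k0412 := key 0 4 1 2 (by decide) (by decide) (by decide) (by decide) (by decide) (by decide)
  have k0413 := key 0 4 1 3 (by decide) (by decide) (by decide) (by decide) (by decide) (by decide)
  have k0423 := key 0 4 2 3 (by decide) (by decide) (by decide) (by decide) (by decide) (by decide)
  have k1234 := key 1 2 3 4 (by decide) (by decide) (by decide) (by decide) (by decide) (by decide)
  have k1324 := key 1 3 2 4 (by decide) (by decide) (by decide) (by decide) (by decide) (by decide)
  have k1423 := key 1 4 2 3 (by decide) (by decide) (by decide) (by decide) (by decide) (by decide)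
  have q12 := hpne 1 2 (by decide)
  have q13 := hpne 1 3 (by decide)
  have q14 := hpne 1 4 (by decide)
  have q23 := hpne 2 3 (by decide)
  have q24 := hpne 2 4 (by decide)
  have q34 := hpne 3 4 (by decide)
  simp only [q12] at k0123 k0124 k0134 k0213 k0214 k0234
  simp only [q13, q14, q23, q24, q34] at k0312 k0314 k0324 k0412 k0413 k0423
  simp only [q23, q24, q34] at k1234 k1324 k1423
  generalize r = R at *
  grind

lemma exists_shear_injOn {V : Set Pt} (hV : V.Finite) :
    ∃ θ : ℝ, InjOn (fun p : Pt => p.1 + θ * p.2) V := by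
  have hfin : (image2 (fun p q : Pt => (q.1 - p.1) / (p.2 - q.2)) V V).Finite := hV.image2 _ hV
  obtain ⟨θ, hθ⟩ := hfin.infinite_compl.nonempty
  refine ⟨θ, fun p hp q hq h => ?_⟩
  simp only at h
  by_contra hne
  by_cases h2 : p.2 = q.2
  · apply hne; ext
    · rw [h2] at h; linarith
    · exact h2
  · have h3 : p.2 - q.2 ≠ 0 := sub_ne_zero.2 h2
    exact hθ ⟨p, hp, q, hq, by field_simp; linarith⟩

lemma exists_forall_le_dist_of_disjoint {f g : ℝ → Pt} (hf : ContinuousOn f (Icc 0 1))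
    (hg : ContinuousOn g (Icc 0 1)) (h : Disjoint (f '' Icc 0 1) (g '' Icc 0 1)) :
    ∃ ε > 0, ∀ s ∈ Icc (0 : ℝ) 1, ∀ t ∈ Icc (0 : ℝ) 1, ε ≤ dist (f s) (g t) := by
  obtain ⟨ε, hε, h'⟩ := Metric.exists_pos_forall_lt_edist
    (isCompact_Icc.image_of_continuousOn hf) (isCompact_Icc.image_of_continuousOn hg).isClosed h
  refine ⟨ε, by exact_mod_cast hε, fun s hs t ht => ?_⟩
  have := h' _ (mem_image_of_mem f hs) _ (mem_image_of_mem g ht)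
  rw [edist_nndist] at this
  exact_mod_cast this.le

/-- There is no plane drawing of the complete graph on five vertices in which disjoint edges are
drawn disjointly. -/
theorem not_K5_planar (p : Fin 5 → Pt) (R : Fin 5 → Fin 5 → Set Pt)
    (hR : ∀ u v, u < v → JoinedIn (R u v) (p u) (p v))
    (hdis : ∀ u v w z, u < v → w < z → u ≠ w → u ≠ z → v ≠ w → v ≠ z →
      Disjoint (R u v) (R w z)) : False := by
  have hg : ∀ u v, ∃ g : ℝ → Pt, u < v → ContinuousOn g (Icc 0 1) ∧ (∀ t ∈ Icc (0 : ℝ) 1,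
      g t ∈ R u v) ∧ g 0 = p u ∧ g 1 = p v := by
    intro u v
    by_cases huv : u < v
    · obtain ⟨γ, hγ⟩ := hR u v huv
      exact ⟨γ.extend, fun _ => ⟨γ.continuous_extend.continuousOn,
        fun t ht => by rw [γ.extend_apply ht]; exact hγ _, by simp, by simp⟩⟩
    · exact ⟨0, fun h => absurd h huv⟩
  choose g hg using hg
  have hε : ∀ᶠ ε in nhdsWithin (0 : ℝ) (Ioi 0), ∀ u v w z, u < v → w < z → u ≠ w → u ≠ z → v ≠ w →
      v ≠ z → ∀ s ∈ Icc (0 : ℝ) 1, ∀ t ∈ Icc (0 : ℝ) 1, 3 * ε ≤ dist (g u v s) (g w z t) := by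
    simp only [Filter.eventually_all]
    intro u v w z huv hwz h1 h2 h3 h4
    have hd : Disjoint (g u v '' Icc 0 1) (g w z '' Icc 0 1) :=
      (hdis u v w z huv hwz h1 h2 h3 h4).mono
        (image_subset_iff.2 fun t ht => (hg u v huv).2.1 t ht)
        (image_subset_iff.2 fun t ht => (hg w z hwz).2.1 t ht)
    obtain ⟨ε, hε, h⟩ := exists_forall_le_dist_of_disjoint (hg u v huv).1 (hg w z hwz).1 hd
    filter_upwards [Ioo_mem_nhdsGT (show (0 : ℝ) < ε / 3 by positivity)] with x hx s hs t ht
    linarith [h s hs t ht, hx.2]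
  obtain ⟨ε, hε, hε0⟩ := (hε.and self_mem_nhdsWithin).exists
  have hN : ∀ᶠ N : ℕ in Filter.atTop, ∀ u v, u < v → ∀ k < N,
      dist (g u v ((k + 1 : ℕ) / N)) (g u v (k / N)) < ε := by
    simp only [Filter.eventually_all]
    intro u v huv
    obtain ⟨δ, hδ, h⟩ := Metric.uniformContinuousOn_iff.1
      (isCompact_Icc.uniformContinuousOn_of_continuous (hg u v huv).1) ε hε0
    obtain ⟨M, hM⟩ := exists_nat_gt (1 / δ)
    filter_upwards [Filter.eventually_ge_atTop M] with N hN k hk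
    have hN0 : (0 : ℝ) < N := by exact_mod_cast (Nat.zero_le k).trans_lt hk
    have hk' : ((k + 1 : ℕ) : ℝ) ≤ N := by exact_mod_cast hk
    refine h _ ⟨by positivity, by rwa [div_le_one hN0]⟩ _ ⟨by positivity, ?_⟩ ?_
    · rw [div_le_one hN0]; push_cast at hk'; linarith
    · rw [Real.dist_eq, ← sub_div]
      push_cast
      rw [add_sub_cancel_left, abs_of_nonneg (by positivity), one_div_lt hN0 hδ]
      exact hM.trans_le (by exact_mod_cast hN)
  obtain ⟨N, hN, hN1⟩ := (hN.and (Filter.eventually_ge_atTop 1)).exists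
  have hN0 : (0 : ℝ) < N := by exact_mod_cast hN1
  set b : Fin 5 → Fin 5 → ℕ → Pt := fun u v k => g u v ((min k N : ℕ) / N) with hb
  have hmem : ∀ k : ℕ, ((min k N : ℕ) / N : ℝ) ∈ Icc (0 : ℝ) 1 := fun k =>
    ⟨by positivity, by rw [div_le_one hN0]; exact_mod_cast min_le_right k N⟩
  have hfin : (⋃ u, ⋃ v, range (b u v)).Finite := by
    refine finite_iUnion fun u => finite_iUnion fun v => ?_
    refine ((finite_Iic N).image (b u v)).subset ?_
    rintro _ ⟨k, rfl⟩
    exact ⟨min k N, mem_Iic.2 (min_le_right _ _), by simp [hb]⟩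
  obtain ⟨θ, hθ⟩ := exists_shear_injOn hfin
  let T : Pt →ₗ[ℝ] Pt := (LinearMap.fst ℝ ℝ ℝ + θ • LinearMap.snd ℝ ℝ ℝ).prod (LinearMap.snd ℝ ℝ ℝ)
  have hT : Function.Injective T := by
    intro p q h
    have h2 := congrArg Prod.snd h
    have h1 := congrArg Prod.fst h
    simp [T] at h1 h2
    ext
    · rw [h2] at h1; linarith
    · exact h2
  have hmemb : ∀ u v k, b u v k ∈ ⋃ u, ⋃ v, range (b u v) := fun u v k =>
    mem_iUnion₂.2 ⟨u, v, k, rfl⟩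
  have hdist : ∀ u v w z k l, u < v → w < z → u ≠ w → u ≠ z → v ≠ w → v ≠ z →
      3 * ε ≤ dist (b u v k) (b w z l) := fun u v w z k l huv hwz h1 h2 h3 h4 =>
    hε u v w z huv hwz h1 h2 h3 h4 _ (hmem k) _ (hmem l)
  refine not_K5_polyline_of_generic N (fun u => T (p u)) (fun u v k => T (b u v k)) ?_ ?_ ?_ ?_ ?_
  · intro u v huv; simp [hb, (hg u v huv).2.2.1]
  · intro u v huv; simp [hb, (hg u v huv).2.2.2, hN0.ne']
  · intro u v w z k l _ _ h
    rw [hθ (hmemb u v k) (hmemb w z l) h]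
  · intro u v w z k l huv hwz h1 h2 h3 h4 h
    have := hdist u v w z k l huv hwz h1 h2 h3 h4
    rw [hT h, dist_self] at this
    linarith
  · intro u v w z huv hwz h1 h2 h3 h4 k hk l hl
    have himg : ∀ x y : Pt, segment ℝ (T x) (T y) = T '' segment ℝ x y := fun x y =>
      (image_segment ℝ T.toAffineMap x y).symm
    rw [himg, himg, disjoint_image_iff hT, disjoint_left]
    have hsub : ∀ u v, u < v → ∀ k < N, segment ℝ (b u v k) (b u v (k + 1)) ⊆
        Metric.ball (b u v k) ε := by
      intro u v huv k hk
      refine (convex_ball _ _).segment_subset (Metric.mem_ball_self hε0) ?_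
      have := hN u v huv k hk
      rw [Metric.mem_ball]
      simpa only [hb, min_eq_left hk.le, min_eq_left (show k + 1 ≤ N from hk)] using this
    intro x hx hx'
    have e1 := hsub u v huv k hk hx
    have e2 := hsub w z hwz l hl hx'
    have := hdist u v w z k l huv hwz h1 h2 h3 h4
    have := dist_triangle_left (b u v k) (b w z l) x
    rw [Metric.mem_ball] at e1 e2
    linarith

section PlanarBound

open Classical in
/-- The ordered pairs of elements of `V` related by `r`. -/
noncomputable def relPairs {α : Type*} (V : Finset α) (r : α → α → Prop) : Finset (α × α) :=
  (V ×ˢ V).filter fun p => r p.1 p.2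

lemma mem_relPairs {α : Type*} {V : Finset α} {r : α → α → Prop} {p : α × α} :
    p ∈ relPairs V r ↔ (p.1 ∈ V ∧ p.2 ∈ V) ∧ r p.1 p.2 := by
  simp [relPairs]

/-- The relation obtained from `r` by contracting `v` into `u`. -/
def contractRel {α : Type*} (r : α → α → Prop) (u v x y : α) : Prop :=
  x ≠ y ∧ (r x y ∨ (x = u ∧ r v y) ∨ (y = u ∧ r x v))

open Classical in
lemma card_relPairs_le_erase {α : Type*} (V : Finset α) (r : α → α → Prop)
    (hs : ∀ x y, r x y → r y x) (v : α) :
    (relPairs V r).card ≤ (relPairs (V.erase v) r).card + 2 * (V.filter (r v)).card := by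
  have hsub : relPairs V r ⊆ relPairs (V.erase v) r ∪
      ((V.filter (r v)).image (fun y => (v, y)) ∪ (V.filter (r v)).image (fun y => (y, v))) := by
    rintro ⟨x, y⟩ h
    simp only [mem_relPairs, Finset.mem_filter, Finset.mem_union, Finset.mem_image,
      Finset.mem_erase, Prod.mk.injEq] at h ⊢
    by_cases hx : x = v
    · subst hx; exact Or.inr (Or.inl ⟨y, ⟨h.1.2, h.2⟩, rfl, rfl⟩)
    · by_cases hy : y = v
      · subst hy; exact Or.inr (Or.inr ⟨x, ⟨h.1.1, hs _ _ h.2⟩, rfl, rfl⟩)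
      · exact Or.inl ⟨⟨⟨hx, h.1.1⟩, hy, h.1.2⟩, h.2⟩
  have h1 := Finset.card_le_card hsub
  have h2 := Finset.card_union_le (relPairs (V.erase v) r)
    ((V.filter (r v)).image (fun y => (v, y)) ∪ (V.filter (r v)).image (fun y => (y, v)))
  have h3 := Finset.card_union_le ((V.filter (r v)).image (fun y => (v, y)))
    ((V.filter (r v)).image (fun y => (y, v)))
  have h4 := Finset.card_image_le (s := V.filter (r v)) (f := fun y => (v, y))
  have h5 := Finset.card_image_le (s := V.filter (r v)) (f := fun y => (y, v))
  omega

open Classical in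
lemma card_relPairs_le_contract {α : Type*} (V : Finset α) (r : α → α → Prop)
    (hs : ∀ x y, r x y → r y x) (hi : ∀ x, ¬ r x x) {u v : α} (hu : u ∈ V) (huv : r u v) :
    (relPairs V r).card ≤ (relPairs (V.erase v) (contractRel r u v)).card + 2 +
      2 * (V.filter fun y => r u y ∧ r v y).card := by
  have hne : u ≠ v := fun h => hi v (h ▸ huv)
  set N := V.filter fun y => r v y ∧ ¬ r u y ∧ y ≠ u with hN
  have hsub : relPairs (V.erase v) r ∪ (N.image (fun y => (u, y)) ∪ N.image (fun y => (y, u))) ⊆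
      relPairs (V.erase v) (contractRel r u v) := by
    rintro ⟨x, y⟩ h
    simp only [mem_relPairs, Finset.mem_filter, Finset.mem_union, Finset.mem_image,
      Finset.mem_erase, Prod.mk.injEq, hN, contractRel] at h ⊢
    rcases h with ⟨h, h'⟩ | ⟨z, ⟨hz, hz1, -, hz3⟩, rfl, rfl⟩ | ⟨z, ⟨hz, hz1, -, hz3⟩, rfl, rfl⟩
    · exact ⟨h, fun e => hi y (e ▸ h'), Or.inl h'⟩
    · exact ⟨⟨⟨hne, hu⟩, fun e => hi v (e ▸ hz1), hz⟩, hz3.symm, Or.inr (Or.inl ⟨rfl, hz1⟩)⟩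
    · exact ⟨⟨⟨fun e => hi v (e ▸ hz1), hz⟩, hne, hu⟩, hz3, Or.inr (Or.inr ⟨rfl, hs _ _ hz1⟩)⟩
  have hd1 : Disjoint (relPairs (V.erase v) r)
      (N.image (fun y => (u, y)) ∪ N.image (fun y => (y, u))) := by
    rw [Finset.disjoint_left]
    rintro ⟨x, y⟩ h h'
    simp only [mem_relPairs, Finset.mem_filter, Finset.mem_union, Finset.mem_image,
      Finset.mem_erase, Prod.mk.injEq, hN] at h h'
    rcases h' with ⟨z, hz, rfl, rfl⟩ | ⟨z, hz, rfl, rfl⟩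
    · exact hz.2.2.1 h.2
    · exact hz.2.2.1 (hs _ _ h.2)
  have hd2 : Disjoint (N.image (fun y => (u, y))) (N.image (fun y => (y, u))) := by
    rw [Finset.disjoint_left]
    rintro ⟨x, y⟩ h h'
    simp only [Finset.mem_image, Prod.mk.injEq, hN, Finset.mem_filter] at h h'
    obtain ⟨z, hz, rfl, rfl⟩ := h
    obtain ⟨w, hw, rfl, rfl⟩ := h'
    exact hw.2.2.2 rfl
  have h1 := Finset.card_le_card hsub
  rw [Finset.card_union_of_disjoint hd1, Finset.card_union_of_disjoint hd2,
    Finset.card_image_of_injective _ (fun a b h => (Prod.mk.inj h).2),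
    Finset.card_image_of_injective _ (fun a b h => (Prod.mk.inj h).1)] at h1
  have h2 := card_relPairs_le_erase V r hs v
  have h3 : V.filter (r v) ⊆ insert u (N ∪ V.filter fun y => r u y ∧ r v y) := by
    intro y hy
    simp only [hN, Finset.mem_filter, Finset.mem_insert, Finset.mem_union] at hy ⊢
    tauto
  have h4 := (Finset.card_le_card h3).trans ((Finset.card_insert_le _ _).trans
    (Nat.succ_le_succ (Finset.card_union_le _ _)))
  omega

open Classical in
lemma card_relPairs_delete {α : Type*} (V : Finset α) (r : α → α → Prop) {u v : α} (hu : u ∈ V)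
    (hv : v ∈ V) (huv : r u v) :
    (relPairs V r).card ≤ (relPairs V fun x y => r x y ∧ ¬ (x = u ∧ y = v) ∧
      ¬ (x = v ∧ y = u)).card + 2 ∧
    (relPairs V fun x y => r x y ∧ ¬ (x = u ∧ y = v) ∧ ¬ (x = v ∧ y = u)).card <
      (relPairs V r).card := by
  constructor
  · have : relPairs V r ⊆ (relPairs V fun x y => r x y ∧ ¬ (x = u ∧ y = v) ∧
        ¬ (x = v ∧ y = u)) ∪ {(u, v), (v, u)} := by
      rintro ⟨x, y⟩ h
      simp only [mem_relPairs, Finset.mem_union,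
        Finset.mem_insert, Finset.mem_singleton, Prod.mk.injEq] at h ⊢
      tauto
    exact (Finset.card_le_card this).trans ((Finset.card_union_le _ _).trans
      (Nat.add_le_add_left Finset.card_le_two _))
  · refine Finset.card_lt_card ⟨?_, fun h => ?_⟩
    · rintro ⟨x, y⟩ h
      simp only [mem_relPairs] at h ⊢
      tauto
    · have := @h (u, v) (by simp [relPairs, hu, hv, huv])
      simp [relPairs] at this

open Classical in
lemma card_relPairs_eq_sum {α : Type*} (V : Finset α) (r : α → α → Prop) :
    (relPairs V r).card = ∑ v ∈ V, (V.filter (r v)).card := by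
  unfold relPairs
  rw [Finset.card_filter, Finset.sum_product]
  simp_rw [Finset.card_filter]

open Classical in
/-- In a graph on five vertices of minimum degree at least three some edge can be contracted such
that the remaining four vertices are pairwise adjacent. -/
lemma exists_contractible_pair {α : Type*} (L : Finset α) (r : α → α → Prop)
    (hs : ∀ x y, r x y → r y x) (hL : L.card = 5)
    (hdeg : ∀ x ∈ L, 3 ≤ (L.filter (r x)).card) (hi : ∀ x, ¬ r x x) :
    ∃ a b c d e, L = {a, b, c, d, e} ∧ [a, b, c, d, e].Nodup ∧ r a b ∧ r c d ∧ r c e ∧ r d e ∧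
      (r a c ∨ r b c) ∧ (r a d ∨ r b d) ∧ (r a e ∨ r b e) := by
  have key : ∀ x ∈ L, ∀ y ∈ L, ∀ z ∈ L, x ≠ y → x ≠ z → y ≠ z → r x y ∨ r x z := by
    intro x hx y hy z hz hxy hxz hyz
    by_contra! h
    have hsub : L.filter (r x) ⊆ ((L.erase x).erase y).erase z := by
      intro w hw
      rw [Finset.mem_filter] at hw
      simp only [Finset.mem_erase]
      exact ⟨fun e => h.2 (e ▸ hw.2), fun e => h.1 (e ▸ hw.2), fun e => hi x (e ▸ hw.2), hw.1⟩
    have := Finset.card_le_card hsub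
    rw [Finset.card_erase_of_mem (by simp [hz, hyz.symm, hxz.symm]),
      Finset.card_erase_of_mem (by simp [hy, hxy.symm]), Finset.card_erase_of_mem hx, hL] at this
    have := hdeg x hx
    omega
  have fin : ∀ a b c d e, L = {a, b, c, d, e} → [a, b, c, d, e].Nodup → r a b → r c d → r c e →
      r d e → ∃ a b c d e, L = {a, b, c, d, e} ∧ [a, b, c, d, e].Nodup ∧ r a b ∧ r c d ∧ r c e ∧
      r d e ∧ (r a c ∨ r b c) ∧ (r a d ∨ r b d) ∧ (r a e ∨ r b e) := by
    intro a b c d e h hnd h1 h2 h3 h4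
    simp only [List.nodup_cons, List.mem_cons, not_or] at hnd
    refine ⟨a, b, c, d, e, h, by simp; tauto, h1, h2, h3, h4, ?_, ?_, ?_⟩
    · exact (key c (by simp [h]) a (by simp [h]) b (by simp [h]) (by tauto) (by tauto)
        (by tauto)).imp (hs _ _) (hs _ _)
    · exact (key d (by simp [h]) a (by simp [h]) b (by simp [h]) (by tauto) (by tauto)
        (by tauto)).imp (hs _ _) (hs _ _)
    · exact (key e (by simp [h]) a (by simp [h]) b (by simp [h]) (by tauto) (by tauto)
        (by tauto)).imp (hs _ _) (hs _ _)
  by_cases hall : ∀ x ∈ L, ∀ y ∈ L, x ≠ y → r x y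
  · obtain ⟨a, L', ha, rfl, hL'⟩ := Finset.card_eq_succ.1 hL
    obtain ⟨b, L'', hb, rfl, hL''⟩ := Finset.card_eq_succ.1 hL'
    obtain ⟨c, d, e, hcd, hce, hde, rfl⟩ := Finset.card_eq_three.1 hL''
    simp only [Finset.mem_insert, Finset.mem_singleton, not_or] at ha hb
    refine fin a b c d e rfl (by simp; tauto) ?_ ?_ ?_ ?_ <;>
      exact hall _ (by simp) _ (by simp) (by tauto)
  · push Not at hall
    obtain ⟨a, ha, b, hb, hab, hrab⟩ := hall
    have h3 : ((L.erase a).erase b).card = 3 := by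
      rw [Finset.card_erase_of_mem (by simp [hb, hab.symm]), Finset.card_erase_of_mem ha, hL]
    obtain ⟨c, d, e, hcd, hce, hde, h⟩ := Finset.card_eq_three.1 h3
    have hLe : L = {a, b, c, d, e} := by
      rw [← Finset.insert_erase ha, ← Finset.insert_erase
        (show b ∈ L.erase a by simp [hb, hab.symm]),
        h]
    have hmem : ∀ x, x ∈ ({c, d, e} : Finset α) → x ∈ L ∧ x ≠ a ∧ x ≠ b := by
      intro x hx
      rw [← h] at hx
      simp only [Finset.mem_erase] at hx
      tauto
    obtain ⟨hc, hca, hcb⟩ := hmem c (by simp)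
    obtain ⟨hd, hda, hdb⟩ := hmem d (by simp)
    obtain ⟨he, hea, heb⟩ := hmem e (by simp)
    have hadj : ∀ x ∈ L, x ≠ a → x ≠ b → r a x ∧ r b x := fun x hx hxa hxb =>
      ⟨(key a ha b hb x hx hab hxa.symm hxb.symm).resolve_left hrab,
        (key b hb a ha x hx hab.symm hxb.symm hxa.symm).resolve_left fun h => hrab (hs _ _ h)⟩
    by_cases hrde : r d e
    · refine fin a c b d e ?_ ?_ (hadj c hc hca hcb).1 (hadj d hd hda hdb).2 (hadj e he hea heb).2
        hrde
      · rw [hLe]; ext; simp; tauto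
      · simp; tauto
    · refine fin a d b c e ?_ ?_ (hadj d hd hda hdb).1 (hadj c hc hca hcb).2 (hadj e he hea heb).2
        (hs _ _ ((key e he d hd c hc hde.symm hce.symm hcd.symm).resolve_left
          fun h => hrde (hs _ _ h)))
      · rw [hLe]; ext; simp; tauto
      · simp; tauto

open Classical in
/-- **Mader's bound**: a minor-closed class of graphs without a complete graph on five vertices
consists of graphs with at most `3 n - 5` edges. -/
theorem card_relPairs_le_of_minor_closed {α : Type*} (Q : Finset α → (α → α → Prop) → Prop)
    (hsymm : ∀ V r, Q V r → (∀ x y, r x y → r y x) ∧ ∀ x, ¬ r x x)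
    (hdel : ∀ V r r', Q V r → (∀ x y, r' x y → r' y x) → (∀ x y, r' x y → r x y) → Q V r')
    (hverase : ∀ V r v, Q V r → Q (V.erase v) r)
    (hcontract : ∀ V r u v, Q V r → u ∈ V → v ∈ V → r u v → Q (V.erase v) (contractRel r u v))
    (hK5 : ∀ V r a b c d e, Q V r → [a, b, c, d, e].Nodup → (∀ x ∈ [a, b, c, d, e], x ∈ V) →
      ¬ [a, b, c, d, e].Pairwise r)
    (V : Finset α) (r : α → α → Prop) (hQ : Q V r) (hV : 2 ≤ V.card) :
    (relPairs V r).card + 10 ≤ 6 * V.card := by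
  obtain ⟨n, hn⟩ : ∃ n, V.card = n := ⟨_, rfl⟩
  induction n using Nat.strong_induction_on generalizing V r with
  | _ n ihn =>
  obtain ⟨E, hE⟩ : ∃ E, (relPairs V r).card = E := ⟨_, rfl⟩
  induction E using Nat.strong_induction_on generalizing r with
  | _ E ihE =>
  obtain ⟨hs, hi⟩ := hsymm V r hQ
  have hdeg_lt : ∀ v ∈ V, (V.filter (r v)).card < V.card := fun v hv =>
    Finset.card_lt_card ((Finset.filter_ssubset).2 ⟨v, hv, hi v⟩)
  by_cases hV2 : V.card = 2
  · have : (relPairs V r).card ≤ V.card * 1 := by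
      rw [card_relPairs_eq_sum]
      exact Finset.sum_le_card_nsmul _ _ _ fun v hv => by have := hdeg_lt v hv; omega
    omega
  by_contra! hbig
  have herase : ∀ v ∈ V, (V.erase v).card = V.card - 1 := fun v hv => Finset.card_erase_of_mem hv
  have hdeg4 : ∀ v ∈ V, 4 ≤ (V.filter (r v)).card := by
    intro v hv
    by_contra! h
    have h1 := card_relPairs_le_erase V r hs v
    have h2 := ihn (n - 1) (by omega) (V.erase v) r (hverase V r v hQ)
      (by rw [herase v hv]; omega) (by rw [herase v hv]; omega)
    rw [herase v hv] at h2
    omega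
  have htri : ∀ u ∈ V, ∀ v ∈ V, r u v → 3 ≤ (V.filter fun y => r u y ∧ r v y).card := by
    intro u hu v hv huv
    by_contra! h
    have h1 := card_relPairs_le_contract V r hs hi hu huv
    have h2 := ihn (n - 1) (by omega) (V.erase v) _ (hcontract V r u v hQ hu hv huv)
      (by rw [herase v hv]; omega) (by rw [herase v hv]; omega)
    rw [herase v hv] at h2
    omega
  obtain ⟨v, hv, hdv⟩ : ∃ v ∈ V, (V.filter (r v)).card ≤ 5 := by
    by_contra! h
    have h6 : V.card * 6 ≤ (relPairs V r).card := by
      rw [card_relPairs_eq_sum]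
      exact Finset.card_nsmul_le_sum _ _ _ fun v hv => Nat.succ_le_of_lt (h v hv)
    obtain ⟨⟨x, y⟩, hxy⟩ : (relPairs V r).Nonempty := Finset.card_pos.1 (by omega)
    rw [mem_relPairs] at hxy
    have h1 := card_relPairs_delete V r hxy.1.1 hxy.1.2 hxy.2
    have h2 := ihE _ (hE ▸ h1.2) _ (hdel V r _ hQ (fun p q h => ⟨hs _ _ h.1, by tauto, by tauto⟩)
      fun p q h => h.1) rfl
    omega
  set L := V.filter (r v) with hL
  have hLV : ∀ x ∈ L, x ∈ V ∧ r v x := fun x hx => Finset.mem_filter.1 hx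
  have hLdeg : ∀ x ∈ L, 3 ≤ (L.filter (r x)).card := by
    intro x hx
    have h1 := htri v hv x (hLV x hx).1 (hLV x hx).2
    rwa [hL, Finset.filter_filter]
  rcases (show L.card = 4 ∨ L.card = 5 by
      have h : 4 ≤ L.card := hdeg4 v hv
      omega) with h4 | h5
  · have hall : ∀ x ∈ L, ∀ y ∈ L, x ≠ y → r x y := by
      intro x hx y hy hxy
      by_contra h
      have hsub : L.filter (r x) ⊆ (L.erase x).erase y := by
        intro w hw
        rw [Finset.mem_filter] at hw
        simp only [Finset.mem_erase]
        exact ⟨fun e => h (e ▸ hw.2), fun e => hi x (e ▸ hw.2), hw.1⟩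
      have h1 := Finset.card_le_card hsub
      rw [Finset.card_erase_of_mem (by simp [hy, hxy.symm]), Finset.card_erase_of_mem hx, h4] at h1
      have := hLdeg x hx
      omega
    obtain ⟨a, L', ha, hL', hcard⟩ := Finset.card_eq_succ.1 h4
    obtain ⟨b, c, d, hbc, hbd, hcd, rfl⟩ := Finset.card_eq_three.1 hcard
    rw [← hL'] at hLV hall
    simp only [Finset.mem_insert, Finset.mem_singleton, not_or] at ha
    have hvn : ∀ x ∈ insert a ({b, c, d} : Finset α), v ≠ x := fun x hx h =>
      hi v (by simpa [← h] using (hLV x hx).2)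
    refine hK5 V r v a b c d hQ ?_ ?_ ?_
    · have := hvn a (by simp)
      have := hvn b (by simp)
      have := hvn c (by simp)
      have := hvn d (by simp)
      simp; tauto
    · intro x hx
      simp only [List.mem_cons, List.not_mem_nil, or_false] at hx
      rcases hx with rfl | hx
      · exact hv
      · exact (hLV x (by simpa using hx)).1
    · simp only [List.pairwise_cons, List.mem_cons, List.not_mem_nil, or_false, forall_eq_or_imp,
        forall_eq]
      refine ⟨⟨?_, ?_, ?_, ?_⟩, ⟨?_, ?_, ?_⟩, ⟨?_, ?_⟩, ?_, by simp⟩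
      any_goals exact (hLV _ (by simp)).2
      all_goals exact hall _ (by simp) _ (by simp) (by tauto)
  · obtain ⟨a, b, c, d, e, hLe, hnd, hab, hcd, hce, hde, h1, h2, h3⟩ :=
      exists_contractible_pair L r hs h5 hLdeg hi
    rw [hLe] at hLV
    have hvn : ∀ x ∈ ({a, b, c, d, e} : Finset α), v ≠ x := fun x hx h =>
      hi v (by simpa [← h] using (hLV x hx).2)
    have hva := hvn a (by simp)
    have hvb := hvn b (by simp)
    have hvc := hvn c (by simp)
    have hvd := hvn d (by simp)
    have hve := hvn e (by simp)
    have hra := (hLV a (by simp)).2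
    have hrc := (hLV c (by simp)).2
    have hrd := (hLV d (by simp)).2
    have hre := (hLV e (by simp)).2
    have ha := (hLV a (by simp)).1
    have hc := (hLV c (by simp)).1
    have hd := (hLV d (by simp)).1
    have he := (hLV e (by simp)).1
    simp only [List.nodup_cons, List.mem_cons, List.not_mem_nil, or_false, not_or] at hnd
    obtain ⟨⟨hab', hac', had', hae'⟩, ⟨hbc', hbd', hbe'⟩, ⟨hcd', hce'⟩, hde', -⟩ := hnd
    have hc' : ∀ x y, x ≠ y → r x y → contractRel r a b x y := fun x y h h' => ⟨h, Or.inl h'⟩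
    have ha' : ∀ y, a ≠ y → r a y ∨ r b y → contractRel r a b a y := fun y h h' =>
      ⟨h, h'.imp id fun h => Or.inl ⟨rfl, h⟩⟩
    refine hK5 (V.erase b) (contractRel r a b) a v c d e
      (hcontract V r a b hQ ha (hLV b (by simp)).1 hab) ?_ ?_ ?_
    · simp only [List.nodup_cons, List.mem_cons, List.not_mem_nil, or_false, not_or]
      exact ⟨⟨hva.symm, hac', had', hae'⟩, ⟨hvc, hvd, hve⟩, ⟨hcd', hce'⟩, hde', by simp⟩
    · simp only [List.mem_cons, List.not_mem_nil, or_false, forall_eq_or_imp, forall_eq,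
        Finset.mem_erase]
      exact ⟨⟨hab', ha⟩, ⟨hvb, hv⟩, ⟨Ne.symm hbc', hc⟩, ⟨Ne.symm hbd', hd⟩, ⟨Ne.symm hbe', he⟩⟩
    · simp only [List.pairwise_cons, List.mem_cons, List.not_mem_nil, or_false, forall_eq_or_imp,
        forall_eq]
      exact ⟨⟨ha' _ hva.symm (Or.inl (hs _ _ hra)), ha' _ hac' h1, ha' _ had' h2,
        ha' _ hae' h3⟩, ⟨hc' _ _ hvc hrc, hc' _ _ hvd hrd, hc' _ _ hve hre⟩,
        ⟨hc' _ _ hcd' hcd, hc' _ _ hce' hce⟩, hc' _ _ hde' hde, by simp⟩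

end PlanarBound

section PlaneDrawing

/-- A drawing in the plane of the graph with vertex set `V` and adjacency `r`, in which vertices
and edges are represented by path-connected sets and only edges with a common end may meet. -/
structure IsPlaneDrawing {α : Type*} (V : Finset α) (r : α → α → Prop) (X : α → Set Pt)
    (P : α → α → Set Pt) : Prop where
  symm : ∀ x y, r x y → r y x
  irrefl : ∀ x, ¬ r x x
  vertex_connected : ∀ x ∈ V, IsPathConnected (X x)
  vertex_disjoint : ∀ x ∈ V, ∀ y ∈ V, x ≠ y → Disjoint (X x) (X y)
  edge_connected : ∀ x ∈ V, ∀ y ∈ V, r x y → IsPathConnected (P x y)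
  edge_left : ∀ x ∈ V, ∀ y ∈ V, r x y → (X x ∩ P x y).Nonempty
  edge_right : ∀ x ∈ V, ∀ y ∈ V, r x y → (P x y ∩ X y).Nonempty
  edge_vertex : ∀ x ∈ V, ∀ y ∈ V, r x y → ∀ w ∈ V, w ≠ x → w ≠ y → Disjoint (P x y) (X w)
  edge_edge : ∀ x ∈ V, ∀ y ∈ V, r x y → ∀ w ∈ V, ∀ z ∈ V, r w z → x ≠ w → x ≠ z → y ≠ w → y ≠ z →
    Disjoint (P x y) (P w z)

variable {α : Type*} {V : Finset α} {r : α → α → Prop} {X : α → Set Pt} {P : α → α → Set Pt}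

lemma IsPlaneDrawing.mono (h : IsPlaneDrawing V r X P) {V' : Finset α} {r' : α → α → Prop}
    (hV : V' ⊆ V) (hs : ∀ x y, r' x y → r' y x) (hr : ∀ x y, r' x y → r x y) :
    IsPlaneDrawing V' r' X P where
  symm := hs
  irrefl x hx := h.irrefl x (hr _ _ hx)
  vertex_connected x hx := h.vertex_connected x (hV hx)
  vertex_disjoint x hx y hy := h.vertex_disjoint x (hV hx) y (hV hy)
  edge_connected x hx y hy hxy := h.edge_connected x (hV hx) y (hV hy) (hr _ _ hxy)
  edge_left x hx y hy hxy := h.edge_left x (hV hx) y (hV hy) (hr _ _ hxy)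
  edge_right x hx y hy hxy := h.edge_right x (hV hx) y (hV hy) (hr _ _ hxy)
  edge_vertex x hx y hy hxy w hw := h.edge_vertex x (hV hx) y (hV hy) (hr _ _ hxy) w (hV hw)
  edge_edge x hx y hy hxy w hw z hz hwz :=
    h.edge_edge x (hV hx) y (hV hy) (hr _ _ hxy) w (hV hw) z (hV hz) (hr _ _ hwz)

lemma IsPlaneDrawing.link_connected (h : IsPlaneDrawing V r X P) {x y : α} (hx : x ∈ V)
    (hy : y ∈ V) (hxy : r x y) : IsPathConnected (X x ∪ P x y ∪ X y) := by
  refine ((h.vertex_connected x hx).union (h.edge_connected x hx y hy hxy)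
    (h.edge_left x hx y hy hxy)).union (h.vertex_connected y hy) ?_
  exact (h.edge_right x hx y hy hxy).mono (inter_subset_inter_left _ subset_union_right)

open Classical in
lemma IsPlaneDrawing.contract (h : IsPlaneDrawing V r X P) {u v : α} (hu : u ∈ V) (hv : v ∈ V)
    (huv : r u v) :
    IsPlaneDrawing (V.erase v) (contractRel r u v)
      (fun x => if x = u then X u ∪ P u v ∪ X v else X x)
      (fun x y => if r x y then P x y else if x = u then P v y else P x v) := by
  have hne : u ≠ v := fun e => h.irrefl v (e ▸ huv)
  have hd : ∀ w ∈ V, w ≠ u → w ≠ v → Disjoint (X u ∪ P u v ∪ X v) (X w) := by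
    intro w hw hwu hwv
    rw [disjoint_union_left, disjoint_union_left]
    exact ⟨⟨h.vertex_disjoint _ hu _ hw hwu.symm, h.edge_vertex _ hu _ hv huv w hw hwu hwv⟩,
      h.vertex_disjoint _ hv _ hw hwv.symm⟩
  have hX : ∀ x, X x ⊆ if x = u then X u ∪ P u v ∪ X v else X x := by
    intro x; split_ifs with e
    · rw [e]; exact subset_union_left.trans subset_union_left
    · rfl
  have hP : ∀ x ∈ V.erase v, ∀ y ∈ V.erase v, contractRel r u v x y → ∃ x' ∈ V, ∃ y' ∈ V,
      (if r x y then P x y else if x = u then P v y else P x v) = P x' y' ∧ r x' y' ∧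
      (x' = x ∨ x = u ∧ x' = v) ∧ (y' = y ∨ y = u ∧ y' = v) := by
    intro x hx y hy hxy
    have hx' := Finset.mem_of_mem_erase hx
    have hy' := Finset.mem_of_mem_erase hy
    by_cases h1 : r x y
    · exact ⟨x, hx', y, hy', by rw [if_pos h1], h1, by simp, by simp⟩
    · by_cases h2 : x = u
      · have h3 : r v y := by
          rcases hxy.2 with h3 | h3 | h3
          · exact absurd h3 h1
          · exact h3.2
          · exact absurd (h2.trans h3.1.symm) hxy.1
        exact ⟨v, hv, y, hy', by rw [if_neg h1, if_pos h2], h3, by simp [h2], by simp⟩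
      · have h3 : y = u ∧ r x v := by
          rcases hxy.2 with h3 | h3 | h3
          · exact absurd h3 h1
          · exact absurd h3.1 h2
          · exact h3
        exact ⟨x, hx', v, hv, by rw [if_neg h1, if_neg h2], h3.2, by simp, by simp [h3.1]⟩
  refine ⟨?_, ?_, ?_, ?_, ?_, ?_, ?_, ?_, ?_⟩
  · rintro x y ⟨h1, h2 | h2 | h2⟩
    · exact ⟨h1.symm, Or.inl (h.symm _ _ h2)⟩
    · exact ⟨h1.symm, Or.inr (Or.inr ⟨h2.1, h.symm _ _ h2.2⟩)⟩
    · exact ⟨h1.symm, Or.inr (Or.inl ⟨h2.1, h.symm _ _ h2.2⟩)⟩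
  · exact fun x hx => hx.1 rfl
  · intro x hx
    split_ifs with e
    · exact h.link_connected hu hv huv
    · exact h.vertex_connected x (Finset.mem_of_mem_erase hx)
  · intro x hx y hy hxy
    rw [Finset.mem_erase] at hx hy
    split_ifs with e1 e2 e2
    · exact absurd (e1.trans e2.symm) hxy
    · exact hd y hy.2 e2 hy.1
    · exact (hd x hx.2 e1 hx.1).symm
    · exact h.vertex_disjoint x hx.2 y hy.2 hxy
  · intro x hx y hy hxy
    obtain ⟨x', hx', y', hy', e, hr, -⟩ := hP x hx y hy hxy
    rw [e]; exact h.edge_connected x' hx' y' hy' hr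
  · intro x hx y hy hxy
    obtain ⟨x', hx', y', hy', e, hr, e', -⟩ := hP x hx y hy hxy
    rw [e]
    refine (h.edge_left x' hx' y' hy' hr).mono (inter_subset_inter_left _ ?_)
    rcases e' with rfl | ⟨rfl, rfl⟩
    · exact hX x'
    · rw [if_pos rfl]; exact subset_union_right
  · intro x hx y hy hxy
    obtain ⟨x', hx', y', hy', e, hr, -, e'⟩ := hP x hx y hy hxy
    rw [e]
    refine (h.edge_right x' hx' y' hy' hr).mono (inter_subset_inter_right _ ?_)
    rcases e' with rfl | ⟨rfl, rfl⟩
    · exact hX y'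
    · rw [if_pos rfl]; exact subset_union_right
  · intro x hx y hy hxy w hw hwx hwy
    obtain ⟨x', hx', y', hy', e, hr, e1, e2⟩ := hP x hx y hy hxy
    rw [e]
    rw [Finset.mem_erase] at hx hy hw
    have hwx' : w ≠ x' := by rcases e1 with rfl | ⟨-, rfl⟩; exacts [hwx, hw.1]
    have hwy' : w ≠ y' := by rcases e2 with rfl | ⟨-, rfl⟩; exacts [hwy, hw.1]
    split_ifs with e3
    · subst e3
      rcases e1 with rfl | ⟨h1, -⟩
      rcases e2 with rfl | ⟨h1, -⟩
      · rw [disjoint_union_right, disjoint_union_right]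
        exact ⟨⟨h.edge_vertex _ hx' _ hy' hr _ hw.2 hwx hwy,
          h.edge_edge _ hx' _ hy' hr _ hu _ hv huv hwx.symm hx.1 hwy.symm hy.1⟩,
          h.edge_vertex _ hx' _ hy' hr _ hv hx.1.symm hy.1.symm⟩
      · exact absurd h1.symm hwy
      · exact absurd h1.symm hwx
    · exact h.edge_vertex _ hx' _ hy' hr _ hw.2 hwx' hwy'
  · intro x hx y hy hxy w hw z hz hwz h1 h2 h3 h4
    obtain ⟨x', hx', y', hy', e, hr, e1, e2⟩ := hP x hx y hy hxy
    obtain ⟨w', hw', z', hz', e', hr', e1', e2'⟩ := hP w hw z hz hwz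
    rw [e, e']
    rw [Finset.mem_erase] at hx hy hw hz
    apply h.edge_edge _ hx' _ hy' hr _ hw' _ hz' hr' <;> grind

lemma IsPlaneDrawing.not_K5 (h : IsPlaneDrawing V r X P) (f : Fin 5 → α)
    (hf : ∀ i j, i < j → f i ≠ f j ∧ r (f i) (f j)) (hfV : ∀ i, f i ∈ V) : False := by
  have hne : ∀ i j, i ≠ j → f i ≠ f j := fun i j hij =>
    (lt_or_gt_of_ne hij).elim (fun h => (hf _ _ h).1) fun h => (hf _ _ h).1.symm
  choose p hp using fun i => (h.vertex_connected (f i) (hfV i)).nonempty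
  refine not_K5_planar p (fun i j => X (f i) ∪ P (f i) (f j) ∪ X (f j)) ?_ ?_
  · intro i j hij
    exact (h.link_connected (hfV i) (hfV j) (hf i j hij).2).joinedIn _
      (Or.inl (Or.inl (hp i))) _ (Or.inr (hp j))
  · intro i j k l hij hkl h1 h2 h3 h4
    have hik := hne _ _ h1
    have hil := hne _ _ h2
    have hjk := hne _ _ h3
    have hjl := hne _ _ h4
    have rij := (hf i j hij).2
    have rkl := (hf k l hkl).2
    simp only [disjoint_union_left, disjoint_union_right]
    refine ⟨⟨⟨⟨?_, ?_⟩, ?_⟩, ⟨⟨?_, ?_⟩, ?_⟩⟩, ⟨⟨?_, ?_⟩, ?_⟩⟩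
    all_goals first
      | exact h.vertex_disjoint _ (hfV _) _ (hfV _) (by assumption)
      | exact h.edge_vertex _ (hfV _) _ (hfV _) (by assumption) _ (hfV _)
          (Ne.symm (by assumption)) (Ne.symm (by assumption))
      | exact (h.edge_vertex _ (hfV _) _ (hfV _) (by assumption) _ (hfV _)
          (by assumption) (by assumption)).symm
      | exact h.edge_edge _ (hfV _) _ (hfV _) rij _ (hfV _) _ (hfV _) rkl hik hil hjk hjl

lemma IsPlaneDrawing.card_relPairs_le (h : IsPlaneDrawing V r X P) (hV : 2 ≤ V.card) :
    (relPairs V r).card + 10 ≤ 6 * V.card := by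
  classical
  refine card_relPairs_le_of_minor_closed (fun V r => ∃ X P, IsPlaneDrawing V r X P)
    ?_ ?_ ?_ ?_ ?_ V r ⟨X, P, h⟩ hV
  · rintro V r ⟨X, P, h⟩; exact ⟨h.symm, h.irrefl⟩
  · rintro V r r' ⟨X, P, h⟩ hs hr; exact ⟨X, P, h.mono (Finset.Subset.refl V) hs hr⟩
  · rintro V r v ⟨X, P, h⟩; exact ⟨X, P, h.mono (Finset.erase_subset _ _) h.symm fun _ _ h => h⟩
  · rintro V r u v ⟨X, P, h⟩ hu hv huv; exact ⟨_, _, h.contract hu hv huv⟩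
  · rintro V r a b c d e ⟨X, P, h⟩ hnd hmem hp
    refine h.not_K5 (fun i => [a, b, c, d, e].get i) (fun i j hij => ⟨?_, ?_⟩)
      fun i => hmem _ (List.get_mem _ _)
    · exact fun e => hij.ne (List.nodup_iff_injective_get.1 hnd e)
    · exact List.pairwise_iff_get.1 hp i j hij

/-- The number of edges of a graph drawn in the plane, in terms of the number of vertices. -/
theorem card_edges_add_five_le {V K : Type*} [Fintype V] [Fintype K] (a b : K → V)
    (hab : ∀ k, a k ≠ b k) (hinj : ∀ k l, s(a k, b k) = s(a l, b l) → k = l)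
    (X : V → Set Pt) (P : K → Set Pt) (hX : ∀ v, IsPathConnected (X v))
    (hXX : ∀ v w, v ≠ w → Disjoint (X v) (X w)) (hP : ∀ k, IsPathConnected (P k))
    (hPa : ∀ k, (X (a k) ∩ P k).Nonempty) (hPb : ∀ k, (P k ∩ X (b k)).Nonempty)
    (hPX : ∀ k w, w ≠ a k → w ≠ b k → Disjoint (P k) (X w))
    (hPP : ∀ k l, a k ≠ a l → a k ≠ b l → b k ≠ a l → b k ≠ b l → Disjoint (P k) (P l))
    (hV : 2 ≤ Fintype.card V) : Fintype.card K + 5 ≤ 3 * Fintype.card V := by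
  classical
  set r : V → V → Prop := fun x y => ∃ k, s(a k, b k) = s(x, y)
  have hk : ∀ x y, r x y → ∃ k, (a k = x ∧ b k = y ∨ a k = y ∧ b k = x) := by
    rintro x y ⟨k, hk⟩; exact ⟨k, by simpa using hk⟩
  set Q : V → V → Set Pt := fun x y => if h : r x y then P (hk x y h).choose else ∅ with hQ
  have hQ' : ∀ x y, r x y → ∃ k, (a k = x ∧ b k = y ∨ a k = y ∧ b k = x) ∧ Q x y = P k := by
    intro x y h
    exact ⟨_, (hk x y h).choose_spec, by rw [hQ]; simp only [dif_pos h]⟩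
  have hdraw : IsPlaneDrawing Finset.univ r X Q := by
    refine ⟨?_, ?_, fun x _ => hX x, fun x _ y _ => hXX x y, ?_, ?_, ?_, ?_, ?_⟩
    · rintro x y ⟨k, hk⟩; exact ⟨k, hk.trans Sym2.eq_swap⟩
    · rintro x ⟨k, hk⟩
      have : a k = x ∧ b k = x := by simpa using hk
      exact hab k (this.1.trans this.2.symm)
    · rintro x - y - h
      obtain ⟨k, -, e⟩ := hQ' x y h
      rw [e]; exact hP k
    · rintro x - y - h
      obtain ⟨k, ⟨rfl, rfl⟩ | ⟨rfl, rfl⟩, e⟩ := hQ' x y h <;> rw [e]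
      · exact hPa k
      · rw [inter_comm]; exact hPb k
    · rintro x - y - h
      obtain ⟨k, ⟨rfl, rfl⟩ | ⟨rfl, rfl⟩, e⟩ := hQ' x y h <;> rw [e]
      · exact hPb k
      · rw [inter_comm]; exact hPa k
    · rintro x - y - h w - hwx hwy
      obtain ⟨k, ⟨rfl, rfl⟩ | ⟨rfl, rfl⟩, e⟩ := hQ' x y h <;> rw [e]
      · exact hPX k w hwx hwy
      · exact hPX k w hwy hwx
    · rintro x - y - h w - z - h' h1 h2 h3 h4
      obtain ⟨k, ⟨rfl, rfl⟩ | ⟨rfl, rfl⟩, e⟩ := hQ' x y h <;>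
      obtain ⟨l, ⟨rfl, rfl⟩ | ⟨rfl, rfl⟩, e'⟩ := hQ' w z h' <;> rw [e, e']
      · exact hPP k l h1 h2 h3 h4
      · exact hPP k l h2 h1 h4 h3
      · exact hPP k l h3 h4 h1 h2
      · exact hPP k l h4 h3 h2 h1
  have hcard := hdraw.card_relPairs_le (by simpa using hV)
  rw [Finset.card_univ] at hcard
  have hle : (Finset.univ : Finset (K × Bool)).card ≤ (relPairs Finset.univ r).card := by
    refine Finset.card_le_card_of_injOn (fun p => if p.2 then (a p.1, b p.1) else (b p.1, a p.1))
      ?_ ?_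
    · rintro ⟨k, c⟩ -
      rw [Finset.mem_coe, mem_relPairs]
      cases c
      · exact ⟨by simp, k, by simp⟩
      · exact ⟨by simp, k, by simp⟩
    · rintro ⟨k, c⟩ - ⟨l, d⟩ - h
      have hkl : k = l := by
        apply hinj
        cases c <;> cases d <;> simp only [if_true, Bool.false_eq_true, if_false,
          Prod.mk.injEq] at h <;> simp [h.1, h.2]
      subst hkl
      have := hab k
      cases c <;> cases d <;> simp at h ⊢ <;> tauto
  rw [Finset.card_univ, Fintype.card_prod, Fintype.card_bool] at hle
  omega

theorem card_edges_add_two_le {V K : Type*} [Fintype V] [Fintype K] (a b : K → V)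
    (hab : ∀ k, a k ≠ b k) (hinj : ∀ k l, s(a k, b k) = s(a l, b l) → k = l)
    (X : V → Set Pt) (P : K → Set Pt) (hX : ∀ v, IsPathConnected (X v))
    (hXX : ∀ v w, v ≠ w → Disjoint (X v) (X w)) (hP : ∀ k, IsPathConnected (P k))
    (hPa : ∀ k, (X (a k) ∩ P k).Nonempty) (hPb : ∀ k, (P k ∩ X (b k)).Nonempty)
    (hPX : ∀ k w, w ≠ a k → w ≠ b k → Disjoint (P k) (X w))
    (hPP : ∀ k l, a k ≠ a l → a k ≠ b l → b k ≠ a l → b k ≠ b l → Disjoint (P k) (P l))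
    (hV : 1 ≤ Fintype.card V) : Fintype.card K + 2 ≤ 3 * Fintype.card V := by
  rcases hV.lt_or_eq with h | h
  · have := card_edges_add_five_le a b hab hinj X P hX hXX hP hPa hPb hPX hPP h
    omega
  · have hK : IsEmpty K := ⟨fun k => hab k (Fintype.card_le_one_iff.1 h.ge _ _)⟩
    rw [← h, Fintype.card_eq_zero]
    norm_num

end PlaneDrawing

/-- The direction of `q` as seen from `p`. -/
noncomputable def direction (p q : Pt) : Pt := ‖q - p‖⁻¹ • (q - p)

/-- The cross product of two plane vectors. -/
def cross (v w : Pt) : ℝ := v.1 * w.2 - v.2 * w.1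

/-- The Euclidean inner product of two plane vectors. -/
def dot (v w : Pt) : ℝ := v.1 * w.1 + v.2 * w.2

lemma norm_direction {p q : Pt} (h : q ≠ p) : ‖direction p q‖ = 1 := by
  rw [direction, norm_smul, norm_inv, norm_norm,
    inv_mul_cancel₀ (norm_ne_zero_iff.2 (sub_ne_zero.2 h))]

lemma direction_self (p : Pt) : direction p p = 0 := by simp [direction]

lemma direction_smul {p q r : Pt} {t : ℝ} (ht : 0 < t) (h : r - p = t • (q - p)) :
    direction p r = direction p q := by
  rw [direction, direction, h, norm_smul, Real.norm_of_nonneg ht.le, smul_smul,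
    mul_inv, mul_right_comm,
    inv_mul_cancel₀ ht.ne', one_mul]

lemma sub_eq_norm_smul_direction (p q : Pt) : q - p = ‖q - p‖ • direction p q := by
  by_cases h : q = p
  · simp [h]
  · rw [direction, smul_smul, mul_inv_cancel₀ (norm_ne_zero_iff.2 (sub_ne_zero.2 h)), one_smul]

lemma exists_smul_of_direction_eq {p q r : Pt} (hr : r ≠ p) (hq : q ≠ p)
    (h : direction p r = direction p q) : ∃ t : ℝ, 0 < t ∧ r - p = t • (q - p) := by
  have h1 := norm_pos_iff.2 (sub_ne_zero.2 hr)
  have h2 := norm_pos_iff.2 (sub_ne_zero.2 hq)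
  refine ⟨‖r - p‖ * ‖q - p‖⁻¹, by positivity, ?_⟩
  rw [sub_eq_norm_smul_direction p r, h, direction, smul_smul]
  simp [norm_smul, h2.ne']

lemma continuousAt_direction {p q : Pt} (h : q ≠ p) : ContinuousAt (direction p) q := by
  have : ‖q - p‖ ≠ 0 := norm_ne_zero_iff.2 (sub_ne_zero.2 h)
  unfold direction
  fun_prop (disch := assumption)

lemma dot_self_pos {v : Pt} (h : v ≠ 0) : 0 < dot v v := by
  unfold dot
  by_contra! h'
  apply h
  ext
  · simp; nlinarith [mul_self_nonneg v.1, mul_self_nonneg v.2]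
  · simp; nlinarith [mul_self_nonneg v.1, mul_self_nonneg v.2]

lemma dot_smul_eq (v w : Pt) : dot v v • w = dot v w • v + cross v w • (-v.2, v.1) := by
  ext <;> simp [dot, cross] <;> ring

lemma direction_eq_iff_of_dot_pos {p q r : Pt} (h : 0 < dot (q - p) (r - p)) :
    direction p r = direction p q ↔ cross (q - p) (r - p) = 0 := by
  have hq : q ≠ p := by rintro rfl; simp [dot] at h
  have hr : r ≠ p := by rintro rfl; simp [dot] at h
  constructor
  · intro h'
    obtain ⟨t, -, ht⟩ := exists_smul_of_direction_eq hr hq h'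
    rw [ht]; simp [cross]; ring
  · intro h'
    have h0 := dot_self_pos (sub_ne_zero.2 hq)
    have h1 := dot_smul_eq (q - p) (r - p)
    rw [h', zero_smul, add_zero] at h1
    refine direction_smul (t := (dot (q - p) (q - p))⁻¹ * dot (q - p) (r - p)) (by positivity) ?_
    rw [mul_smul, ← h1, inv_smul_smul₀ h0.ne']

/-- The set `s` looks like a cone near `p`. -/
def LocallyConicAt (s : Set Pt) (p : Pt) (ε : ℝ) (D : Set Pt) : Prop :=
  D.Finite ∧ ∀ q, q ≠ p → dist q p < ε → (q ∈ s ↔ direction p q ∈ D)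

lemma exists_locallyConicAt_segment (a b p : Pt) :
    ∃ ε > 0, ∃ D, LocallyConicAt (segment ℝ a b) p ε D := by
  by_cases hp : p ∈ segment ℝ a b
  · have hε : ∃ ε > 0, (a ≠ p → ε ≤ dist a p) ∧ (b ≠ p → ε ≤ dist b p) := by
      by_cases ha : a = p <;> by_cases hb : b = p
      · exact ⟨1, one_pos, by simp [ha], by simp [hb]⟩
      · exact ⟨dist b p, dist_pos.2 hb, by simp [ha], by simp⟩
      · exact ⟨dist a p, dist_pos.2 ha, by simp, by simp [hb]⟩
      · exact ⟨min (dist a p) (dist b p), lt_min (dist_pos.2 ha) (dist_pos.2 hb), by simp, by simp⟩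
    obtain ⟨ε, hε0, h1, h2⟩ := hε
    refine ⟨ε, hε0, {direction p a, direction p b}, by simp, fun q hq hqε => ⟨fun h => ?_, ?_⟩⟩
    · obtain ⟨s, t, hs, ht, hst, rfl⟩ := hp
      obtain ⟨s', t', hs', ht', hst', rfl⟩ := h
      rcases lt_trichotomy t t' with hlt | rfl | hlt
      · right
        have h1t : 0 < 1 - t := by linarith
        refine direction_smul (t := (t' - t) / (1 - t)) (div_pos (by linarith) h1t) ?_
        obtain rfl : s = 1 - t := by linarith
        obtain rfl : s' = 1 - t' := by linarith
        ext <;> simp <;> field_simp <;> ring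
      · exact absurd (by rw [show s' = s by linarith]) hq
      · left
        have h1t : 0 < t := by linarith
        refine direction_smul (t := (t - t') / t) (div_pos (by linarith) h1t) ?_
        obtain rfl : s = 1 - t := by linarith
        obtain rfl : s' = 1 - t' := by linarith
        ext <;> simp <;> field_simp <;> ring
    · have key : ∀ c ∈ segment ℝ a b, (c ≠ p → ε ≤ dist c p) → direction p q = direction p c →
          q ∈ segment ℝ a b := by
        intro c hc hcε h
        have hcp : c ≠ p := by
          rintro rfl
          have := norm_direction hq
          rw [h, direction_self, norm_zero] at this
          exact zero_ne_one this
        obtain ⟨t, ht, h'⟩ := exists_smul_of_direction_eq hq hcp h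
        have ht1 : t ≤ 1 := by
          by_contra! h1
          have h3 : dist q p = t * dist c p := by
            rw [dist_eq_norm, dist_eq_norm, h', norm_smul, Real.norm_of_nonneg ht.le]
          have := hcε hcp
          nlinarith
        have hq' : q = (1 - t) • p + t • c := by
          rw [← sub_add_cancel q p, h']; module
        rw [hq']
        exact convex_segment a b hp hc (by linarith) ht.le (by ring)
      rintro (h | h)
      · exact key a (left_mem_segment ℝ a b) h1 h
      · exact key b (right_mem_segment ℝ a b) h2 h
  · have hc : IsClosed (segment ℝ a b) := by
      rw [← convexHull_pair]; exact (Set.toFinite _).isClosed_convexHull _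
    obtain ⟨ε, hε, h⟩ := Metric.isOpen_iff.1 hc.isOpen_compl p hp
    exact ⟨ε, hε, ∅, by simp, fun q _ hqε => by simpa using h hqε⟩

/-- `s` is a finite union of segments. -/
def IsPolygonal (s : Set Pt) : Prop := ∃ P : Finset (Pt × Pt), s = ⋃ p ∈ P, segment ℝ p.1 p.2

lemma IsPolygonal.exists_locallyConicAt {s : Set Pt} (hs : IsPolygonal s) (p : Pt) :
    ∃ ε > 0, ∃ D, LocallyConicAt s p ε D := by
  classical
  obtain ⟨P, rfl⟩ := hs
  induction P using Finset.induction_on with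
  | empty => exact ⟨1, one_pos, ∅, by simp, by simp⟩
  | insert x P _ ih =>
    obtain ⟨ε, hε, D, hD, h⟩ := ih
    obtain ⟨ε', hε', D', hD', h'⟩ := exists_locallyConicAt_segment x.1 x.2 p
    refine ⟨min ε ε', lt_min hε hε', D' ∪ D, hD'.union hD, fun q hq hqε => ?_⟩
    rw [Finset.set_biUnion_insert, mem_union, mem_union,
      h q hq (hqε.trans_le (min_le_left _ _)), h' q hq (hqε.trans_le (min_le_right _ _))]

lemma IsPolygonal.isClosed {s : Set Pt} (hs : IsPolygonal s) : IsClosed s := by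
  obtain ⟨P, rfl⟩ := hs
  refine P.finite_toSet.isClosed_biUnion fun x _ => ?_
  rw [← convexHull_pair]; exact (Set.toFinite _).isClosed_convexHull _

lemma IsPolygonal.iUnion {ι : Type*} [Finite ι] {s : ι → Set Pt} (hs : ∀ i, IsPolygonal (s i)) :
    IsPolygonal (⋃ i, s i) := by
  classical
  choose P hP using hs
  have := Fintype.ofFinite ι
  refine ⟨Finset.univ.biUnion P, ?_⟩
  ext x
  simp [hP]
  tauto

/-- Near `q` the set `s` is a line with direction `v`. -/
def IsStraightAt (s : Set Pt) (q v : Pt) : Prop :=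
  v ≠ 0 ∧ ∃ δ > 0, ∀ r, dist r q < δ → (r ∈ s ↔ cross v (r - q) = 0)

lemma continuous_dot_sub (v q : Pt) : Continuous fun r : Pt => dot v (r - q) := by
  unfold dot; fun_prop

lemma continuous_cross_sub (v q : Pt) : Continuous fun r : Pt => cross v (r - q) := by
  unfold cross; fun_prop

lemma LocallyConicAt.isStraightAt {s : Set Pt} {p q : Pt} {ε : ℝ} {D : Set Pt}
    (h : LocallyConicAt s p ε D) (hq : q ≠ p) (hqε : dist q p < ε) (hqs : q ∈ s) :
    IsStraightAt s q (q - p) := by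
  refine ⟨sub_ne_zero.2 hq, ?_⟩
  have h1 : ∀ᶠ r in nhds q, r ≠ p := isOpen_ne.mem_nhds hq
  have h2 : ∀ᶠ r in nhds q, dist r p < ε := Metric.isOpen_ball.mem_nhds hqε
  have h3 : ∀ᶠ r in nhds q, 0 < dot (q - p) (r - p) :=
    (isOpen_lt continuous_const (continuous_dot_sub _ _)).mem_nhds
      (dot_self_pos (sub_ne_zero.2 hq))
  have h4 : ∀ᶠ r in nhds q, direction p r ∉ D \ {direction p q} := by
    refine (continuousAt_direction hq).eventually (p := fun d => d ∉ D \ {direction p q}) ?_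
    exact ((h.1.subset sdiff_subset).isClosed.isOpen_compl).mem_nhds (by simp)
  obtain ⟨δ, hδ, h5⟩ := Metric.eventually_nhds_iff.1 (h1.and (h2.and (h3.and h4)))
  refine ⟨δ, hδ, fun r hr => ?_⟩
  obtain ⟨h1, h2, h3, h4⟩ := h5 hr
  have e : cross (q - p) (r - q) = cross (q - p) (r - p) := by simp [cross]; ring
  rw [h.2 r h1 h2, e, ← direction_eq_iff_of_dot_pos h3]
  have hqD := (h.2 q hq hqε).1 hqs
  constructor
  · intro h6; by_contra h7; exact h4 ⟨h6, h7⟩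
  · intro h6; rwa [h6]

/-- A closed set containing all points of an open set off some line contains the open set. -/
lemma subset_of_forall_cross_ne_zero {B K : Set Pt} (hB : IsOpen B) (hK : IsClosed K) {p v : Pt}
    (hv : v ≠ 0) (h : ∀ q ∈ B, cross v (q - p) ≠ 0 → q ∈ K) : B ⊆ K := by
  intro q hq
  by_cases h0 : cross v (q - p) = 0
  · set w : Pt := (-v.2, v.1) with hw
    have hc : Filter.Tendsto (fun t : ℝ => q + t • w) (nhdsWithin 0 (Ioi 0)) (nhds q) := by
      have : Filter.Tendsto (fun t : ℝ => q + t • w) (nhds 0) (nhds (q + (0 : ℝ) • w)) :=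
        (by fun_prop : Continuous fun t : ℝ => q + t • w).tendsto 0
      rw [zero_smul, add_zero] at this
      exact this.mono_left nhdsWithin_le_nhds
    refine hK.mem_of_tendsto hc ?_
    filter_upwards [hc (hB.mem_nhds hq), self_mem_nhdsWithin] with t ht ht0
    apply h _ ht
    have : cross v (q + t • w - p) = cross v (q - p) + t * dot v v := by
      simp [cross, dot, hw]; ring
    rw [this, h0, zero_add]
    exact (mul_pos ht0 (dot_self_pos hv)).ne'
  · exact h q hq h0

lemma convex_cross_pos (v p : Pt) : Convex ℝ {q : Pt | 0 < cross v (q - p)} := by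
  intro x hx y hy a b ha hb hab
  simp only [mem_ofPred_eq, cross] at *
  have : v.1 * ((a • x + b • y - p).2) - v.2 * ((a • x + b • y - p).1) =
      a * (v.1 * (x - p).2 - v.2 * (x - p).1) + b * (v.1 * (y - p).2 - v.2 * (y - p).1) := by
    obtain rfl : a = 1 - b := by linarith
    simp; ring
  rw [this]
  rcases ha.lt_or_eq with ha | rfl
  · nlinarith [mul_pos ha hx, mul_nonneg hb hy.le]
  · obtain rfl : b = 1 := by linarith
    linarith

lemma convex_cross_neg (v p : Pt) : Convex ℝ {q : Pt | cross v (q - p) < 0} := by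
  convert convex_cross_pos (-v) p using 3
  simp [cross]

lemma convex_dot_neg (v p : Pt) : Convex ℝ {q : Pt | dot v (q - p) < 0} := by
  convert convex_cross_pos (-v.2, v.1) p using 3
  simp [cross, dot]
  constructor <;> intro h <;> linarith

/-- A disc minus a radius is connected. -/
lemma isPreconnected_ball_diff_ray {v : Pt} (hv : v ≠ 0) (p : Pt) {ε : ℝ} (hε : 0 < ε) :
    IsPreconnected {q | dist q p < ε ∧ (cross v (q - p) ≠ 0 ∨ dot v (q - p) < 0)} := by
  have hv0 := dot_self_pos hv
  have key : ∀ b : ℝ, ∃ q, ∃ t > 0, dist q p < ε ∧ cross v (q - p) = t * b * dot v v ∧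
      dot v (q - p) < 0 := by
    intro b
    set w : Pt := -v + b • ((-v.2, v.1) : Pt)
    set t := ε / (2 * (‖w‖ + 1))
    have ht : 0 < t := by positivity
    have htw : t * ‖w‖ < ε := by
      rw [div_mul_eq_mul_div, div_lt_iff₀ (by positivity)]
      nlinarith [norm_nonneg w]
    refine ⟨p + t • w, t, ht, by simpa [dist_eq_norm, norm_smul, abs_of_pos ht] using htw, ?_, ?_⟩
    · simp [cross, dot, w]; ring
    · have : dot v (p + t • w - p) = - (t * dot v v) := by simp [dot, w]; ring
      rw [this]; nlinarith [mul_pos ht hv0]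
  have c1 := ((convex_cross_pos v p).inter (convex_ball p ε)).isPreconnected
  have c2 := ((convex_cross_neg v p).inter (convex_ball p ε)).isPreconnected
  have c3 := ((convex_dot_neg v p).inter (convex_ball p ε)).isPreconnected
  obtain ⟨q1, t1, ht1, h1, h1', h1''⟩ := key 1
  obtain ⟨q2, t2, ht2, h2, h2', h2''⟩ := key (-1)
  have p1 : 0 < cross v (q1 - p) := by rw [h1']; nlinarith [mul_pos ht1 hv0]
  have p2 : cross v (q2 - p) < 0 := by rw [h2']; nlinarith [mul_pos ht2 hv0]
  have m2 : q2 ∈ {q | dot v (q - p) < 0} ∩ Metric.ball p ε := ⟨h2'', h2⟩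
  have c13 := IsPreconnected.union q1 (mem_inter p1 (Metric.mem_ball.2 h1))
    (mem_inter h1'' (Metric.mem_ball.2 h1)) c1 c3
  have c := IsPreconnected.union q2 (mem_inter p2 (Metric.mem_ball.2 h2))
    (mem_union_right _ m2) c2 c13
  convert c using 1
  ext q
  simp only [mem_union, mem_inter_iff, Metric.mem_ball, mem_ofPred_eq, ne_iff_lt_or_gt]
  tauto

/-- The boundary of a regular closed set does not lie locally in a single ray. -/
lemma exists_mem_frontier_closure_of_ray {U : Set Pt} (hU : IsOpen U) {p v : Pt}
    (hp : p ∈ frontier (closure U))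
    (hv : v ≠ 0) {ε : ℝ} (hε : 0 < ε) :
    ∃ q ∈ frontier (closure U), dist q p < ε ∧ (cross v (q - p) ≠ 0 ∨ dot v (q - p) < 0) := by
  by_contra! hcon
  set H := {q | dist q p < ε ∧ (cross v (q - p) ≠ 0 ∨ dot v (q - p) < 0)} with hH
  have hHF : H ⊆ interior (closure U) ∪ (closure U)ᶜ := by
    intro q hq
    by_contra h
    have hqf : q ∈ frontier (closure U) := by
      rw [isClosed_closure.frontier_eq]
      simp only [mem_union, mem_compl_iff, not_or, not_not] at h
      exact ⟨h.2, h.1⟩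
    have := hcon q hqf hq.1
    rcases hq.2 with h | h
    · exact h this.1
    · linarith [this.2]
  have hball : ∀ K, IsClosed K → H ⊆ K → Metric.ball p ε ⊆ K := fun K hK h =>
    subset_of_forall_cross_ne_zero Metric.isOpen_ball hK (p := p) hv
      fun q hq h0 => h ⟨hq, Or.inl h0⟩
  rw [isClosed_closure.frontier_eq] at hp
  rcases (isPreconnected_ball_diff_ray hv p hε).subset_or_subset isOpen_interior
    isClosed_closure.isOpen_compl
    (disjoint_compl_right.mono_left interior_subset) hHF with h | h
  · exact hp.2 (mem_interior.2 ⟨_, hball _ isClosed_closure (h.trans interior_subset),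
      Metric.isOpen_ball, Metric.mem_ball_self hε⟩)
  · have h1 : Metric.ball p ε ⊆ Uᶜ :=
      hball _ hU.isClosed_compl (h.trans (compl_subset_compl.2 subset_closure))
    exact (disjoint_compl_left.mono_left h1).symm.closure_left Metric.isOpen_ball |>.le_bot
      ⟨hp.1, Metric.mem_ball_self hε⟩

/-- `U` is a connected component of the complement of `s`. -/
structure IsRegion (s U : Set Pt) : Prop where
  isOpen : IsOpen U
  isConnected : IsConnected U
  disjoint : Disjoint U s
  subset_of_isPreconnected : ∀ c, IsPreconnected c → Disjoint c s → (c ∩ U).Nonempty → c ⊆ U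

lemma isRegion_connectedComponentIn {s : Set Pt} (hs : IsClosed s) {x : Pt} (hx : x ∉ s) :
    IsRegion s (connectedComponentIn sᶜ x) where
  isOpen := hs.isOpen_compl.connectedComponentIn
  isConnected := isConnected_connectedComponentIn_iff.2 hx
  disjoint := disjoint_compl_left.mono_left (connectedComponentIn_subset _ _)
  subset_of_isPreconnected c hc hcs := by
    rintro ⟨y, hyc, hy⟩
    rw [connectedComponentIn_eq hy]
    exact hc.subset_connectedComponentIn hyc (subset_compl_iff_disjoint_right.2 hcs)

namespace IsRegion

variable {s U : Set Pt}

lemma isPathConnected (h : IsRegion s U) : IsPathConnected U :=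
  h.isOpen.isConnected_iff_isPathConnected.1 h.isConnected

lemma subset_or_disjoint (h : IsRegion s U) {c : Set Pt} (hc : IsPreconnected c)
    (hcs : Disjoint c s) : c ⊆ U ∨ Disjoint c U := by
  rw [or_iff_not_imp_right, not_disjoint_iff]
  exact h.subset_of_isPreconnected c hc hcs

lemma closure_subset (h : IsRegion s U) (hs : IsClosed s) : closure U ⊆ U ∪ s := by
  intro x hx
  by_contra hxs
  simp only [mem_union, not_or] at hxs
  obtain ⟨ε, hε, hb⟩ := Metric.isOpen_iff.1 hs.isOpen_compl x hxs.2
  obtain ⟨y, hy⟩ := mem_closure_iff.1 hx _ Metric.isOpen_ball (Metric.mem_ball_self hε)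
  exact hxs.1 (h.subset_of_isPreconnected _ (convex_ball x ε).isPreconnected
    (disjoint_compl_left.mono_left hb) ⟨y, hy⟩ (Metric.mem_ball_self hε))

lemma subset_interior_closure (h : IsRegion s U) : U ⊆ interior (closure U) :=
  h.isOpen.subset_interior_iff.2 subset_closure

lemma frontier_closure_subset (h : IsRegion s U) (hs : IsClosed s) :
    frontier (closure U) ⊆ s := by
  intro x hx
  rw [isClosed_closure.frontier_eq] at hx
  exact (h.closure_subset hs hx.1).resolve_left fun h' => hx.2 (h.subset_interior_closure h')

lemma mem_of_mem_closure (h : IsRegion s U) (hs : IsClosed s) {x : Pt} (hx : x ∈ closure U)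
    (hxs : x ∉ s) : x ∈ U :=
  (h.closure_subset hs hx).resolve_right hxs

end IsRegion

lemma mem_closure_cross_pos_inter {B : Set Pt} (hB : IsOpen B) {v p r : Pt} (hv : v ≠ 0)
    (hr : cross v (r - p) = 0) (hrB : r ∈ B) :
    r ∈ closure ({q | 0 < cross v (q - p)} ∩ B) := by
  set w : Pt := (-v.2, v.1) with hw
  have hc : Filter.Tendsto (fun t : ℝ => r + t • w) (nhdsWithin 0 (Ioi 0)) (nhds r) := by
    have : Filter.Tendsto (fun t : ℝ => r + t • w) (nhds 0) (nhds (r + (0 : ℝ) • w)) :=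
      (by fun_prop : Continuous fun t : ℝ => r + t • w).tendsto 0
    rw [zero_smul, add_zero] at this
    exact this.mono_left nhdsWithin_le_nhds
  refine mem_closure_of_tendsto hc ?_
  filter_upwards [hc (hB.mem_nhds hrB), self_mem_nhdsWithin] with t ht ht0
  refine ⟨?_, ht⟩
  have : cross v (r + t • w - p) = cross v (r - p) + t * dot v v := by
    simp [cross, dot, hw]; ring
  rw [mem_ofPred_eq, this, hr, zero_add]
  exact mul_pos ht0 (dot_self_pos hv)

lemma isOpen_cross_pos (v p : Pt) : IsOpen {q : Pt | 0 < cross v (q - p)} :=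
  isOpen_lt continuous_const (continuous_cross_sub _ _)

lemma cross_neg (v w : Pt) : cross (-v) w = -cross v w := by simp [cross]; ring

/-- Along a straight piece of `s`, membership in the boundary of a region is locally constant. -/
lemma IsStraightAt.exists_mem_frontier_iff {s U : Set Pt} (h : IsRegion s U) {q v : Pt}
    (hq : IsStraightAt s q v) :
    ∃ δ > 0, ∀ r ∈ s, dist r q < δ →
      (r ∈ frontier (closure U) ↔ q ∈ frontier (closure U)) := by
  obtain ⟨hv, δ, hδ, hs⟩ := hq
  refine ⟨δ, hδ, ?_⟩
  have half : ∀ v : Pt, v ≠ 0 → (∀ r, dist r q < δ → (r ∈ s ↔ cross v (r - q) = 0)) →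
      {r | 0 < cross v (r - q)} ∩ Metric.ball q δ ⊆ U ∨
      Disjoint ({r | 0 < cross v (r - q)} ∩ Metric.ball q δ) (closure U) := by
    intro v hv hs
    rcases h.subset_or_disjoint ((convex_cross_pos v q).inter (convex_ball q δ)).isPreconnected
      (by
        rw [Set.disjoint_left]
        rintro r ⟨h1, h2⟩ h3
        exact h1.ne' ((hs r h2).1 h3)) with h | h
    · exact Or.inl h
    · exact Or.inr (h.closure_right ((isOpen_cross_pos v q).inter Metric.isOpen_ball))
  have mixed : ∀ v : Pt, v ≠ 0 → (∀ r, dist r q < δ → (r ∈ s ↔ cross v (r - q) = 0)) →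
      {r | 0 < cross v (r - q)} ∩ Metric.ball q δ ⊆ U →
      Disjoint ({r | 0 < cross (-v) (r - q)} ∩ Metric.ball q δ) (closure U) →
      ∀ r ∈ s, dist r q < δ → r ∈ frontier (closure U) := by
    intro v hv hs h1 h2 r hr hrδ
    have h0 := (hs r hrδ).1 hr
    rw [isClosed_closure.frontier_eq]
    refine ⟨closure_mono h1 (mem_closure_cross_pos_inter Metric.isOpen_ball hv h0 hrδ), ?_⟩
    have := mem_closure_cross_pos_inter (v := -v) (p := q) Metric.isOpen_ball (neg_ne_zero.2 hv)
      (by rw [cross_neg, h0, neg_zero]) (Metric.mem_ball.2 hrδ)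
    intro h3
    obtain ⟨x, hx, hx'⟩ := mem_closure_iff.1 this _ isOpen_interior h3
    exact h2.le_bot ⟨hx', interior_subset hx⟩
  have hs' : ∀ r, dist r q < δ → (r ∈ s ↔ cross (-v) (r - q) = 0) := by
    simpa [cross_neg] using hs
  have hqs : q ∈ s := (hs q (by simpa)).2 (by simp [cross])
  have nz : ∀ r, cross v (r - q) ≠ 0 → 0 < cross v (r - q) ∨ 0 < cross (-v) (r - q) := by
    intro r hr; rw [cross_neg]; rcases hr.lt_or_gt with h | h
    · right; linarith
    · exact Or.inl h
  intro r hr hrδ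
  rcases half v hv hs with h1 | h1 <;> rcases half (-v) (neg_ne_zero.2 hv) hs' with h2 | h2
  · have hb : Metric.ball q δ ⊆ interior (closure U) := by
      refine interior_maximal (subset_of_forall_cross_ne_zero Metric.isOpen_ball isClosed_closure hv
        (p := q) fun x hx hx0 => ?_) Metric.isOpen_ball
      rcases nz x hx0 with h | h
      · exact subset_closure (h1 ⟨h, hx⟩)
      · exact subset_closure (h2 ⟨h, hx⟩)
    rw [isClosed_closure.frontier_eq]
    exact iff_of_false (fun h => h.2 (hb hrδ)) (fun h => h.2 (hb (Metric.mem_ball_self hδ)))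
  · exact iff_of_true (mixed v hv hs h1 h2 r hr hrδ) (mixed v hv hs h1 h2 q hqs (by simpa))
  · have := mixed (-v) (neg_ne_zero.2 hv) hs' h2 (by rwa [neg_neg])
    exact iff_of_true (this r hr hrδ) (this q hqs (by simpa))
  · have hb : Metric.ball q δ ⊆ Uᶜ := by
      refine subset_of_forall_cross_ne_zero Metric.isOpen_ball h.isOpen.isClosed_compl hv
        (p := q) fun x hx hx0 => ?_
      rcases nz x hx0 with h | h
      · exact fun hxU => h1.le_bot ⟨⟨h, hx⟩, subset_closure hxU⟩
      · exact fun hxU => h2.le_bot ⟨⟨h, hx⟩, subset_closure hxU⟩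
    have hd : Disjoint (Metric.ball q δ) (closure U) :=
      (disjoint_compl_left.mono_left hb).closure_right Metric.isOpen_ball
    rw [isClosed_closure.frontier_eq]
    exact iff_of_false (fun h => hd.le_bot ⟨hrδ, h.1⟩)
      (fun h => hd.le_bot ⟨Metric.mem_ball_self hδ, h.1⟩)

/-- A connected subset of a locally conic set that avoids the apex lies on one ray. -/
lemma LocallyConicAt.direction_eq {s : Set Pt} {p : Pt} {ε : ℝ} {D : Set Pt}
    (h : LocallyConicAt s p ε D) {c : Set Pt} (hc : IsPreconnected c)
    (hcs : ∀ q ∈ c, q ∈ s ∧ q ≠ p ∧ dist q p < ε) {q r : Pt} (hq : q ∈ c) (hr : r ∈ c) :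
    direction p q = direction p r := by
  have h1 : IsPreconnected (direction p '' c) :=
    hc.image _ fun x hx => (continuousAt_direction (hcs x hx).2.1).continuousWithinAt
  have h2 : (direction p '' c).Finite := h.1.subset <| by
    rintro _ ⟨x, hx, rfl⟩
    exact (h.2 x (hcs x hx).2.1 (hcs x hx).2.2).1 (hcs x hx).1
  exact h2.countable.isTotallyDisconnected _ Subset.rfl h1 (mem_image_of_mem _ hq)
    (mem_image_of_mem _ hr)

/-- An injective continuous parametrization of an arc is a homeomorphism onto its image. -/
lemma exists_forall_dist_lt_of_injOn {f : ℝ → Pt} (hc : ContinuousOn f (Icc 0 1))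
    (hi : InjOn f (Icc 0 1)) {t : ℝ} (ht : t ∈ Icc (0 : ℝ) 1) {η : ℝ} (hη : 0 < η) :
    ∃ ε > 0, ∀ u ∈ Icc (0 : ℝ) 1, dist (f u) (f t) < ε → |u - t| < η := by
  have hK : IsCompact (Icc (0 : ℝ) 1 ∩ {u | η ≤ |u - t|}) :=
    isCompact_Icc.inter_right (isClosed_le continuous_const (by fun_prop))
  have hcl := (hK.image_of_continuousOn (hc.mono inter_subset_left)).isClosed
  obtain ⟨ε, hε, h⟩ := Metric.isOpen_iff.1 hcl.isOpen_compl (f t) (by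
    rintro ⟨u, ⟨hu, hu'⟩, hut⟩
    obtain rfl := hi hu ht hut
    simp at hu'; linarith)
  refine ⟨ε, hε, fun u hu hd => ?_⟩
  by_contra! h'
  exact h hd ⟨u, ⟨hu, h'⟩, rfl⟩

lemma IsPreconnected.iff_of_locally_iff {α : Type*} [PseudoMetricSpace α] {c : Set α}
    (hc : IsPreconnected c) {P : α → Prop}
    (h : ∀ q ∈ c, ∃ δ > 0, ∀ r ∈ c, dist r q < δ → (P r ↔ P q)) {q r : α} (hq : q ∈ c)
    (hr : r ∈ c) : P q ↔ P r := by
  classical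
  have : ContinuousOn (fun x => decide (P x)) c := by
    intro x hx
    obtain ⟨δ, hδ, h'⟩ := h x hx
    refine ContinuousWithinAt.congr_of_eventuallyEq (f := fun _ => decide (P x))
      continuousWithinAt_const ?_ rfl
    filter_upwards [mem_nhdsWithin_of_mem_nhds (Metric.ball_mem_nhds x hδ), self_mem_nhdsWithin]
      with y hy hyc
    simp [h' y hyc hy]
  simpa using hc.constant this hq hr

/-- A finite family of two-colored polygonal arcs, with a base point that selects a face. -/
structure Arrangement (n : ℕ) where
  f : Fin n → ℝ → Pt
  color : Fin n → Bool
  cont : ∀ i, ContinuousOn (f i) (Icc 0 1)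
  inj : ∀ i, InjOn (f i) (Icc 0 1)
  poly : ∀ i, IsPolygonal (f i '' Icc 0 1)
  same : ∀ i j, i ≠ j → color i = color j → Disjoint (f i '' Icc 0 1) (f j '' Icc 0 1)
  fin : ∀ i j, i ≠ j → (f i '' Icc 0 1 ∩ f j '' Icc 0 1).Finite
  base : Pt
  base_notMem : ∀ i, base ∉ f i '' Icc 0 1

namespace Arrangement

variable {n : ℕ} (A : Arrangement n)

/-- The arcs of the arrangement. -/
def curve (i : Fin n) : Set Pt := A.f i '' Icc 0 1

/-- The union of the arcs. -/
def support : Set Pt := ⋃ i, A.curve i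

/-- The open face. -/
def U : Set Pt := connectedComponentIn A.supportᶜ A.base

/-- The face. -/
def F : Set Pt := closure A.U

/-- The crossing points. -/
def X : Set Pt := {p | ∃ i j, i ≠ j ∧ p ∈ A.curve i ∧ p ∈ A.curve j}

/-- The parameters of end points and crossings. -/
def marks (i : Fin n) : Set ℝ := {t | t ∈ Icc (0 : ℝ) 1 ∧ (t = 0 ∨ t = 1 ∨ A.f i t ∈ A.X)}

lemma curve_subset_support (i : Fin n) : A.curve i ⊆ A.support := subset_iUnion _ i

lemma mem_curve {i : Fin n} {t : ℝ} (ht : t ∈ Icc (0 : ℝ) 1) : A.f i t ∈ A.curve i :=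
  mem_image_of_mem _ ht

lemma mem_support {i : Fin n} {t : ℝ} (ht : t ∈ Icc (0 : ℝ) 1) : A.f i t ∈ A.support :=
  A.curve_subset_support i (A.mem_curve ht)

lemma isPolygonal_support : IsPolygonal A.support := IsPolygonal.iUnion A.poly

lemma isClosed_support : IsClosed A.support := A.isPolygonal_support.isClosed

lemma isClosed_curve (i : Fin n) : IsClosed (A.curve i) := (A.poly i).isClosed

lemma base_notMem_support : A.base ∉ A.support := by
  simp only [support, mem_iUnion, not_exists]
  exact A.base_notMem

lemma isRegion : IsRegion A.support A.U :=
  isRegion_connectedComponentIn A.isClosed_support A.base_notMem_support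

lemma isClosed_F : IsClosed A.F := isClosed_closure

lemma X_finite : A.X.Finite := by
  have : A.X = ⋃ i, ⋃ j, ⋃ _ : i ≠ j, A.curve i ∩ A.curve j := by
    ext p; simp only [X, mem_ofPred_eq, mem_iUnion, exists_prop, mem_inter_iff]
  rw [this]
  exact finite_iUnion fun i => finite_iUnion fun j => finite_iUnion fun h => A.fin i j h

lemma marks_finite (i : Fin n) : (A.marks i).Finite := by
  have h : (Icc (0 : ℝ) 1 ∩ A.f i ⁻¹' A.X).Finite :=
    Finite.of_finite_image (A.X_finite.subset (by rintro _ ⟨t, ht, rfl⟩; exact ht.2))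
      ((A.inj i).mono inter_subset_left)
  refine (h.union (toFinite {0, 1})).subset ?_
  rintro t ⟨ht, h0 | h1 | h2⟩
  · right; simp [h0]
  · right; simp [h1]
  · exact Or.inl ⟨ht, h2⟩

lemma exists_side (i : Fin n) (p : Pt) :
    ∃ η > 0, ∀ t₀ ∈ Icc (0 : ℝ) 1, A.f i t₀ = p →
      (∀ t ∈ Icc (0 : ℝ) 1, t ≠ t₀ → |t - t₀| < η →
        t ∉ A.marks i ∧ ∃ v, IsStraightAt A.support (A.f i t) v) ∧
      ∀ t ∈ Icc (0 : ℝ) 1, ∀ u ∈ Icc (0 : ℝ) 1, |t - t₀| < η → |u - t₀| < η →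
        0 < (t - t₀) * (u - t₀) → direction p (A.f i t) = direction p (A.f i u) ∧
          (A.f i t ∈ frontier A.F ↔ A.f i u ∈ frontier A.F) := by
  by_cases hp : p ∈ A.curve i
  swap
  · exact ⟨1, one_pos, fun t ht h => absurd (h ▸ A.mem_curve ht) hp⟩
  obtain ⟨t₀, ht₀, rfl⟩ := hp
  obtain ⟨ε, hε, D, hD⟩ := A.isPolygonal_support.exists_locallyConicAt (A.f i t₀)
  obtain ⟨η₁, hη₁, h₁⟩ := Metric.continuousOn_iff.1 (A.cont i) t₀ ht₀ ε hε
  obtain ⟨η₂, hη₂, h₂⟩ : ∃ η₂ > 0, ∀ t, |t - t₀| < η₂ → t ≠ t₀ → t ∉ A.marks i := by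
    have := ((A.marks_finite i).subset (sdiff_subset (t := {t₀}))).isClosed.isOpen_compl
    obtain ⟨η, hη, h⟩ := Metric.isOpen_iff.1 this t₀ (by simp)
    exact ⟨η, hη, fun t ht hne htm => h (show dist t t₀ < η from ht) ⟨htm, hne⟩⟩
  have hne : ∀ t ∈ Icc (0 : ℝ) 1, t ≠ t₀ → A.f i t ≠ A.f i t₀ :=
    fun t ht h h' => h (A.inj i ht ht₀ h')
  have hst : ∀ t ∈ Icc (0 : ℝ) 1, t ≠ t₀ → |t - t₀| < min η₁ η₂ →
      ∃ v, IsStraightAt A.support (A.f i t) v := fun t ht h h' =>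
    ⟨_, hD.isStraightAt (hne t ht h) (h₁ t ht (h'.trans_le (min_le_left _ _))) (A.mem_support ht)⟩
  refine ⟨min η₁ η₂, lt_min hη₁ hη₂, fun t₁ ht₁ heq => ?_⟩
  obtain rfl := A.inj i ht₁ ht₀ heq
  refine ⟨fun t ht h h' => ⟨h₂ t (h'.trans_le (min_le_right _ _)) h, hst t ht h h'⟩, ?_⟩
  intro t ht u hu htη huη hpos
  have hI : ∀ x ∈ uIcc t u, x ∈ Icc (0 : ℝ) 1 ∧ x ≠ t₁ ∧ |x - t₁| < min η₁ η₂ := by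
    intro x hx
    rw [mem_uIcc] at hx
    rw [abs_lt] at htη huη ⊢
    refine ⟨?_, ?_, ?_⟩
    · rcases hx with hx | hx <;> constructor <;> linarith [ht.1, ht.2, hu.1, hu.2]
    · rintro rfl
      rcases hx with hx | hx <;> nlinarith
    · rcases hx with hx | hx <;> constructor <;> linarith
  have hc : IsPreconnected (A.f i '' uIcc t u) :=
    isPreconnected_uIcc.image _ ((A.cont i).mono fun x hx => (hI x hx).1)
  have mt : A.f i t ∈ A.f i '' uIcc t u := mem_image_of_mem _ left_mem_uIcc
  have mu : A.f i u ∈ A.f i '' uIcc t u := mem_image_of_mem _ right_mem_uIcc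
  refine ⟨hD.direction_eq hc ?_ mt mu, hc.iff_of_locally_iff (P := (· ∈ frontier A.F)) ?_ mt mu⟩
  · rintro _ ⟨x, hx, rfl⟩
    obtain ⟨hx1, hx2, hx3⟩ := hI x hx
    exact ⟨A.mem_support hx1, hne x hx1 hx2, h₁ x hx1 (hx3.trans_le (min_le_left _ _))⟩
  · rintro _ ⟨x, hx, rfl⟩
    obtain ⟨hx1, hx2, hx3⟩ := hI x hx
    obtain ⟨v, hv⟩ := hst x hx1 hx2 hx3
    obtain ⟨δ, hδ, h⟩ := hv.exists_mem_frontier_iff A.isRegion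
    refine ⟨δ, hδ, ?_⟩
    rintro _ ⟨y, hy, rfl⟩ hd
    exact h _ (A.mem_support (hI y hy).1) hd

lemma frontier_subset_support : frontier A.F ⊆ A.support :=
  A.isRegion.frontier_closure_subset A.isClosed_support

lemma exists_germ (p : Pt) {η : Fin n → ℝ} (hη : ∀ i, 0 < η i) :
    ∃ ε > 0, ∀ q ∈ A.support, dist q p < ε → ∃ i, ∃ t₀ ∈ Icc (0 : ℝ) 1, ∃ t ∈ Icc (0 : ℝ) 1,
      A.f i t₀ = p ∧ A.f i t = q ∧ |t - t₀| < η i := by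
  have : ∀ᶠ q in nhds p, ∀ i, q ∈ A.curve i → ∃ t₀ ∈ Icc (0 : ℝ) 1, ∃ t ∈ Icc (0 : ℝ) 1,
      A.f i t₀ = p ∧ A.f i t = q ∧ |t - t₀| < η i := by
    rw [Filter.eventually_all]
    intro i
    by_cases hp : p ∈ A.curve i
    · obtain ⟨t₀, ht₀, rfl⟩ := hp
      obtain ⟨ε, hε, h⟩ := exists_forall_dist_lt_of_injOn (A.cont i) (A.inj i) ht₀ (hη i)
      filter_upwards [Metric.ball_mem_nhds _ hε]
      rintro _ hq ⟨t, ht, rfl⟩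
      exact ⟨t₀, ht₀, t, ht, rfl, rfl, h t ht hq⟩
    · filter_upwards [(A.isClosed_curve i).isOpen_compl.mem_nhds hp] with q hq hq'
      exact absurd hq' hq
  obtain ⟨ε, hε, h⟩ := Metric.eventually_nhds_iff.1 this
  refine ⟨ε, hε, fun q hq hd => ?_⟩
  obtain ⟨i, hi⟩ := mem_iUnion.1 hq
  exact ⟨i, h hd i hi⟩

/-- A boundary point of the face is approached by boundary points along two different sides. -/
lemma exists_two_sides {p : Pt} (hp : p ∈ frontier A.F) {η : Fin n → ℝ} (hη : ∀ i, 0 < η i) :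
    ∃ i, ∃ t₀ ∈ Icc (0 : ℝ) 1, ∃ t ∈ Icc (0 : ℝ) 1, ∃ j, ∃ u₀ ∈ Icc (0 : ℝ) 1,
      ∃ u ∈ Icc (0 : ℝ) 1, A.f i t₀ = p ∧ A.f j u₀ = p ∧ t ≠ t₀ ∧ u ≠ u₀ ∧
      |t - t₀| < η i ∧ |u - u₀| < η j ∧ A.f i t ∈ frontier A.F ∧ A.f j u ∈ frontier A.F ∧
      (i = j → (t - t₀) * (u - t₀) < 0) := by
  choose κ hκ h using fun i => A.exists_side i p
  have hμ : ∀ i, 0 < min (η i) (κ i) := fun i => lt_min (hη i) (hκ i)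
  obtain ⟨ε, hε, hg⟩ := A.exists_germ p hμ
  obtain ⟨q, hq, hqd, hq'⟩ := exists_mem_frontier_closure_of_ray A.isRegion.isOpen hp
    (v := ((1, 0) : Pt)) (by simp) hε
  have hqp : q ≠ p := by rintro rfl; simp [cross, dot] at hq'
  obtain ⟨r, hr, hrd, hr'⟩ := exists_mem_frontier_closure_of_ray A.isRegion.isOpen hp
    (sub_ne_zero.2 hqp) hε
  have hrp : r ≠ p := by rintro rfl; simp [cross, dot] at hr'
  obtain ⟨i, t₀, ht₀, t, ht, rfl, rfl, htη⟩ := hg q (A.frontier_subset_support hq) hqd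
  obtain ⟨j, u₀, hu₀, u, hu, hu', rfl, huη⟩ := hg r (A.frontier_subset_support hr) hrd
  have hne : t ≠ t₀ := by rintro rfl; exact hqp rfl
  refine ⟨i, t₀, ht₀, t, ht, j, u₀, hu₀, u, hu, rfl, hu', hne, ?_,
    htη.trans_le (min_le_left _ _), huη.trans_le (min_le_left _ _), hq, hr, ?_⟩
  · rintro rfl; exact hrp hu'
  · rintro rfl
    obtain rfl := A.inj i hu₀ ht₀ hu'
    have hne' : u ≠ u₀ := by rintro rfl; exact hrp rfl
    by_contra! h0
    have h1 : 0 < (t - u₀) * (u - u₀) :=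
      h0.lt_of_ne (mul_ne_zero (sub_ne_zero.2 hne) (sub_ne_zero.2 hne')).symm
    have h2 := ((h i u₀ hu₀ rfl).2 t ht u hu (htη.trans_le (min_le_right _ _))
      (huη.trans_le (min_le_right _ _)) h1).1
    obtain ⟨c, hc, hc'⟩ := exists_smul_of_direction_eq hrp hqp h2.symm
    have h3 := dot_self_pos (sub_ne_zero.2 hqp)
    rw [hc'] at hr'
    rcases hr' with hr' | hr'
    · apply hr'; simp [cross]; ring
    · have : dot (A.f i t - A.f i u₀) (c • (A.f i t - A.f i u₀)) =
        c * dot (A.f i t - A.f i u₀) (A.f i t - A.f i u₀) := by simp [dot]; ring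
      rw [this] at hr'
      nlinarith [mul_pos hc h3]

end Arrangement

namespace Arrangement

variable {n : ℕ} (A : Arrangement n)

/-- The mark following `a` on the arc `i`. -/
noncomputable def next (i : Fin n) (a : ℝ) : ℝ := sInf {t | t ∈ A.marks i ∧ a < t}

lemma one_mem_marks (i : Fin n) : (1 : ℝ) ∈ A.marks i := ⟨by simp, by simp⟩

lemma zero_mem_marks (i : Fin n) : (0 : ℝ) ∈ A.marks i := ⟨by simp, by simp⟩

lemma next_mem {i : Fin n} {a : ℝ} (ha : a < 1) : A.next i a ∈ A.marks i ∧ a < A.next i a := by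
  have h : {t | t ∈ A.marks i ∧ a < t}.Finite := (A.marks_finite i).subset fun t ht => ht.1
  exact Set.Nonempty.csInf_mem (s := {t | t ∈ A.marks i ∧ a < t}) ⟨1, A.one_mem_marks i, ha⟩ h

lemma next_le {i : Fin n} {a t : ℝ} (ht : t ∈ A.marks i) (hat : a < t) : A.next i a ≤ t :=
  csInf_le ⟨a, fun _ h => h.2.le⟩ ⟨ht, hat⟩

lemma lt_next {i : Fin n} {a : ℝ} (ha : a < 1) : a < A.next i a := (A.next_mem ha).2

lemma next_mem_marks {i : Fin n} {a : ℝ} (ha : a < 1) : A.next i a ∈ A.marks i := (A.next_mem ha).1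

lemma next_le_one {i : Fin n} {a : ℝ} (ha : a < 1) : A.next i a ≤ 1 := (A.next_mem_marks ha).1.2

lemma notMem_marks {i : Fin n} {a t : ℝ} (ht : t ∈ Ioo a (A.next i a)) : t ∉ A.marks i :=
  fun h => (A.next_le h ht.1).not_gt ht.2

lemma exists_mark_lt {i : Fin n} {t : ℝ} (ht : t ∈ Ioc (0 : ℝ) 1) :
    ∃ a ∈ A.marks i, a < 1 ∧ a < t ∧ t ≤ A.next i a := by
  have h : {u | u ∈ A.marks i ∧ u < t}.Finite := (A.marks_finite i).subset fun u hu => hu.1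
  have hm := Set.Nonempty.csSup_mem (s := {u | u ∈ A.marks i ∧ u < t})
    ⟨0, A.zero_mem_marks i, ht.1⟩ h
  set a := sSup {u | u ∈ A.marks i ∧ u < t}
  have ha : a < 1 := hm.2.trans_le ht.2
  refine ⟨a, hm.1, ha, hm.2, ?_⟩
  by_contra! hlt
  have := le_csSup h.bddAbove ⟨(A.next_mem_marks ha), hlt⟩
  exact this.not_gt (A.lt_next ha)

lemma exists_next_eq {i : Fin n} {t : ℝ} (ht : t ∈ A.marks i) (ht0 : 0 < t) :
    ∃ a ∈ A.marks i, a < 1 ∧ A.next i a = t := by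
  obtain ⟨a, ha, ha1, hat, h⟩ := A.exists_mark_lt (i := i) ⟨ht0, ht.1.2⟩
  exact ⟨a, ha, ha1, (A.next_le ht hat).antisymm h⟩

lemma mark_eq_of_mem_Ioc {i : Fin n} {a b t : ℝ} (ha : a ∈ A.marks i) (hb : b ∈ A.marks i)
    (hat : t ∈ Ioc a (A.next i a)) (hbt : t ∈ Ioc b (A.next i b)) : a = b := by
  rcases lt_trichotomy a b with h | h | h
  · exact absurd (hat.2.trans (A.next_le hb h)) hbt.1.not_ge
  · exact h
  · exact absurd (hbt.2.trans (A.next_le ha h)) hat.1.not_ge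

/-- The gaps between consecutive marks, indexed by their left end. -/
def gapSet : Set (Fin n × ℝ) := {g | g.2 ∈ A.marks g.1 ∧ g.2 < 1}

lemma gapSet_finite : A.gapSet.Finite := by
  refine (finite_iUnion fun i => (A.marks_finite i).image (Prod.mk i)).subset ?_
  rintro ⟨i, a⟩ ⟨h, -⟩
  exact mem_iUnion.2 ⟨i, a, h, rfl⟩

/-- The open arc of a gap. -/
def arc (g : Fin n × ℝ) : Set Pt := A.f g.1 '' Ioo g.2 (A.next g.1 g.2)

variable {A}

lemma gapSet_Icc {g : Fin n × ℝ} (hg : g ∈ A.gapSet) {t : ℝ}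
    (ht : t ∈ Icc g.2 (A.next g.1 g.2)) : t ∈ Icc (0 : ℝ) 1 :=
  ⟨hg.1.1.1.trans ht.1, ht.2.trans (A.next_le_one hg.2)⟩

lemma lt_next_of_gap {g : Fin n × ℝ} (hg : g ∈ A.gapSet) : g.2 < A.next g.1 g.2 := A.lt_next hg.2

lemma eq_of_mem_X {i j : Fin n} {p : Pt} (hp : p ∉ A.X) (hi : p ∈ A.curve i) (hj : p ∈ A.curve j) :
    i = j := by
  by_contra h
  exact hp ⟨i, j, h, hi, hj⟩

lemma arc_subset_curve {g : Fin n × ℝ} (hg : g ∈ A.gapSet) : A.arc g ⊆ A.curve g.1 := by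
  rintro _ ⟨t, ht, rfl⟩
  exact A.mem_curve (gapSet_Icc hg (Ioo_subset_Icc_self ht))

lemma disjoint_arc_X {g : Fin n × ℝ} (hg : g ∈ A.gapSet) : Disjoint (A.arc g) A.X := by
  rw [Set.disjoint_left]
  rintro _ ⟨t, ht, rfl⟩ hX
  exact A.notMem_marks ht ⟨gapSet_Icc hg (Ioo_subset_Icc_self ht), Or.inr (Or.inr hX)⟩

lemma isConnected_arc {g : Fin n × ℝ} (hg : g ∈ A.gapSet) : IsConnected (A.arc g) :=
  (isConnected_Ioo (lt_next_of_gap hg)).image _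
    ((A.cont _).mono fun _ ht => gapSet_Icc hg (Ioo_subset_Icc_self ht))

lemma exists_adjacent_gap (i : Fin n) (p : Pt) :
    ∃ η > 0, ∀ t₀ ∈ A.marks i, A.f i t₀ = p → ∀ t ∈ Icc (0 : ℝ) 1, t ≠ t₀ → |t - t₀| < η →
      ∃ a, (i, a) ∈ A.gapSet ∧ t ∈ Ioo a (A.next i a) ∧
        (t₀ < t ∧ a = t₀ ∨ t < t₀ ∧ A.next i a = t₀) := by
  obtain ⟨η, hη, h⟩ := A.exists_side i p
  refine ⟨η, hη, fun t₀ ht₀ hp t ht hne hd => ?_⟩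
  have h' := (h t₀ ht₀.1 hp).1
  rcases hne.lt_or_gt with hlt | hlt
  · have ht0 : 0 < t := by
      rcases ht.1.lt_or_eq with h0 | rfl
      · exact h0
      · exact absurd (A.zero_mem_marks i) (h' 0 ht hne hd).1
    obtain ⟨a, ha, ha1, hat, hta⟩ := A.exists_mark_lt (i := i) ⟨ht0, ht.2⟩
    have e : A.next i a = t₀ := by
      by_contra hne'
      have hle := A.next_le ht₀ (hat.trans hlt)
      refine (h' _ (A.next_mem_marks ha1).1 hne' ?_).1 (A.next_mem_marks ha1)
      rw [abs_lt] at hd ⊢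
      constructor <;> linarith
    exact ⟨a, ⟨ha, ha1⟩, ⟨hat, e ▸ hlt⟩, Or.inr ⟨hlt, e⟩⟩
  · have ht1 : t₀ < 1 := hlt.trans_le ht.2
    refine ⟨t₀, ⟨ht₀, ht1⟩, ⟨hlt, ?_⟩, Or.inl ⟨hlt, rfl⟩⟩
    by_contra! hle
    have h1 := A.lt_next (i := i) ht1
    refine (h' _ (A.next_mem_marks ht1).1 h1.ne' ?_).1 (A.next_mem_marks ht1)
    rw [abs_lt] at hd ⊢
    constructor <;> linarith

/-- Each gap lies in the interior, on the boundary, or outside of the face. -/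
lemma arc_trichotomy {g : Fin n × ℝ} (hg : g ∈ A.gapSet) :
    A.arc g ⊆ interior A.F ∨ A.arc g ⊆ frontier A.F ∨ A.arc g ⊆ A.Fᶜ := by
  have hI : ∀ t ∈ Ioo g.2 (A.next g.1 g.2), t ∈ Icc (0 : ℝ) 1 :=
    fun t ht => gapSet_Icc hg (Ioo_subset_Icc_self ht)
  have hloc : ∀ t ∈ Ioo g.2 (A.next g.1 g.2), ∃ δ > 0, ∀ u ∈ Ioo g.2 (A.next g.1 g.2),
      dist u t < δ → (A.f g.1 u ∈ frontier A.F ↔ A.f g.1 t ∈ frontier A.F) := by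
    intro t ht
    by_cases hfr : A.f g.1 t ∈ frontier A.F
    · choose η hη h using fun i => A.exists_side i (A.f g.1 t)
      obtain ⟨i, t₀, ht₀, t₁, ht₁, j, u₀, hu₀, u, hu, e1, e2, hne, -, hd, hd', hfr1, hfr2, hop⟩ :=
        A.exists_two_sides hfr hη
      have hX := (disjoint_arc_X hg).notMem_of_mem_left (mem_image_of_mem _ ht)
      obtain rfl : i = g.1 := eq_of_mem_X hX (e1 ▸ A.mem_curve ht₀) (A.mem_curve (hI t ht))
      obtain rfl : j = g.1 := eq_of_mem_X hX (e2 ▸ A.mem_curve hu₀) (A.mem_curve (hI t ht))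
      obtain rfl := A.inj _ ht₀ (hI t ht) e1
      obtain rfl := A.inj _ hu₀ (hI _ ht) e2
      have hs := (h g.1 _ hu₀ rfl).2
      refine ⟨η g.1, hη _, fun w hw hwd => iff_of_true ?_ hfr⟩
      by_cases hwu : w = u₀
      · rwa [hwu]
      · by_cases hpos : 0 < (t₁ - u₀) * (w - u₀)
        · exact (hs t₁ ht₁ w (hI w hw) hd hwd hpos).2.1 hfr1
        · have hneg : (t₁ - u₀) * (w - u₀) < 0 :=
            (not_lt.1 hpos).lt_of_ne (mul_ne_zero (sub_ne_zero.2 hne) (sub_ne_zero.2 hwu))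
          have hpos' : 0 < (u - u₀) * (w - u₀) := by
            have := mul_pos_of_neg_of_neg (hop rfl) hneg
            have h0 := mul_self_pos.2 (sub_ne_zero.2 hne)
            by_contra! hcon
            nlinarith
          exact (hs u hu w (hI w hw) hd' hwd hpos').2.1 hfr2
    · have hcont := (A.cont g.1).mono hI t ht
      have := hcont.eventually (isClosed_frontier.isOpen_compl.mem_nhds hfr)
      obtain ⟨δ, hδ, h⟩ := Metric.mem_nhdsWithin_iff.1 this
      exact ⟨δ, hδ, fun u hu hd => iff_of_false (h ⟨hd, hu⟩) hfr⟩
  have hiff := fun t ht u hu => isPreconnected_Ioo.iff_of_locally_iff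
    (P := fun t => A.f g.1 t ∈ frontier A.F) hloc (q := t) (r := u) ht hu
  by_cases hex : ∃ t ∈ Ioo g.2 (A.next g.1 g.2), A.f g.1 t ∈ frontier A.F
  · obtain ⟨t, ht, hfr⟩ := hex
    right; left
    rintro _ ⟨u, hu, rfl⟩
    exact (hiff t ht u hu).1 hfr
  · push Not at hex
    have : A.arc g ⊆ interior A.F ∪ A.Fᶜ := by
      rintro _ ⟨u, hu, rfl⟩
      have h := hex u hu
      rw [A.isClosed_F.frontier_eq] at h
      by_contra h'
      simp only [mem_union, mem_compl_iff, not_or, not_not] at h'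
      exact h ⟨h'.2, h'.1⟩
    rcases (isConnected_arc hg).isPreconnected.subset_or_subset isOpen_interior
      A.isClosed_F.isOpen_compl (disjoint_compl_right.mono_left interior_subset) this with h | h
    · exact Or.inl h
    · exact Or.inr (Or.inr h)

/-- An arc end that is not a crossing does not lie on the boundary of the face. -/
lemma mem_interior_of_end {i : Fin n} {t : ℝ} (ht : t = 0 ∨ t = 1) (hX : A.f i t ∉ A.X)
    (hF : A.f i t ∈ A.F) : A.f i t ∈ interior A.F := by
  by_contra hint
  have hfr : A.f i t ∈ frontier A.F := by rw [A.isClosed_F.frontier_eq]; exact ⟨hF, hint⟩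
  have htI : t ∈ Icc (0 : ℝ) 1 := by rcases ht with rfl | rfl <;> simp
  obtain ⟨i', t₀, ht₀, t₁, ht₁, j, u₀, hu₀, u, hu, e1, e2, hne, hne', -, -, -, -, hop⟩ :=
    A.exists_two_sides hfr (fun _ => one_pos)
  obtain rfl : i' = i := eq_of_mem_X hX (e1 ▸ A.mem_curve ht₀) (A.mem_curve htI)
  obtain rfl : j = i' := eq_of_mem_X hX (e2 ▸ A.mem_curve hu₀) (A.mem_curve htI)
  obtain rfl := A.inj _ ht₀ htI e1
  obtain rfl := A.inj _ hu₀ htI e2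
  have := hop rfl
  rcases ht with rfl | rfl
  · nlinarith [ht₁.1, hu.1]
  · nlinarith [ht₁.2, hu.2]

end Arrangement

namespace Arrangement

variable {n : ℕ} (A : Arrangement n)

/-- The end points of a gap. -/
def ends (g : Fin n × ℝ) : Set Pt := {A.f g.1 g.2, A.f g.1 (A.next g.1 g.2)}

open Classical in
/-- The gaps in the interior of the face. -/
noncomputable def innerGaps : Finset (Fin n × ℝ) :=
  A.gapSet_finite.toFinset.filter fun g => A.arc g ⊆ interior A.F

open Classical in
/-- The gaps on the boundary of the face. -/
noncomputable def outerGaps : Finset (Fin n × ℝ) :=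
  A.gapSet_finite.toFinset.filter fun g => A.arc g ⊆ frontier A.F

open Classical in
/-- The crossings on the boundary of the face. -/
noncomputable def outerCrossings : Finset Pt :=
  A.X_finite.toFinset.filter fun p => p ∈ frontier A.F

open Classical in
/-- The crossings in the interior of the face. -/
noncomputable def innerCrossings : Finset Pt :=
  A.X_finite.toFinset.filter fun p => p ∈ interior A.F

variable {A}

lemma mem_innerGaps {g : Fin n × ℝ} :
    g ∈ A.innerGaps ↔ g ∈ A.gapSet ∧ A.arc g ⊆ interior A.F := by simp [innerGaps]

lemma mem_outerGaps {g : Fin n × ℝ} :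
    g ∈ A.outerGaps ↔ g ∈ A.gapSet ∧ A.arc g ⊆ frontier A.F := by simp [outerGaps]

lemma mem_outerCrossings {p : Pt} : p ∈ A.outerCrossings ↔ p ∈ A.X ∧ p ∈ frontier A.F := by
  simp [outerCrossings]

lemma mem_innerCrossings {p : Pt} : p ∈ A.innerCrossings ↔ p ∈ A.X ∧ p ∈ interior A.F := by
  simp [innerCrossings]

lemma arc_subset_of_mem_frontier {g : Fin n × ℝ} (hg : g ∈ A.gapSet) {p : Pt} (hp : p ∈ A.arc g)
    (hF : p ∈ frontier A.F) : A.arc g ⊆ frontier A.F := by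
  rw [A.isClosed_F.frontier_eq] at hF
  rcases arc_trichotomy hg with h | h | h
  · exact absurd (h hp) hF.2
  · exact h
  · exact absurd hF.1 (h hp)

lemma card_outerCrossings_le : A.outerCrossings.card ≤ A.outerGaps.card := by
  classical
  have key := Finset.card_mul_le_card_mul (fun p g => p ∈ A.ends g) (s := A.outerCrossings)
    (t := A.outerGaps) (m := 2) (n := 2) ?_ ?_
  · omega
  · intro p hp
    obtain ⟨hX, hfr⟩ := mem_outerCrossings.1 hp
    choose η hη h using fun i => A.exists_adjacent_gap i p
    obtain ⟨i, t₀, ht₀, t, ht, j, u₀, hu₀, u, hu, e1, e2, hne, hne', hd, hd', hfr1, hfr2, hop⟩ :=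
      A.exists_two_sides hfr hη
    obtain ⟨a, ha, hta, ha'⟩ := h i t₀ ⟨ht₀, by simp [e1, hX]⟩ e1 t ht hne hd
    obtain ⟨b, hb, hub, hb'⟩ := h j u₀ ⟨hu₀, by simp [e2, hX]⟩ e2 u hu hne' hd'
    have hends : ∀ (i : Fin n) (a t t₀ : ℝ), A.f i t₀ = p →
        (t₀ < t ∧ a = t₀ ∨ t < t₀ ∧ A.next i a = t₀) → p ∈ A.ends (i, a) := by
      rintro i a t t₀ rfl (⟨-, rfl⟩ | ⟨-, rfl⟩) <;> simp [ends]
    have hdist : (i, a) ≠ (j, b) := by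
      intro heq
      obtain ⟨rfl, rfl⟩ := Prod.ext_iff.1 heq
      dsimp only at *
      obtain rfl := A.inj _ ht₀ hu₀ (e1.trans e2.symm)
      have := hop rfl
      have hl := lt_next_of_gap ha
      dsimp only at hl
      rcases ha' with ⟨h1, h2⟩ | ⟨h1, h2⟩ <;> rcases hb' with ⟨h3, h4⟩ | ⟨h3, h4⟩ <;> nlinarith
    refine (Finset.card_pair hdist).symm.trans_le (Finset.card_le_card ?_)
    intro g hg
    rw [Finset.mem_bipartiteAbove, mem_outerGaps]
    simp only [Finset.mem_insert, Finset.mem_singleton] at hg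
    rcases hg with rfl | rfl
    · exact ⟨⟨ha, arc_subset_of_mem_frontier ha (mem_image_of_mem _ hta) hfr1⟩,
        hends _ _ _ _ e1 ha'⟩
    · exact ⟨⟨hb, arc_subset_of_mem_frontier hb (mem_image_of_mem _ hub) hfr2⟩,
        hends _ _ _ _ e2 hb'⟩
  · intro g _
    refine le_trans (Finset.card_le_card ?_)
      (Finset.card_le_two (a := A.f g.1 g.2) (b := A.f g.1 (A.next g.1 g.2)))
    intro p hp
    rw [Finset.mem_bipartiteBelow] at hp
    simpa [ends] using hp.2

end Arrangement

lemma eq_or_eq_of_isConnected_diff {f : ℝ → Pt} (hc : ContinuousOn f (Icc 0 1))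
    (hi : InjOn f (Icc 0 1)) {t : ℝ} (ht : t ∈ Icc (0 : ℝ) 1)
    (h : IsPreconnected (f '' Icc 0 1 \ {f t})) : t = 0 ∨ t = 1 := by
  by_contra! hcon
  have h0 : 0 < t := lt_of_le_of_ne ht.1 hcon.1.symm
  have h1 : t < 1 := lt_of_le_of_ne ht.2 hcon.2
  have hcl : ∀ a b : ℝ, 0 ≤ a → b ≤ 1 → IsClosed (f '' Icc a b) := fun a b ha hb =>
    (isCompact_Icc.image_of_continuousOn (hc.mono (Icc_subset_Icc ha hb))).isClosed
  have m0 : (0 : ℝ) ∈ Icc (0 : ℝ) 1 := by simp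
  have m1 : (1 : ℝ) ∈ Icc (0 : ℝ) 1 := by simp
  obtain ⟨x, hx, ⟨u, hu, rfl⟩, v, hv, huv⟩ := isPreconnected_closed_iff.1 h _ _
    (hcl 0 t le_rfl h1.le) (hcl t 1 h0.le le_rfl) (by
      rintro _ ⟨⟨u, hu, rfl⟩, -⟩
      rcases le_total u t with h | h
      · exact Or.inl ⟨u, ⟨hu.1, h⟩, rfl⟩
      · exact Or.inr ⟨u, ⟨h, hu.2⟩, rfl⟩)
    ⟨f 0, ⟨mem_image_of_mem _ m0, fun h => h0.ne (hi m0 ht h)⟩, 0, ⟨le_rfl, h0.le⟩, rfl⟩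
    ⟨f 1, ⟨mem_image_of_mem _ m1, fun h => h1.ne' (hi m1 ht h)⟩, 1, ⟨h1.le, le_rfl⟩, rfl⟩
  obtain rfl := hi ⟨h0.le.trans hv.1, hv.2⟩ ⟨hu.1, hu.2.trans h1.le⟩ huv
  exact hx.2 (by rw [mem_singleton_iff, le_antisymm hu.2 hv.1])

lemma eq_or_eq_of_isEndpoint {f : ℝ → Pt} (hc : ContinuousOn f (Icc 0 1))
    (hi : InjOn f (Icc 0 1)) {t : ℝ} (ht : t ∈ Icc (0 : ℝ) 1)
    (h : IsEndpoint (f '' Icc 0 1) (f t)) : t = 0 ∨ t = 1 := by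
  obtain ⟨g, hgc, hgi, hs, hg⟩ := h
  refine eq_or_eq_of_isConnected_diff hc hi ht ?_
  have key : ∀ c ∈ Icc (0 : ℝ) 1, IsPreconnected (Icc (0 : ℝ) 1 \ {c}) →
      IsPreconnected (g '' Icc 0 1 \ {g c}) := by
    intro c hcI hcp
    have : g '' Icc 0 1 \ {g c} = g '' (Icc 0 1 \ {c}) := by
      rw [hgi.image_sdiff_subset (by simpa using hcI), image_singleton]
    rw [this]
    exact hcp.image _ (hgc.mono sdiff_subset)
  rw [hs]
  rcases hg with hg | hg <;> rw [hg]
  · refine key 0 (by simp) ?_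
    rw [Icc_sdiff_left]; exact isPreconnected_Ioc
  · refine key 1 (by simp) ?_
    rw [Icc_sdiff_right]; exact isPreconnected_Ico

namespace Arrangement

variable {n : ℕ} {A : Arrangement n}

lemma mem_arrVertices_iff {i : Fin n} {t : ℝ} (ht : t ∈ Icc (0 : ℝ) 1) :
    A.f i t ∈ ArrVertices A.curve ↔ t ∈ A.marks i := by
  constructor
  · rintro (⟨j, hj⟩ | h)
    · by_cases hX : A.f i t ∈ A.X
      · exact ⟨ht, Or.inr (Or.inr hX)⟩
      · have hmem : A.f i t ∈ A.curve j := by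
          obtain ⟨g, -, -, hs, hg⟩ := hj
          rw [hs]
          rcases hg with hg | hg <;> rw [hg] <;> exact mem_image_of_mem _ (by simp)
        obtain rfl := eq_of_mem_X hX hmem (A.mem_curve ht)
        rcases eq_or_eq_of_isEndpoint (A.cont _) (A.inj _) ht hj with h | h
        · exact ⟨ht, Or.inl h⟩
        · exact ⟨ht, Or.inr (Or.inl h)⟩
    · exact ⟨ht, Or.inr (Or.inr h)⟩
  · rintro ⟨-, h | h | h⟩
    · exact Or.inl ⟨i, A.f i, A.cont i, A.inj i, rfl, Or.inl (by rw [h])⟩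
    · exact Or.inl ⟨i, A.f i, A.cont i, A.inj i, rfl, Or.inr (by rw [h])⟩
    · exact Or.inr h

lemma isClosed_image_Icc (i : Fin n) {a b : ℝ} (ha : 0 ≤ a) (hb : b ≤ 1) :
    IsClosed (A.f i '' Icc a b) :=
  (isCompact_Icc.image_of_continuousOn ((A.cont i).mono (Icc_subset_Icc ha hb))).isClosed

lemma connectedComponentIn_eq_arc {g : Fin n × ℝ} (hg : g ∈ A.gapSet) {x : Pt}
    (hx : x ∈ A.arc g) :
    connectedComponentIn (A.support \ ArrVertices A.curve) x = A.arc g := by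
  obtain ⟨i, a⟩ := g
  have hI : ∀ t ∈ Icc a (A.next i a), t ∈ Icc (0 : ℝ) 1 := fun t ht => gapSet_Icc hg ht
  have hlt : a < A.next i a := lt_next_of_gap hg
  have ha0 : 0 ≤ a := hg.1.1.1
  have hb1 : A.next i a ≤ 1 := A.next_le_one hg.2
  have hsub : A.arc (i, a) ⊆ A.support \ ArrVertices A.curve := by
    rintro _ ⟨t, ht, rfl⟩
    have := hI t (Ioo_subset_Icc_self ht)
    exact ⟨A.mem_support this, fun h => A.notMem_marks ht ((mem_arrVertices_iff this).1 h)⟩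
  refine Subset.antisymm ?_
    ((isConnected_arc hg).isPreconnected.subset_connectedComponentIn hx hsub)
  set c := connectedComponentIn (A.support \ ArrVertices A.curve) x
  have hcs : c ⊆ A.support \ ArrVertices A.curve := connectedComponentIn_subset _ _
  have hxc : x ∈ c := mem_connectedComponentIn (hsub hx)
  set K := A.f i '' Icc a (A.next i a) with hK
  set K' := (⋃ j, ⋃ _ : j ≠ i, A.curve j) ∪ (A.f i '' Icc 0 a ∪ A.f i '' Icc (A.next i a) 1)
  have hKK : ∀ y ∈ K, y ∈ K' → y ∈ ArrVertices A.curve := by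
    rintro _ ⟨t, ht, rfl⟩ hy
    have htI := hI t ht
    rw [mem_arrVertices_iff htI]
    rcases hy with hy | ⟨u, hu, hut⟩ | ⟨u, hu, hut⟩
    · simp only [mem_iUnion] at hy
      obtain ⟨j, hj, hy⟩ := hy
      exact ⟨htI, Or.inr (Or.inr ⟨j, i, hj, hy, A.mem_curve htI⟩)⟩
    · obtain rfl := A.inj i ⟨hu.1, hu.2.trans hg.2.le⟩ htI hut
      obtain rfl : u = a := le_antisymm hu.2 ht.1
      exact hg.1
    · obtain rfl := A.inj i ⟨htI.1.trans (ht.2.trans hu.1), hu.2⟩ htI hut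
      obtain rfl : u = A.next i a := le_antisymm ht.2 hu.1
      exact A.next_mem_marks hg.2
  have hcov : A.support ⊆ K ∪ K' := by
    intro y hy
    obtain ⟨j, hj⟩ := mem_iUnion.1 hy
    by_cases hji : j = i
    · subst hji
      obtain ⟨t, ht, rfl⟩ := hj
      by_cases h1 : t ≤ a
      · exact Or.inr (Or.inr (Or.inl ⟨t, ⟨ht.1, h1⟩, rfl⟩))
      · by_cases h2 : A.next j a ≤ t
        · exact Or.inr (Or.inr (Or.inr ⟨t, ⟨h2, ht.2⟩, rfl⟩))
        · exact Or.inl ⟨t, ⟨(not_le.1 h1).le, (not_le.1 h2).le⟩, rfl⟩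
    · exact Or.inr (Or.inl (mem_iUnion₂.2 ⟨j, hji, hj⟩))
  have hK'c : IsClosed K' :=
    (isClosed_iUnion_of_finite fun j => isClosed_iUnion_of_finite fun _ => A.isClosed_curve j).union
      ((isClosed_image_Icc i le_rfl hg.2.le).union
        (isClosed_image_Icc i (ha0.trans hlt.le) le_rfl))
  have hdisj : Disjoint c K' := by
    by_contra hcon
    obtain ⟨y, hyc, hyK'⟩ := not_disjoint_iff.1 hcon
    obtain ⟨z, hz, hzK, hzK'⟩ := isPreconnected_closed_iff.1 isPreconnected_connectedComponentIn
      K K'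
      (isClosed_image_Icc i ha0 hb1) hK'c (fun z hz => hcov (hcs hz).1)
      ⟨x, hxc, image_mono Ioo_subset_Icc_self hx⟩ ⟨y, hyc, hyK'⟩
    exact (hcs hz).2 (hKK z hzK hzK')
  intro y hy
  obtain ⟨t, ht, rfl⟩ := (hcov (hcs hy).1).resolve_right (hdisj.notMem_of_mem_left hy)
  have hnm := (mem_arrVertices_iff (hI t ht)).not.1 (hcs hy).2
  refine ⟨t, ⟨lt_of_le_of_ne ht.1 ?_, lt_of_le_of_ne ht.2 ?_⟩, rfl⟩
  · rintro rfl; exact hnm hg.1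
  · rintro rfl; exact hnm (A.next_mem_marks hg.2)

lemma exists_gap_of_notMem_marks {i : Fin n} {t : ℝ} (ht : t ∈ Icc (0 : ℝ) 1)
    (h : t ∉ A.marks i) : ∃ a, (i, a) ∈ A.gapSet ∧ t ∈ Ioo a (A.next i a) := by
  have ht0 : 0 < t := lt_of_le_of_ne ht.1 (by rintro rfl; exact h (A.zero_mem_marks i))
  obtain ⟨a, ha, ha1, hat, hta⟩ := A.exists_mark_lt (i := i) ⟨ht0, ht.2⟩
  refine ⟨a, ⟨ha, ha1⟩, hat, lt_of_le_of_ne hta ?_⟩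
  rintro rfl
  exact h (A.next_mem_marks ha1)

lemma arrEdges_eq : ArrEdges A.curve = (fun g => closure (A.arc g)) '' A.gapSet := by
  ext e
  constructor
  · rintro ⟨x, ⟨hx, hxV⟩, rfl⟩
    obtain ⟨i, t, ht, rfl⟩ := mem_iUnion.1 hx
    obtain ⟨a, ha, hta⟩ := exists_gap_of_notMem_marks ht ((mem_arrVertices_iff ht).not.1 hxV)
    refine ⟨_, ha, ?_⟩
    dsimp only
    rw [← connectedComponentIn_eq_arc ha (mem_image_of_mem _ hta)]
    rfl
  · rintro ⟨g, hg, rfl⟩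
    obtain ⟨x, hx⟩ := (isConnected_arc hg).nonempty
    have := connectedComponentIn_eq_arc hg hx
    have hx' : x ∈ A.support \ ArrVertices A.curve := by
      by_contra h
      rw [connectedComponentIn_eq_empty h] at this
      exact (this ▸ hx : x ∈ (∅ : Set Pt))
    exact ⟨x, hx', by dsimp only; rw [← this]; rfl⟩

lemma closure_arc_subset {g : Fin n × ℝ} (hg : g ∈ A.gapSet) :
    closure (A.arc g) ⊆ A.f g.1 '' Icc g.2 (A.next g.1 g.2) :=
  closure_minimal (image_mono Ioo_subset_Icc_self)
    (isClosed_image_Icc _ hg.1.1.1 (A.next_le_one hg.2))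

lemma eq_of_mem_arc_of_mem_closure {g g' : Fin n × ℝ} (hg : g ∈ A.gapSet) (hg' : g' ∈ A.gapSet)
    {x : Pt} (hx : x ∈ A.arc g) (hx' : x ∈ closure (A.arc g')) : g = g' := by
  obtain ⟨i, a⟩ := g
  obtain ⟨j, b⟩ := g'
  obtain ⟨u, hu, rfl⟩ := closure_arc_subset hg' hx'
  have huI := gapSet_Icc hg' hu
  obtain rfl : i = j := eq_of_mem_X ((disjoint_arc_X hg).notMem_of_mem_left hx)
    (arc_subset_curve hg hx) (A.mem_curve huI)
  obtain ⟨t, ht, htu⟩ := hx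
  obtain rfl := A.inj _ (gapSet_Icc hg (Ioo_subset_Icc_self ht)) huI htu
  have hne : t ≠ b := by rintro rfl; exact A.notMem_marks ht hg'.1
  exact Prod.ext rfl (A.mark_eq_of_mem_Ioc hg.1 hg'.1 (t := t) (Ioo_subset_Ioc_self ht)
    ⟨lt_of_le_of_ne hu.1 hne.symm, hu.2⟩)

lemma card_outerGaps_le : A.outerGaps.card ≤ (FaceEdges A.curve A.F).ncard := by
  have hfin : (FaceEdges A.curve A.F).Finite :=
    ((A.gapSet_finite.image _).subset arrEdges_eq.subset).subset fun _ h => h.1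
  rw [← ncard_coe_finset]
  refine ncard_le_ncard_of_injOn (fun g => closure (A.arc g)) ?_ ?_ hfin
  · intro g hg
    obtain ⟨h1, h2⟩ := mem_outerGaps.1 hg
    exact ⟨arrEdges_eq ▸ mem_image_of_mem _ h1, closure_minimal h2 isClosed_frontier⟩
  · intro g hg g' hg' h
    have h1 := (mem_outerGaps.1 hg).1
    obtain ⟨x, hx⟩ := (isConnected_arc h1).nonempty
    exact eq_of_mem_arc_of_mem_closure h1 (mem_outerGaps.1 hg').1 hx
      ((show closure (A.arc g) = closure (A.arc g') from h) ▸ subset_closure hx)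

end Arrangement

/-- The quarter turn of a plane vector. -/
def perp (v : Pt) : Pt := (-v.2, v.1)

lemma joinedIn_halfPlane (a b q w : Pt) (ha : 0 < dot w (a - q)) (hb : 0 < dot w (b - q)) :
    JoinedIn {r | 0 < dot w (r - q)} a b := by
  have hc : Convex ℝ {r : Pt | 0 < dot w (r - q)} := by
    convert convex_dot_neg (-w) q using 3
    simp [dot]
    constructor <;> intro h <;> linarith
  exact JoinedIn.of_segment_subset (hc.segment_subset ha hb)

lemma segment_dot_nonneg (a q w : Pt) (ha : 0 ≤ dot w (a - q)) :
    ∀ r ∈ segment ℝ q a, 0 ≤ dot w (r - q) := by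
  rintro r ⟨s, t, hs, ht, hst, rfl⟩
  have : dot w (s • q + t • a - q) = t * dot w (a - q) := by
    obtain rfl : s = 1 - t := by linarith
    simp [dot]; ring
  rw [this]; positivity

/-- Two disjoint connections between opposite ends of a cross do not exist. -/
lemma false_of_joinedIn_cross {q v : Pt} (hv : v ≠ 0) {G P : Set Pt}
    (hG : JoinedIn G (q + perp v) (q - perp v)) (hP : JoinedIn P (q + v) (q - v))
    (hd : Disjoint G P) (h1 : Disjoint P (segment ℝ q (q + perp v)))
    (h2 : Disjoint P (segment ℝ q (q - perp v))) (h3 : Disjoint G (segment ℝ q (q + v)))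
    (h4 : Disjoint G (segment ℝ q (q - v))) : False := by
  have hv0 := dot_self_pos hv
  set w := v + perp v with hw
  set z := v - perp v with hz
  set p : Fin 5 → Pt := ![q, q + v, q - v, q + perp v, q - perp v]
  set H : Pt → Set Pt := fun w => {r | 0 < dot w (r - q)}
  set R : Fin 5 → Fin 5 → Set Pt := ![
    ![∅, segment ℝ q (q + v), segment ℝ q (q - v), segment ℝ q (q + perp v),
      segment ℝ q (q - perp v)],
    ![∅, ∅, P, H w, H z], ![∅, ∅, ∅, H (-z), H (-w)], ![∅, ∅, ∅, ∅, G], ![∅, ∅, ∅, ∅, ∅]]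
  have e1 : dot w v = dot v v := by simp [hw, dot, perp]; ring
  have e2 : dot z v = dot v v := by simp [hz, dot, perp]; ring
  have e3 : dot w (perp v) = dot v v := by simp [hw, dot, perp]; ring
  have e4 : dot z (perp v) = - dot v v := by simp [hz, dot, perp]; ring
  have neg : ∀ a b : Pt, dot a (-b) = - dot a b := by intro a b; simp [dot]; ring
  have neg' : ∀ a b : Pt, dot (-a) b = - dot a b := by intro a b; simp [dot]; ring
  have hsep : ∀ a x : Pt, dot a (x - q) ≤ 0 → Disjoint (segment ℝ q x) (H a) := by
    intro a x hx
    rw [Set.disjoint_left]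
    intro r hr hr'
    have := segment_dot_nonneg x q (-a) (by rw [neg']; linarith) r hr
    rw [neg'] at this
    have hr'' : 0 < dot a (r - q) := hr'
    linarith
  have hopp : ∀ a : Pt, Disjoint (H a) (H (-a)) := by
    intro a
    rw [Set.disjoint_left]
    intro r (hr : 0 < dot a (r - q)) (hr' : 0 < dot (-a) (r - q))
    rw [neg'] at hr'
    linarith
  have c1 : dot w (q + v - q) = dot v v := by rw [add_sub_cancel_left, e1]
  have c2 : dot z (q + v - q) = dot v v := by rw [add_sub_cancel_left, e2]
  have c3 : dot w (q + perp v - q) = dot v v := by rw [add_sub_cancel_left, e3]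
  have c4 : dot z (q + perp v - q) = -dot v v := by rw [add_sub_cancel_left, e4]
  have c5 : dot w (q - v - q) = -dot v v := by rw [sub_sub_cancel_left, neg, e1]
  have c6 : dot z (q - v - q) = -dot v v := by rw [sub_sub_cancel_left, neg, e2]
  have c7 : dot w (q - perp v - q) = -dot v v := by rw [sub_sub_cancel_left, neg, e3]
  have c8 : dot z (q - perp v - q) = dot v v := by rw [sub_sub_cancel_left, neg, e4, neg_neg]
  have j := fun a b w => joinedIn_halfPlane a b q w
  have j1 : JoinedIn (H w) (q + v) (q + perp v) := j _ _ _ (by rwa [c1]) (by rwa [c3])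
  have j2 : JoinedIn (H z) (q + v) (q - perp v) := j _ _ _ (by rwa [c2]) (by rwa [c8])
  have j3 : JoinedIn (H (-z)) (q - v) (q + perp v) :=
    j _ _ _ (by rwa [neg', c6, neg_neg]) (by rwa [neg', c4, neg_neg])
  have j4 : JoinedIn (H (-w)) (q - v) (q - perp v) :=
    j _ _ _ (by rwa [neg', c5, neg_neg]) (by rwa [neg', c7, neg_neg])
  have d1 := hsep (-z) (q + v) (by rw [neg', c2]; linarith)
  have d2 := hsep (-w) (q + v) (by rw [neg', c1]; linarith)
  have d3 := hsep w (q - v) (by rw [c5]; linarith)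
  have d4 := hsep z (q - v) (by rw [c6]; linarith)
  have d5 := hsep z (q + perp v) (by rw [c4]; linarith)
  have d6 := hsep (-w) (q + perp v) (by rw [neg', c3]; linarith)
  have d7 := hsep w (q - perp v) (by rw [c7]; linarith)
  have d8 := hsep (-z) (q - perp v) (by rw [neg', c8]; linarith)
  have js := fun x y : Pt => JoinedIn.of_segment_subset (Subset.rfl : segment ℝ x y ⊆ _)
  refine not_K5_planar p R ?_ ?_
  · intro u v huv
    fin_cases u <;> fin_cases v <;> first
      | exact absurd huv (by decide)
      | exact js _ _
      | assumption
  · have main : ∀ u v w z : Fin 5, u < w → u < v → w < z → u ≠ w → u ≠ z → v ≠ w → v ≠ z →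
        Disjoint (R u v) (R w z) := by
      intro u v w z huw huv hwz h1 h2 h3 h4
      fin_cases u <;> fin_cases w <;> first
      | exact absurd huw (by decide)
      | (fin_cases v <;> first
          | exact absurd huv (by decide)
          | exact absurd h3 (by decide)
          | (fin_cases z <;> first
              | exact absurd hwz (by decide)
              | exact absurd h4 (by decide)
              | assumption
              | (apply Disjoint.symm; assumption)
              | exact hopp _))
    intro u v w z huv hwz h1 h2 h3 h4
    rcases lt_or_gt_of_ne h1 with h | h
    · exact main u v w z h huv hwz h1 h2 h3 h4
    · exact (main w z u v h hwz huv h1.symm h3.symm h2.symm h4.symm).symm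

lemma IsOpen.joinedIn_of_isPreconnected {O c : Set Pt} (hO : IsOpen O) (hc : IsPreconnected c)
    (hcO : c ⊆ O) {x y : Pt} (hx : x ∈ c) (hy : y ∈ c) : JoinedIn O x y := by
  have h1 : IsConnected (connectedComponentIn O x) :=
    isConnected_connectedComponentIn_iff.2 (hcO hx)
  have h2 := hO.connectedComponentIn (x := x) |>.isConnected_iff_isPathConnected.1 h1
  have h3 := hc.subset_connectedComponentIn hx hcO
  exact (h2.joinedIn x (h3 hx) y (h3 hy)).mono (connectedComponentIn_subset _ _)

lemma norm_perp (v : Pt) : ‖perp v‖ = ‖v‖ := by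
  simp [perp, Prod.norm_def, max_comm]

lemma exists_smul_of_mem_segment {q w r : Pt} (h : r ∈ segment ℝ q (q + w)) :
    ∃ τ : ℝ, τ ∈ Icc (0 : ℝ) 1 ∧ r = q + τ • w := by
  obtain ⟨s, t, hs, ht, hst, rfl⟩ := h
  refine ⟨t, ⟨ht, by linarith⟩, ?_⟩
  obtain rfl : s = 1 - t := by linarith
  module

/-- Inside a face, the two sides of a straight point are separated along the complement of the
open face. -/
lemma IsRegion.exists_not_both_mem {s U : Set Pt} (hs : IsClosed s) (h : IsRegion s U) {q v : Pt}
    (hq : IsStraightAt s q v) (hqW : q ∈ interior (closure U)) :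
    ∃ ε > 0, ∀ t : ℝ, 0 < t → t < ε → ∀ c, IsPreconnected c →
      c ⊆ (s ∪ (interior (closure U))ᶜ) \ {q} → q + t • v ∈ c → q - t • v ∉ c := by
  obtain ⟨hv, δ₁, hδ₁, hs'⟩ := hq
  obtain ⟨δ₂, hδ₂, hW⟩ := Metric.isOpen_iff.1 isOpen_interior q hqW
  have hvn := norm_pos_iff.2 hv
  have hv0 := dot_self_pos hv
  refine ⟨min δ₁ δ₂ / ‖v‖, div_pos (lt_min hδ₁ hδ₂) hvn, fun t ht htε c hc hcs h1 h2 => ?_⟩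
  rw [lt_div_iff₀ hvn] at htε
  have hball : ∀ w : Pt, ‖w‖ = t * ‖v‖ → ∀ r ∈ segment ℝ q (q + w),
      dist r q < δ₁ ∧ r ∈ interior (closure U) := by
    intro w hw r hr
    obtain ⟨τ, hτ, rfl⟩ := exists_smul_of_mem_segment hr
    have : dist (q + τ • w) q < min δ₁ δ₂ := by
      rw [dist_eq_norm, add_sub_cancel_left, norm_smul, hw, Real.norm_of_nonneg hτ.1]
      have : 0 < t * ‖v‖ := mul_pos ht hvn
      nlinarith [hτ.2]
    exact ⟨this.trans_le (min_le_left _ _), hW (this.trans_le (min_le_right _ _))⟩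
  set w := t • v with hw
  have n1 : ‖w‖ = t * ‖v‖ := by rw [hw, norm_smul, Real.norm_of_nonneg ht.le]
  have n2 : ‖perp w‖ = t * ‖v‖ := by rw [norm_perp, n1]
  have along : ∀ σ : ℝ, ‖σ • w‖ = t * ‖v‖ → segment ℝ q (q + σ • w) ⊆ s := by
    intro σ hσ r hr
    have hr' := hball _ hσ r hr
    obtain ⟨τ, -, rfl⟩ := exists_smul_of_mem_segment hr
    refine (hs' _ hr'.1).2 ?_
    simp [cross, hw]; ring
  have across : ∀ σ : ℝ, σ ≠ 0 → ‖σ • perp w‖ = t * ‖v‖ →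
      ∀ r ∈ segment ℝ q (q + σ • perp w), r ∈ s → r = q := by
    intro σ hσ hσ' r hr hrs
    have hr' := hball _ hσ' r hr
    obtain ⟨τ, -, rfl⟩ := exists_smul_of_mem_segment hr
    have := (hs' _ hr'.1).1 hrs
    have e : cross v (q + τ • σ • perp w - q) = τ * (σ * t * dot v v) := by
      simp [cross, hw, perp, dot]; ring
    rw [e] at this
    rcases mul_eq_zero.1 this with h0 | h0
    · simp [h0]
    · exact absurd h0 (mul_ne_zero (mul_ne_zero hσ ht.ne') hv0.ne')
  have hw0 : w ≠ 0 := smul_ne_zero ht.ne' hv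
  have hp0 : perp w ≠ 0 := by
    intro h0; rw [h0, norm_zero] at n2; exact (mul_pos ht hvn).ne n2
  have hin : ∀ σ : ℝ, σ ≠ 0 → ‖σ • perp w‖ = t * ‖v‖ → q + σ • perp w ∈ U := by
    intro σ hσ hσ'
    refine h.mem_of_mem_closure hs
      (interior_subset (hball _ hσ' _ (right_mem_segment ℝ _ _)).2) fun hmem => ?_
    have := across σ hσ hσ' _ (right_mem_segment ℝ _ _) hmem
    exact smul_ne_zero hσ hp0 (add_eq_left.1 this)
  have e1 : q - w = q + (-1 : ℝ) • w := by module
  have e2 : q - perp w = q + (-1 : ℝ) • perp w := by module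
  have e3 : q + w = q + (1 : ℝ) • w := by module
  have e4 : q + perp w = q + (1 : ℝ) • perp w := by module
  have m1 : ‖(-1 : ℝ) • w‖ = t * ‖v‖ := by simpa using n1
  have m2 : ‖(-1 : ℝ) • perp w‖ = t * ‖v‖ := by simpa using n2
  have m3 : ‖(1 : ℝ) • w‖ = t * ‖v‖ := by simpa using n1
  have m4 : ‖(1 : ℝ) • perp w‖ = t * ‖v‖ := by simpa using n2
  obtain ⟨γ, hγ⟩ := h.isPathConnected.joinedIn _ (hin 1 one_ne_zero m4) _
    (hin (-1) (by norm_num) m2)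
  set O : Set Pt := (range γ ∪ (segment ℝ q (q + (1 : ℝ) • perp w) ∪
    segment ℝ q (q + (-1 : ℝ) • perp w)))ᶜ
  have hsegc : ∀ a b : Pt, IsClosed (segment ℝ a b) := fun a b => by
    rw [← convexHull_pair]; exact (Set.toFinite _).isClosed_convexHull _
  have hOo : IsOpen O := ((isCompact_range γ.continuous).isClosed.union
    ((hsegc _ _).union (hsegc _ _))).isOpen_compl
  have hcO : c ⊆ O := by
    intro x hx hx'
    obtain ⟨hx1, hx2⟩ := hcs hx
    rcases hx' with ⟨y, rfl⟩ | hx' | hx'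
    · rcases hx1 with hx1 | hx1
      · exact h.disjoint.le_bot ⟨hγ y, hx1⟩
      · exact hx1 (h.subset_interior_closure (hγ y))
    · exact hx2 (across 1 one_ne_zero m4 x hx'
        (hx1.resolve_right fun h' => h' (hball _ m4 x hx').2))
    · exact hx2 (across (-1) (by norm_num) m2 x hx'
        (hx1.resolve_right fun h' => h' (hball _ m2 x hx').2))
  have hγU : range γ ⊆ U := by rintro _ ⟨y, rfl⟩; exact hγ y
  refine false_of_joinedIn_cross (q := q) (v := w) hw0 (G := range γ) (P := O) ?_
    (hOo.joinedIn_of_isPreconnected hc hcO h1 h2) ?_ ?_ ?_ ?_ ?_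
  · rw [e4, e2]; exact ⟨γ, fun y => mem_range_self y⟩
  · exact disjoint_compl_right.mono_right (compl_subset_compl.2 subset_union_left)
  · rw [e4]
    exact disjoint_compl_left.mono_right
      (subset_union_left.trans subset_union_right)
  · rw [e2]
    exact disjoint_compl_left.mono_right
      (subset_union_right.trans subset_union_right)
  · rw [e3]; exact h.disjoint.mono hγU (along 1 m3)
  · rw [e1]; exact h.disjoint.mono hγU (along (-1) m1)

lemma card_lt_card_of_separated {D N : Type*} [Fintype D] [Fintype N] [Nonempty N]
    (a b : D → N) (P : D → N → Prop) (hne : ∀ g, P g (b g) ∧ ¬ P g (a g))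
    (heq : ∀ g h, g ≠ h → (P g (a h) ↔ P g (b h))) : Fintype.card D + 1 ≤ Fintype.card N := by
  classical
  let w : Option D → N → ℚ := fun o x => o.elim 1 fun g => if P g x then 1 else 0
  have hw : LinearIndependent ℚ w := by
    rw [Fintype.linearIndependent_iff]
    intro c hc
    have hev : ∀ x, c none + ∑ g, c (some g) * (if P g x then 1 else 0) = 0 := by
      intro x
      have := congrFun hc x
      simpa [w, Fintype.sum_option] using this
    have hs : ∀ h, c (some h) = 0 := by
      intro h
      have h1 := hev (a h)
      have h2 := hev (b h)
      have h3 : ∑ g, c (some g) * (if P g (b h) then (1 : ℚ) else 0) -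
          ∑ g, c (some g) * (if P g (a h) then (1 : ℚ) else 0) = c (some h) := by
        rw [← Finset.sum_sub_distrib, Finset.sum_eq_single h]
        · simp [hne h]
        · intro g _ hgh
          simp [heq g h hgh]
        · simp
      linarith
    intro o
    cases o with
    | some h => exact hs h
    | none => simpa [hs] using hev (Classical.arbitrary N)
  simpa using hw.fintype_card_le_finrank

namespace Arrangement

variable {n : ℕ} {A : Arrangement n}

lemma exists_straight {g : Fin n × ℝ} (hg : g ∈ A.gapSet) :
    ∃ t ∈ Ioo g.2 (A.next g.1 g.2), ∃ v, IsStraightAt A.support (A.f g.1 t) v := by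
  have hlt := lt_next_of_gap hg
  obtain ⟨m, hm1, hm2⟩ := exists_between hlt
  obtain ⟨η, hη, h⟩ := A.exists_side g.1 (A.f g.1 m)
  obtain ⟨t, ht1, ht2⟩ := exists_between (show m < min (m + η) (A.next g.1 g.2) by
    rw [lt_min_iff]; exact ⟨by linarith, hm2⟩)
  rw [lt_min_iff] at ht2
  have htI : t ∈ Ioo g.2 (A.next g.1 g.2) := ⟨hm1.trans ht1, ht2.2⟩
  refine ⟨t, htI, ((h m (gapSet_Icc hg ⟨hm1.le, hm2.le⟩) rfl).1 t
    (gapSet_Icc hg (Ioo_subset_Icc_self htI)) ht1.ne' ?_).2⟩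
  rw [abs_lt]; constructor <;> linarith

lemma not_subset_of_straight {g : Fin n × ℝ} (hg : g ∈ A.gapSet) (hgW : A.arc g ⊆ interior A.F)
    {t : ℝ} (ht : t ∈ Ioo g.2 (A.next g.1 g.2)) {v : Pt}
    (hv : IsStraightAt A.support (A.f g.1 t) v) {c : Set Pt} (hc : IsPreconnected c)
    (hcK : c ⊆ (A.support ∪ (interior A.F)ᶜ) \ {A.f g.1 t}) (ha : A.f g.1 g.2 ∈ c)
    (hb : A.f g.1 (A.next g.1 g.2) ∈ c) : False := by
  obtain ⟨i, a⟩ := g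
  set b := A.next i a
  have hI : ∀ u ∈ Icc a b, u ∈ Icc (0 : ℝ) 1 := fun u hu => gapSet_Icc hg hu
  have htI := hI t (Ioo_subset_Icc_self ht)
  have hqarc : A.f i t ∈ A.arc (i, a) := mem_image_of_mem _ ht
  obtain ⟨ε, hε, h⟩ := A.isRegion.exists_not_both_mem A.isClosed_support hv (hgW hqarc)
  obtain ⟨η, hη, hgerm⟩ := A.exists_germ (A.f i t) (η := fun _ => min (t - a) (b - t))
    (fun _ => lt_min (sub_pos.2 ht.1) (sub_pos.2 ht.2))
  obtain ⟨hv0, δ, hδ, hv⟩ := hv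
  have hvn : 0 < ‖v‖ := norm_pos_iff.2 hv0
  obtain ⟨s, hs0, hs⟩ := exists_between (show 0 < min ε (min δ η / ‖v‖) by positivity)
  rw [lt_min_iff, lt_div_iff₀ hvn, lt_min_iff] at hs
  have hd : ∀ w : Pt, ‖w‖ = s * ‖v‖ → cross v w = 0 → w ≠ 0 →
      A.f i t + w ∈ A.f i '' Ico a t ∪ A.f i '' Ioc t b := by
    intro w hw hcr hw0
    have hdist : dist (A.f i t + w) (A.f i t) = s * ‖v‖ := by simp [dist_eq_norm, hw]
    have hsup : A.f i t + w ∈ A.support := by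
      rw [hv _ (by rw [hdist]; exact hs.2.1)]
      simpa using hcr
    obtain ⟨i', t₀, ht₀, u, -, h1, h2, h3⟩ := hgerm _ hsup (by rw [hdist]; exact hs.2.2)
    obtain rfl : i' = i := eq_of_mem_X ((disjoint_arc_X hg).notMem_of_mem_left hqarc)
      (h1 ▸ A.mem_curve ht₀) (A.mem_curve htI)
    obtain rfl := A.inj i' ht₀ htI h1
    rw [abs_lt] at h3
    have := min_le_left (t₀ - a) (b - t₀)
    have := min_le_right (t₀ - a) (b - t₀)
    have hut : u ≠ t₀ := by
      rintro rfl
      rw [h2] at h1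
      exact hw0 (by simpa using h2)
    rcases hut.lt_or_gt with hlt | hlt
    · exact Or.inl ⟨u, ⟨by linarith, hlt⟩, h2⟩
    · exact Or.inr ⟨u, ⟨hlt, by linarith⟩, h2⟩
  have c1 : IsPreconnected (A.f i '' Ico a t) := isPreconnected_Ico.image _
    ((A.cont i).mono fun u hu => hI u ⟨hu.1, hu.2.le.trans ht.2.le⟩)
  have c2 : IsPreconnected (A.f i '' Ioc t b) := isPreconnected_Ioc.image _
    ((A.cont i).mono fun u hu => hI u ⟨ht.1.le.trans hu.1.le, hu.2⟩)
  have hC1 := IsPreconnected.union _ ha (mem_image_of_mem _ (left_mem_Ico.2 ht.1)) hc c1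
  have hC := IsPreconnected.union _ (mem_union_left _ hb) (mem_image_of_mem _ (right_mem_Ioc.2 ht.2)) hC1
    c2
  have hsub : ∀ u ∈ Icc a b, u ≠ t →
      A.f i u ∈ (A.support ∪ (interior A.F)ᶜ) \ {A.f i t} := fun u hu hne =>
    ⟨Or.inl (A.mem_support (hI u hu)), fun h => hne (A.inj i (hI u hu) htI h)⟩
  have hCK : c ∪ A.f i '' Ico a t ∪ A.f i '' Ioc t b ⊆
      (A.support ∪ (interior A.F)ᶜ) \ {A.f i t} := by
    refine union_subset (union_subset hcK ?_) ?_
    · rintro _ ⟨u, hu, rfl⟩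
      exact hsub u ⟨hu.1, hu.2.le.trans ht.2.le⟩ hu.2.ne
    · rintro _ ⟨u, hu, rfl⟩
      exact hsub u ⟨ht.1.le.trans hu.1.le, hu.2⟩ hu.1.ne'
  refine h s hs0 hs.1 _ hC hCK ?_ ?_
  · rw [union_assoc]
    exact Or.inr (hd (s • v) (by simp [norm_smul, abs_of_pos hs0])
      (by simp [cross]; ring) (smul_ne_zero hs0.ne' hv0))
  · rw [union_assoc, sub_eq_add_neg]
    exact Or.inr (hd (-(s • v)) (by simp [norm_smul, abs_of_pos hs0])
      (by simp [cross]; ring) (neg_ne_zero.2 (smul_ne_zero hs0.ne' hv0)))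

variable (A) in
open Classical in
/-- The connected components of the complement of the open face that contain a crossing on the
boundary of the face. -/
noncomputable def blobs : Finset (Set Pt) :=
  A.outerCrossings.image (connectedComponentIn (interior A.F)ᶜ)

variable (A) in
open Classical in
/-- The end points of arcs that lie in the face and are not crossings. -/
noncomputable def looseEnds : Finset (Fin n × ℝ) :=
  (Finset.univ ×ˢ {0, 1}).filter fun e => A.f e.1 e.2 ∉ A.X ∧ A.f e.1 e.2 ∈ A.F

lemma mem_looseEnds {e : Fin n × ℝ} :
    e ∈ A.looseEnds ↔ (e.2 = 0 ∨ e.2 = 1) ∧ A.f e.1 e.2 ∉ A.X ∧ A.f e.1 e.2 ∈ A.F := by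
  simp [looseEnds]

lemma card_looseEnds_le : A.looseEnds.card ≤ 2 * n := by
  classical
  refine (Finset.card_filter_le _ _).trans ?_
  rw [Finset.card_product]
  simp [mul_comm]

variable (A) in
open Classical in
/-- The node of the contracted graph that represents the vertex `x`. -/
noncomputable def node (x : Pt) : Set Pt :=
  if x ∈ interior A.F then {x} else connectedComponentIn (interior A.F)ᶜ x

variable (A) in
open Classical in
/-- The nodes of the contracted graph. -/
noncomputable def nodes : Finset (Set Pt) :=
  A.innerCrossings.image singleton ∪ A.looseEnds.image (fun e => {A.f e.1 e.2}) ∪ A.blobs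

lemma card_nodes_le :
    A.nodes.card ≤ A.innerCrossings.card + A.looseEnds.card + A.blobs.card := by
  classical
  exact (Finset.card_union_le _ _).trans (Nat.add_le_add_right ((Finset.card_union_le _ _).trans
    (Nat.add_le_add Finset.card_image_le Finset.card_image_le)) _)

lemma mem_frontier_F {x : Pt} (h : x ∈ A.F) (h' : x ∉ interior A.F) : x ∈ frontier A.F := by
  rw [A.isClosed_F.frontier_eq]; exact ⟨h, h'⟩

lemma mem_X_of_mem_frontier {i : Fin n} {t : ℝ} (ht : t ∈ A.marks i)
    (h : A.f i t ∈ frontier A.F) : A.f i t ∈ A.X := by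
  by_contra hX
  rw [A.isClosed_F.frontier_eq] at h
  refine h.2 (mem_interior_of_end (ht.2.imp_right fun h => h.resolve_right hX) hX h.1)

lemma node_mem_nodes {i : Fin n} {t : ℝ} (ht : t ∈ A.marks i) (hF : A.f i t ∈ A.F) :
    A.node (A.f i t) ∈ A.nodes := by
  classical
  by_cases hW : A.f i t ∈ interior A.F
  · rw [node, if_pos hW]
    by_cases hX : A.f i t ∈ A.X
    · exact Finset.mem_union_left _ (Finset.mem_union_left _
        (Finset.mem_image_of_mem _ (mem_innerCrossings.2 ⟨hX, hW⟩)))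
    · exact Finset.mem_union_left _ (Finset.mem_union_right _
        (Finset.mem_image.2 ⟨(i, t), mem_looseEnds.2
          ⟨ht.2.imp_right fun h => h.resolve_right hX, hX, hF⟩, rfl⟩))
  · rw [node, if_neg hW]
    have hfr := mem_frontier_F hF hW
    exact Finset.mem_union_right _ (Finset.mem_image_of_mem _
      (mem_outerCrossings.2 ⟨mem_X_of_mem_frontier ht hfr, hfr⟩))

lemma mem_node (x : Pt) : x ∈ A.node x := by
  rw [node]
  split_ifs with h
  · rfl
  · exact mem_connectedComponentIn h

lemma isPreconnected_node (x : Pt) : IsPreconnected (A.node x) := by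
  rw [node]
  split_ifs with h
  · exact isPreconnected_singleton
  · exact isPreconnected_connectedComponentIn

lemma ends_subset_closure_arc {g : Fin n × ℝ} (hg : g ∈ A.gapSet) :
    A.f g.1 '' Icc g.2 (A.next g.1 g.2) ⊆ closure (A.arc g) := by
  have hlt := lt_next_of_gap hg
  rw [← closure_Ioo hlt.ne]
  refine ContinuousOn.image_closure ((A.cont _).mono ?_)
  rw [closure_Ioo hlt.ne]
  exact fun t ht => gapSet_Icc hg ht

lemma image_Icc_subset_F {g : Fin n × ℝ} (hg : g ∈ A.gapSet) (h : A.arc g ⊆ A.F) :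
    A.f g.1 '' Icc g.2 (A.next g.1 g.2) ⊆ A.F :=
  (ends_subset_closure_arc hg).trans (closure_minimal h A.isClosed_F)

lemma exists_visible_mark (h : (A.support ∩ A.F).Nonempty) :
    ∃ i, ∃ t ∈ A.marks i, A.f i t ∈ A.F := by
  obtain ⟨_, hp, hF⟩ := h
  obtain ⟨i, t, ht, rfl⟩ := mem_iUnion.1 hp
  by_cases hm : t ∈ A.marks i
  · exact ⟨i, t, hm, hF⟩
  · obtain ⟨a, ha, hta⟩ := exists_gap_of_notMem_marks ht hm
    have hmem : A.f i t ∈ A.arc (i, a) := mem_image_of_mem _ hta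
    have : A.arc (i, a) ⊆ A.F := by
      rcases arc_trichotomy ha with h | h | h
      · exact h.trans interior_subset
      · exact h.trans A.isClosed_F.frontier_subset
      · exact absurd hF (h hmem)
    exact ⟨i, a, ha.1, image_Icc_subset_F ha this
      (mem_image_of_mem _ (left_mem_Icc.2 (lt_next_of_gap ha).le))⟩

lemma card_innerGaps_lt (hne : (A.support ∩ A.F).Nonempty) :
    A.innerGaps.card + 1 ≤ A.innerCrossings.card + A.looseEnds.card + A.blobs.card := by
  classical
  refine le_trans ?_ A.card_nodes_le
  obtain ⟨i₀, t₀, ht₀, hF₀⟩ := exists_visible_mark hne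
  have : Nonempty A.nodes := ⟨⟨_, node_mem_nodes ht₀ hF₀⟩⟩
  have hD := fun g : A.innerGaps => mem_innerGaps.1 g.2
  choose q hq v hv using fun g : A.innerGaps => exists_straight (hD g).1
  have hcl := fun g : A.innerGaps =>
    image_Icc_subset_F (hD g).1 ((hD g).2.trans interior_subset)
  have hle := fun g : A.innerGaps => (lt_next_of_gap (hD g).1).le
  let K : A.innerGaps → Set Pt := fun g =>
    (A.support ∪ (interior A.F)ᶜ) \ {A.f (g : Fin n × ℝ).1 (q g)}
  have hqI := fun g : A.innerGaps => gapSet_Icc (hD g).1 (Ioo_subset_Icc_self (hq g))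
  have hqarc : ∀ g : A.innerGaps, A.f (g : Fin n × ℝ).1 (q g) ∈ A.arc g :=
    fun g => mem_image_of_mem _ (hq g)
  have hmark : ∀ (g : A.innerGaps) {i t}, t ∈ A.marks i →
      A.f i t ≠ A.f (g : Fin n × ℝ).1 (q g) := by
    intro g i t ht heq
    have hX := (disjoint_arc_X (hD g).1).notMem_of_mem_left (hqarc g)
    obtain rfl := eq_of_mem_X hX (heq ▸ A.mem_curve ht.1) (A.mem_curve (hqI g))
    obtain rfl := A.inj _ ht.1 (hqI g) heq
    exact A.notMem_marks (hq g) ht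
  have hnodeK : ∀ (g : A.innerGaps) {i t}, t ∈ A.marks i → A.node (A.f i t) ⊆ K g := by
    intro g i t ht
    rw [node]
    split_ifs with h
    · rw [singleton_subset_iff]
      exact ⟨Or.inl (A.mem_support ht.1), hmark g ht⟩
    · intro x hx
      have hx' := connectedComponentIn_subset _ _ hx
      exact ⟨Or.inr hx', fun h => hx' (by rw [mem_singleton_iff.1 h]; exact (hD g).2 (hqarc g))⟩
  let comp : A.innerGaps → Set Pt := fun g =>
    connectedComponentIn (K g) (A.f (g : Fin n × ℝ).1 (A.next (g : Fin n × ℝ).1 (g : Fin n × ℝ).2))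
  have hsub : ∀ (g : A.innerGaps) {c : Set Pt} {x : Pt}, IsPreconnected c → c ⊆ K g → x ∈ c →
      x ∈ comp g → c ⊆ comp g := by
    intro g c x hc hcK hxc hx
    have := connectedComponentIn_eq hx
    simp only [comp] at this ⊢
    rw [this]
    exact hc.subset_connectedComponentIn hxc hcK
  have hnode : ∀ (g : A.innerGaps) {i t}, t ∈ A.marks i →
      (A.node (A.f i t) ⊆ comp g ↔ A.f i t ∈ comp g) := fun g i t ht =>
    ⟨fun h => h (mem_node _), fun h => hsub g (isPreconnected_node _) (hnodeK g ht) (mem_node _) h⟩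
  have hma := fun g : A.innerGaps => (hD g).1.1
  have hmb := fun g : A.innerGaps => A.next_mem_marks (i := (g : Fin n × ℝ).1) (hD g).1.2
  have key := card_lt_card_of_separated (D := A.innerGaps) (N := A.nodes)
    (fun g => ⟨_, node_mem_nodes (hma g) (hcl g (mem_image_of_mem _ (left_mem_Icc.2 (hle g))))⟩)
    (fun g => ⟨_, node_mem_nodes (hmb g) (hcl g (mem_image_of_mem _ (right_mem_Icc.2 (hle g))))⟩)
    (fun g N => (N : Set Pt) ⊆ comp g) ?_ ?_
  · simpa using key
  · intro g
    have hbK : A.f (g : Fin n × ℝ).1 (A.next (g : Fin n × ℝ).1 (g : Fin n × ℝ).2) ∈ K g :=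
      ⟨Or.inl (A.mem_support (hmb g).1), hmark g (hmb g)⟩
    refine ⟨(hnode g (hmb g)).2 (mem_connectedComponentIn hbK), fun h => ?_⟩
    exact not_subset_of_straight (hD g).1 (hD g).2 (hq g) (hv g)
      isPreconnected_connectedComponentIn (connectedComponentIn_subset _ _)
      ((hnode g (hma g)).1 h) (mem_connectedComponentIn hbK)
  · intro g h hgh
    change A.node _ ⊆ comp g ↔ A.node _ ⊆ comp g
    rw [hnode g (hma h), hnode g (hmb h)]
    have hc : IsPreconnected (closure (A.arc h)) :=
      (isConnected_arc (hD h).1).isPreconnected.closure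
    have hcK : closure (A.arc h) ⊆ K g := by
      intro x hx
      refine ⟨Or.inl ?_, ?_⟩
      · obtain ⟨t, ht, rfl⟩ := closure_arc_subset (hD h).1 hx
        exact A.mem_support (gapSet_Icc (hD h).1 ht)
      · rintro rfl
        exact hgh (Subtype.ext (eq_of_mem_arc_of_mem_closure (hD g).1 (hD h).1 (hqarc g) hx))
    have ha := ends_subset_closure_arc (hD h).1 (mem_image_of_mem _ (left_mem_Icc.2 (hle h)))
    have hb := ends_subset_closure_arc (hD h).1 (mem_image_of_mem _ (right_mem_Icc.2 (hle h)))
    exact ⟨fun h' => hsub g hc hcK ha h' hb, fun h' => hsub g hc hcK hb h' ha⟩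

lemma markSet_finite : {e : Fin n × ℝ | e.2 ∈ A.marks e.1}.Finite := by
  refine (finite_iUnion fun i => (A.marks_finite i).image (Prod.mk i)).subset ?_
  rintro ⟨i, a⟩ h
  exact mem_iUnion.2 ⟨i, a, h, rfl⟩

variable (A) in
open Classical in
/-- The marks that lie in the interior of the face. -/
noncomputable def innerMarks : Finset (Fin n × ℝ) :=
  (markSet_finite (A := A)).toFinset.filter fun e => A.f e.1 e.2 ∈ interior A.F

lemma mem_innerMarks {e : Fin n × ℝ} :
    e ∈ A.innerMarks ↔ e.2 ∈ A.marks e.1 ∧ A.f e.1 e.2 ∈ interior A.F := by simp [innerMarks]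

lemma exists_param {p : Pt} {i : Fin n} (h : p ∈ A.curve i) : ∃ t ∈ Icc (0 : ℝ) 1, A.f i t = p := h

lemma two_mul_card_innerCrossings_add_le :
    2 * A.innerCrossings.card + A.looseEnds.card ≤ A.innerMarks.card := by
  classical
  have hloose : A.looseEnds ⊆ A.innerMarks.filter fun e => A.f e.1 e.2 ∉ A.X := by
    intro e he
    obtain ⟨h1, h2, h3⟩ := mem_looseEnds.1 he
    refine Finset.mem_filter.2 ⟨mem_innerMarks.2 ⟨⟨?_, h1.imp_right Or.inl⟩,
      mem_interior_of_end h1 h2 h3⟩, h2⟩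
    rcases h1 with h | h <;> simp [h]
  have h1 := Finset.card_le_card hloose
  have h2 := Finset.card_filter_add_card_filter_not (s := A.innerMarks)
    (fun e => A.f e.1 e.2 ∈ A.X)
  have h3 := Finset.card_mul_le_card_mul (fun (p : Pt) (e : Fin n × ℝ) => A.f e.1 e.2 = p)
    (s := A.innerCrossings) (t := A.innerMarks.filter fun e => A.f e.1 e.2 ∈ A.X)
    (m := 2) (n := 1) ?_ ?_
  · omega
  · intro p hp
    obtain ⟨hX, hW⟩ := mem_innerCrossings.1 hp
    obtain ⟨i, j, hij, hi, hj⟩ := id hX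
    obtain ⟨t, ht, rfl⟩ := exists_param hi
    obtain ⟨u, hu, hut⟩ := exists_param hj
    have : ({(i, t), (j, u)} : Finset (Fin n × ℝ)).card = 2 :=
      Finset.card_pair (by simp [hij])
    rw [← this]
    refine Finset.card_le_card ?_
    have hX' : A.f j u ∈ A.X := by rw [hut]; exact hX
    have hW' : A.f j u ∈ interior A.F := by rw [hut]; exact hW
    intro e he
    rw [Finset.mem_insert, Finset.mem_singleton] at he
    rw [Finset.mem_bipartiteAbove, Finset.mem_filter, mem_innerMarks]
    rcases he with rfl | rfl
    · exact ⟨⟨⟨⟨ht, Or.inr (Or.inr hX)⟩, hW⟩, hX⟩, rfl⟩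
    · exact ⟨⟨⟨⟨hu, Or.inr (Or.inr hX')⟩, hW'⟩, hX'⟩, hut⟩
  · intro e _
    rw [Finset.card_le_one]
    intro p hp q hq
    rw [Finset.mem_bipartiteBelow] at hp hq
    rw [← hp.2, ← hq.2]

variable (A) in
open Classical in
/-- The incidences between the arcs and the blobs. -/
noncomputable def blobIncidences : Finset (Fin n × Set Pt) :=
  (Finset.univ ×ˢ A.blobs).filter fun e => (A.curve e.1 ∩ e.2).Nonempty

lemma mem_blobIncidences {e : Fin n × Set Pt} :
    e ∈ A.blobIncidences ↔ e.2 ∈ A.blobs ∧ (A.curve e.1 ∩ e.2).Nonempty := by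
  simp [blobIncidences]

lemma mem_blobs {Q : Set Pt} :
    Q ∈ A.blobs ↔ ∃ x ∈ A.X, x ∈ frontier A.F ∧ connectedComponentIn (interior A.F)ᶜ x = Q := by
  simp [blobs, mem_outerCrossings, and_assoc]

lemma eq_connectedComponentIn_of_mem_blobs {Q : Set Pt} (hQ : Q ∈ A.blobs) {x : Pt} (hx : x ∈ Q) :
    Q = connectedComponentIn (interior A.F)ᶜ x := by
  obtain ⟨y, -, -, rfl⟩ := mem_blobs.1 hQ
  exact connectedComponentIn_eq hx

lemma blob_subset {Q : Set Pt} (hQ : Q ∈ A.blobs) : Q ⊆ (interior A.F)ᶜ := by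
  obtain ⟨y, -, -, rfl⟩ := mem_blobs.1 hQ
  exact connectedComponentIn_subset _ _

lemma subset_blob {Q c : Set Pt} (hQ : Q ∈ A.blobs) (hc : IsPreconnected c)
    (hcW : c ⊆ (interior A.F)ᶜ) {x : Pt} (hxc : x ∈ c) (hx : x ∈ Q) : c ⊆ Q := by
  rw [eq_connectedComponentIn_of_mem_blobs hQ hx]
  exact hc.subset_connectedComponentIn hxc hcW

lemma arc_subset_or_subset_compl {g : Fin n × ℝ} (hg : g ∈ A.gapSet) :
    A.arc g ⊆ interior A.F ∨ A.f g.1 '' Icc g.2 (A.next g.1 g.2) ⊆ (interior A.F)ᶜ := by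
  refine (arc_trichotomy hg).imp_right fun h => ?_
  refine (ends_subset_closure_arc hg).trans (closure_minimal ?_ isOpen_interior.isClosed_compl)
  rcases h with h | h
  · intro x hx
    have := h hx
    rw [A.isClosed_F.frontier_eq] at this
    exact this.2
  · exact h.trans (compl_subset_compl.2 interior_subset)

lemma isPreconnected_image_Icc {g : Fin n × ℝ} (hg : g ∈ A.gapSet) :
    IsPreconnected (A.f g.1 '' Icc g.2 (A.next g.1 g.2)) :=
  isPreconnected_Icc.image _ ((A.cont _).mono fun _ ht => gapSet_Icc hg ht)

lemma exists_last_mark_in_blob {i : Fin n} {Q : Set Pt} (hQ : Q ∈ A.blobs)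
    (h : (A.curve i ∩ Q).Nonempty) :
    ∃ a ∈ A.marks i, A.f i a ∈ Q ∧ (a = 1 ∨ (i, a) ∈ A.innerGaps) := by
  have hne : {t | t ∈ A.marks i ∧ A.f i t ∈ Q}.Nonempty := by
    obtain ⟨_, ⟨t, ht, rfl⟩, htQ⟩ := h
    by_cases hm : t ∈ A.marks i
    · exact ⟨t, hm, htQ⟩
    · obtain ⟨a, ha, hta⟩ := exists_gap_of_notMem_marks ht hm
      rcases arc_subset_or_subset_compl ha with h | h
      · exact absurd (h (mem_image_of_mem _ hta)) (blob_subset hQ htQ)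
      · exact ⟨a, ha.1, subset_blob hQ (isPreconnected_image_Icc ha) h
          (mem_image_of_mem _ (Ioo_subset_Icc_self hta)) htQ
          (mem_image_of_mem _ (left_mem_Icc.2 (lt_next_of_gap ha).le))⟩
  have hfin : {t | t ∈ A.marks i ∧ A.f i t ∈ Q}.Finite :=
    (A.marks_finite i).subset fun t ht => ht.1
  have hmem := hne.csSup_mem hfin
  set a := sSup {t | t ∈ A.marks i ∧ A.f i t ∈ Q}
  refine ⟨a, hmem.1, hmem.2, or_iff_not_imp_left.2 fun ha1 => ?_⟩
  have hg : (i, a) ∈ A.gapSet := ⟨hmem.1, lt_of_le_of_ne hmem.1.1.2 ha1⟩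
  rcases arc_subset_or_subset_compl hg with h | h
  · exact mem_innerGaps.2 ⟨hg, h⟩
  · have hlt := lt_next_of_gap hg
    have := le_csSup hfin.bddAbove (show A.next i a ∈ {t | t ∈ A.marks i ∧ A.f i t ∈ Q} from
      ⟨A.next_mem_marks hg.2, subset_blob hQ (isPreconnected_image_Icc hg) h
        (mem_image_of_mem _ (left_mem_Icc.2 hlt.le)) hmem.2
        (mem_image_of_mem _ (right_mem_Icc.2 hlt.le))⟩)
    exact absurd this hlt.not_ge

lemma card_blobIncidences_add_le :
    A.blobIncidences.card + A.innerMarks.card ≤ A.innerGaps.card + n := by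
  classical
  have hex : ∀ e : Fin n × Set Pt, ∃ a, e ∈ A.blobIncidences → a ∈ A.marks e.1 ∧
      A.f e.1 a ∈ e.2 ∧ (a = 1 ∨ (e.1, a) ∈ A.innerGaps) := by
    intro e
    by_cases he : e ∈ A.blobIncidences
    · obtain ⟨h1, h2⟩ := mem_blobIncidences.1 he
      obtain ⟨a, h⟩ := exists_last_mark_in_blob h1 h2
      exact ⟨a, fun _ => h⟩
    · exact ⟨0, fun h => absurd h he⟩
  choose a ha using hex
  have h1 : (A.blobIncidences.image fun e => (e.1, a e)).card = A.blobIncidences.card := by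
    refine Finset.card_image_of_injOn ?_
    intro e he e' he' heq
    simp only [Prod.mk.injEq] at heq
    obtain ⟨-, h2, -⟩ := ha e he
    obtain ⟨-, h2', -⟩ := ha e' he'
    rw [← heq.1, ← heq.2] at h2'
    refine Prod.ext heq.1 ?_
    rw [eq_connectedComponentIn_of_mem_blobs (mem_blobIncidences.1 he).1 h2,
      ← eq_connectedComponentIn_of_mem_blobs (mem_blobIncidences.1 he').1 h2']
  have h2 : Disjoint (A.blobIncidences.image fun e => (e.1, a e)) A.innerMarks := by
    rw [Finset.disjoint_left]
    rintro _ hmem hm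
    obtain ⟨e, he, rfl⟩ := Finset.mem_image.1 hmem
    exact blob_subset (mem_blobIncidences.1 he).1 (ha e he).2.1 (mem_innerMarks.1 hm).2
  have h3 : (A.blobIncidences.image fun e => (e.1, a e)) ∪ A.innerMarks ⊆
      A.innerGaps ∪ Finset.univ.image fun i => (i, 1) := by
    refine Finset.union_subset ?_ ?_
    · intro _ hmem
      obtain ⟨e, he, rfl⟩ := Finset.mem_image.1 hmem
      rcases (ha e he).2.2 with h | h
      · exact Finset.mem_union_right _ (Finset.mem_image.2 ⟨e.1, Finset.mem_univ _, by rw [h]⟩)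
      · exact Finset.mem_union_left _ h
    · rintro ⟨i, t⟩ he
      obtain ⟨hm, hW⟩ := mem_innerMarks.1 he
      by_cases ht : t = 1
      · exact Finset.mem_union_right _ (Finset.mem_image.2 ⟨i, Finset.mem_univ _, by rw [ht]⟩)
      · have hg : (i, t) ∈ A.gapSet := ⟨hm, lt_of_le_of_ne hm.1.2 ht⟩
        refine Finset.mem_union_left _ (mem_innerGaps.2 ⟨hg, ?_⟩)
        refine (arc_subset_or_subset_compl hg).resolve_right fun h => ?_
        exact h (mem_image_of_mem _ (left_mem_Icc.2 (lt_next_of_gap hg).le)) hW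
  have h4 := Finset.card_le_card h3
  rw [Finset.card_union_of_disjoint h2, h1] at h4
  refine h4.trans ((Finset.card_union_le _ _).trans ?_)
  exact Nat.add_le_add_left (Finset.card_image_le.trans (by simp)) _

lemma eq_of_color_eq {i j : Fin n} {p : Pt} (hi : p ∈ A.curve i) (hj : p ∈ A.curve j)
    (h : A.color i = A.color j) : i = j := by
  by_contra hij
  exact (A.same i j hij h).notMem_of_mem_left hi hj

lemma color_ne_of_mem {i j : Fin n} {p : Pt} (hij : i ≠ j) (hi : p ∈ A.curve i)
    (hj : p ∈ A.curve j) : A.color i ≠ A.color j := fun h => hij (eq_of_color_eq hi hj h)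

lemma eq_of_mem_three {i j k : Fin n} {p : Pt} (hij : i ≠ j) (hik : i ≠ k) (hi : p ∈ A.curve i)
    (hj : p ∈ A.curve j) (hk : p ∈ A.curve k) : j = k := by
  have h1 := color_ne_of_mem hij hi hj
  have h2 := color_ne_of_mem hik hi hk
  refine eq_of_color_eq hj hk ?_
  revert h1 h2
  cases A.color i <;> cases A.color j <;> cases A.color k <;> simp

lemma eq_of_next_eq {i : Fin n} {a b : ℝ} (ha : (i, a) ∈ A.gapSet) (hb : (i, b) ∈ A.gapSet)
    (h : A.next i a = A.next i b) : a = b :=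
  A.mark_eq_of_mem_Ioc ha.1 hb.1 (right_mem_Ioc.2 (lt_next_of_gap ha))
    (by rw [h]; exact right_mem_Ioc.2 (lt_next_of_gap hb))

variable (A) in
open Classical in
/-- The gaps contained in the face. -/
noncomputable def visibleGaps : Finset (Fin n × ℝ) := A.innerGaps ∪ A.outerGaps

lemma mem_visibleGaps {g : Fin n × ℝ} :
    g ∈ A.visibleGaps ↔ g ∈ A.gapSet ∧ A.f g.1 '' Icc g.2 (A.next g.1 g.2) ⊆ A.F := by
  rw [visibleGaps, Finset.mem_union, mem_innerGaps, mem_outerGaps]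
  constructor
  · rintro (⟨h1, h2⟩ | ⟨h1, h2⟩)
    · exact ⟨h1, image_Icc_subset_F h1 (h2.trans interior_subset)⟩
    · exact ⟨h1, image_Icc_subset_F h1 (h2.trans A.isClosed_F.frontier_subset)⟩
  · rintro ⟨h1, h2⟩
    rcases arc_trichotomy h1 with h | h | h
    · exact Or.inl ⟨h1, h⟩
    · exact Or.inr ⟨h1, h⟩
    · obtain ⟨x, hx⟩ := (isConnected_arc h1).nonempty
      exact absurd (h2 ((image_mono Ioo_subset_Icc_self) hx)) (h hx)

lemma card_visibleGaps : A.visibleGaps.card = A.innerGaps.card + A.outerGaps.card := by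
  classical
  refine Finset.card_union_of_disjoint (Finset.disjoint_left.2 fun g h1 h2 => ?_)
  obtain ⟨hg, h1⟩ := mem_innerGaps.1 h1
  obtain ⟨-, h2⟩ := mem_outerGaps.1 h2
  obtain ⟨x, hx⟩ := (isConnected_arc hg).nonempty
  have := h2 hx
  rw [A.isClosed_F.frontier_eq] at this
  exact this.2 (h1 hx)

variable (A) in
/-- The parameter of an end of a gap. -/
noncomputable def endParam (g : Fin n × ℝ) (s : Bool) : ℝ := if s then A.next g.1 g.2 else g.2

variable (A) in
/-- An end of a gap. -/
noncomputable def endPt (g : Fin n × ℝ) (s : Bool) : Pt := A.f g.1 (A.endParam g s)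

lemma endParam_mem_marks {g : Fin n × ℝ} (hg : g ∈ A.gapSet) (s : Bool) :
    A.endParam g s ∈ A.marks g.1 := by
  cases s
  · exact hg.1
  · exact A.next_mem_marks hg.2

lemma endParam_mem_Icc {g : Fin n × ℝ} (hg : g ∈ A.gapSet) (s : Bool) :
    A.endParam g s ∈ Icc g.2 (A.next g.1 g.2) := by
  have := (lt_next_of_gap hg).le
  cases s <;> simpa [endParam]

lemma endPt_mem_curve {g : Fin n × ℝ} (hg : g ∈ A.gapSet) (s : Bool) :
    A.endPt g s ∈ A.curve g.1 := A.mem_curve (endParam_mem_marks hg s).1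

lemma endPt_mem_F {g : Fin n × ℝ} (hg : g ∈ A.visibleGaps) (s : Bool) : A.endPt g s ∈ A.F := by
  obtain ⟨h1, h2⟩ := mem_visibleGaps.1 hg
  exact h2 (mem_image_of_mem _ (endParam_mem_Icc h1 s))

variable (A) in
open Classical in
/-- The incidences between the ends of visible gaps and other arcs. -/
noncomputable def gapIncidences : Finset ((Fin n × ℝ) × Fin n) :=
  (A.visibleGaps ×ˢ Finset.univ).filter fun e => e.1.1 ≠ e.2 ∧ ∃ s, A.endPt e.1 s ∈ A.curve e.2

lemma mem_gapIncidences {e : (Fin n × ℝ) × Fin n} : e ∈ A.gapIncidences ↔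
    e.1 ∈ A.visibleGaps ∧ e.1.1 ≠ e.2 ∧ ∃ s, A.endPt e.1 s ∈ A.curve e.2 := by
  simp only [gapIncidences, Finset.mem_filter, Finset.mem_product, Finset.mem_univ, and_true]

variable (A) in
open Classical in
/-- The visible gaps both ends of which lie on a common second arc. -/
noncomputable def doubleGaps : Finset (Fin n × ℝ) :=
  A.visibleGaps.filter fun g => ∃ j, g.1 ≠ j ∧ ∀ s, A.endPt g s ∈ A.curve j

variable (A) in
open Classical in
/-- The ordered pairs of arcs that cross in the face. -/
noncomputable def crossPairs : Finset (Fin n × Fin n) :=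
  Finset.univ.filter fun e => e.1 ≠ e.2 ∧ (A.curve e.1 ∩ A.curve e.2 ∩ A.F).Nonempty

lemma mem_crossPairs {e : Fin n × Fin n} :
    e ∈ A.crossPairs ↔ e.1 ≠ e.2 ∧ (A.curve e.1 ∩ A.curve e.2 ∩ A.F).Nonempty := by
  simp [crossPairs]

variable (A) in
open Classical in
/-- The ends of visible gaps. -/
noncomputable def gapEnds : Finset ((Fin n × ℝ) × Bool) := A.visibleGaps ×ˢ Finset.univ

variable (A) in
open Classical in
/-- The marks at crossings in the face. -/
noncomputable def crossMarks : Finset (Fin n × ℝ) :=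
  (markSet_finite (A := A)).toFinset.filter fun e => A.f e.1 e.2 ∈ A.X ∧ A.f e.1 e.2 ∈ A.F

lemma mem_crossMarks {e : Fin n × ℝ} :
    e ∈ A.crossMarks ↔ e.2 ∈ A.marks e.1 ∧ A.f e.1 e.2 ∈ A.X ∧ A.f e.1 e.2 ∈ A.F := by
  simp [crossMarks]

open Classical in
lemma card_gapEnds_notMem_X_le :
    (A.gapEnds.filter fun e => A.endPt e.1 e.2 ∉ A.X).card ≤ A.looseEnds.card := by
  have hkey : ∀ e ∈ A.gapEnds.filter fun e => A.endPt e.1 e.2 ∉ A.X,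
      e.1 ∈ A.visibleGaps ∧ A.endParam e.1 e.2 = (if e.2 then 1 else 0) ∧
        A.endPt e.1 e.2 ∉ A.X := by
    intro e he
    obtain ⟨he, hX⟩ := Finset.mem_filter.1 he
    have hv := (Finset.mem_product.1 he).1
    have hg := (mem_visibleGaps.1 hv).1
    refine ⟨hv, ?_, hX⟩
    have h1 := (endParam_mem_marks hg e.2).2.imp_right fun h => h.resolve_right hX
    have h2 := lt_next_of_gap hg
    have h3 := hg.1.1.1
    have h4 := hg.2
    obtain ⟨g, s⟩ := e
    cases s
    · rcases h1 with h | h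
      · exact h
      · simp only [endParam] at h; simp at h; linarith
    · rcases h1 with h | h
      · simp only [endParam] at h; simp at h; linarith
      · exact h
  refine Finset.card_le_card_of_injOn (fun e => (e.1.1, A.endParam e.1 e.2)) ?_ ?_
  · intro e he
    obtain ⟨hv, h1, hX⟩ := hkey e he
    refine mem_looseEnds.2 ⟨?_, hX, endPt_mem_F hv _⟩
    simp only [h1]
    cases e.2 <;> simp
  · rintro ⟨⟨i, a⟩, s⟩ he ⟨⟨j, b⟩, u⟩ he' heq
    obtain ⟨hv, h1, -⟩ := hkey _ he
    obtain ⟨hv', h1', -⟩ := hkey _ he'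
    simp only [Prod.mk.injEq] at heq h1 h1'
    obtain ⟨rfl, heq⟩ := heq
    have hsu : s = u := by
      rw [h1, h1'] at heq
      revert heq
      cases s <;> cases u <;> simp
    subst hsu
    have : a = b := by
      cases s
      · simpa [endParam] using heq
      · exact eq_of_next_eq (mem_visibleGaps.1 hv).1 (mem_visibleGaps.1 hv').1
          (by simpa [endParam] using heq)
    rw [this]

open Classical in
lemma card_gapEnds_mem_X_le : (A.gapEnds.filter fun e => A.endPt e.1 e.2 ∈ A.X).card ≤
    A.gapIncidences.card + A.doubleGaps.card := by
  have hex : ∀ e : (Fin n × ℝ) × Bool, ∃ j, e ∈ A.gapEnds.filter (fun e => A.endPt e.1 e.2 ∈ A.X) →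
      e.1 ∈ A.visibleGaps ∧ e.1.1 ≠ j ∧ A.endPt e.1 e.2 ∈ A.curve j := by
    intro e
    by_cases he : e ∈ A.gapEnds.filter (fun e => A.endPt e.1 e.2 ∈ A.X)
    · obtain ⟨he, i, j, hij, hi, hj⟩ := Finset.mem_filter.1 he
      have hv := (Finset.mem_product.1 he).1
      by_cases h : e.1.1 = i
      · exact ⟨j, fun _ => ⟨hv, h ▸ hij, hj⟩⟩
      · exact ⟨i, fun _ => ⟨hv, h, hi⟩⟩
    · exact ⟨e.1.1, fun h => absurd h he⟩
  choose j hj using hex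
  rw [← Finset.card_disjSum]
  refine Finset.card_le_card_of_injOn (fun e => if e.2 = true ∧ A.endPt e.1 false ∈ A.curve (j e)
    then Sum.inr e.1 else Sum.inl (e.1, j e)) ?_ ?_
  · intro e he
    obtain ⟨hv, hne, hm⟩ := hj e he
    simp only
    split_ifs with h
    · refine Finset.inr_mem_disjSum.2 (Finset.mem_filter.2 ⟨hv, j e, hne, fun s => ?_⟩)
      cases s
      · exact h.2
      · rw [← h.1]; exact hm
    · exact Finset.inl_mem_disjSum.2 (mem_gapIncidences.2 ⟨hv, hne, _, hm⟩)
  · rintro ⟨g, s⟩ he ⟨g', s'⟩ he' heq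
    obtain ⟨-, -, hm⟩ := hj _ he
    obtain ⟨-, -, hm'⟩ := hj _ he'
    simp only at heq hm hm'
    split_ifs at heq with h h' h'
    · rw [Sum.inr.inj heq, h.1, h'.1]
    · have h3 := Sum.inl.inj heq
      simp only [Prod.mk.injEq] at h3
      obtain ⟨rfl, h3⟩ := h3
      rw [h3] at h
      rw [← h3] at h'
      cases s <;> cases s'
      · rfl
      · rw [h3] at hm
        exact absurd ⟨rfl, by rw [h3]; exact hm⟩ h'
      · rw [← h3] at hm'
        exact absurd ⟨rfl, by rw [← h3]; exact hm'⟩ h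
      · rfl

lemma card_doubleGaps_add_le :
    A.doubleGaps.card + A.crossPairs.card ≤ A.crossMarks.card := by
  classical
  have hd : ∀ g ∈ A.doubleGaps, g ∈ A.visibleGaps ∧ ∃ j, g.1 ≠ j ∧ ∀ s, A.endPt g s ∈ A.curve j :=
    fun g hg => Finset.mem_filter.1 hg
  have hex : ∀ e : Fin n × Fin n, ∃ t, e ∈ A.crossPairs →
      (t ∈ A.marks e.1 ∧ A.f e.1 t ∈ A.curve e.2 ∧ A.f e.1 t ∈ A.F) ∧
        ∀ u ∈ A.marks e.1, A.f e.1 u ∈ A.curve e.2 → A.f e.1 u ∈ A.F → t ≤ u := by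
    intro e
    by_cases he : e ∈ A.crossPairs
    · obtain ⟨hne, p, ⟨h1, h2⟩, h3⟩ := mem_crossPairs.1 he
      obtain ⟨t, ht, rfl⟩ := exists_param h1
      have hfin : {t | t ∈ A.marks e.1 ∧ A.f e.1 t ∈ A.curve e.2 ∧ A.f e.1 t ∈ A.F}.Finite :=
        (A.marks_finite e.1).subset fun t ht => ht.1
      have hnon : {t | t ∈ A.marks e.1 ∧ A.f e.1 t ∈ A.curve e.2 ∧ A.f e.1 t ∈ A.F}.Nonempty :=
        ⟨t, ⟨ht, Or.inr (Or.inr ⟨_, _, hne, h1, h2⟩)⟩, h2, h3⟩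
      exact ⟨_, fun _ => ⟨hnon.csInf_mem hfin, fun u hu hu1 hu2 =>
        csInf_le hfin.bddBelow ⟨hu, hu1, hu2⟩⟩⟩
    · exact ⟨0, fun h => absurd h he⟩
  choose t ht using hex
  rw [← Finset.card_disjSum]
  have hinc : ∀ e ∈ A.crossPairs, (e.1, t e) ∈ A.crossMarks := fun e he =>
    mem_crossMarks.2 ⟨(ht e he).1.1, ⟨_, _, (mem_crossPairs.1 he).1, A.mem_curve (ht e he).1.1.1,
      (ht e he).1.2.1⟩, (ht e he).1.2.2⟩
  have hdis : ∀ g ∈ A.doubleGaps, ∀ e ∈ A.crossPairs, (g.1, A.next g.1 g.2) ≠ (e.1, t e) := by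
    rintro ⟨i, a⟩ hg ⟨i', j'⟩ he heq
    simp only [Prod.mk.injEq] at heq
    obtain ⟨rfl, heq⟩ := heq
    obtain ⟨hv, j, hne, h⟩ := hd _ hg
    obtain ⟨⟨h1, h2, h3⟩, h4⟩ := ht _ he
    have hgs := (mem_visibleGaps.1 hv).1
    have hj := h true
    rw [← heq] at h2 h4
    obtain rfl := eq_of_mem_three hne (mem_crossPairs.1 he).1 (endPt_mem_curve hgs true) hj h2
    exact (lt_next_of_gap hgs).not_ge (h4 a hgs.1 (h false) (endPt_mem_F hv false))
  refine Finset.card_le_card_of_injOn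
    (Sum.elim (fun g => (g.1, A.next g.1 g.2)) fun e => (e.1, t e)) ?_ ?_
  · intro x hx
    rcases Finset.mem_disjSum.1 hx with ⟨g, hg, rfl⟩ | ⟨e, he, rfl⟩
    · obtain ⟨hv, j, hne, h⟩ := hd g hg
      have hgs := (mem_visibleGaps.1 hv).1
      exact mem_crossMarks.2 ⟨A.next_mem_marks hgs.2,
        ⟨_, _, hne, endPt_mem_curve hgs true, h true⟩, endPt_mem_F hv true⟩
    · exact hinc e he
  · intro x hx y hy heq
    rcases Finset.mem_disjSum.1 hx with ⟨g, hg, rfl⟩ | ⟨e, he, rfl⟩ <;>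
      rcases Finset.mem_disjSum.1 hy with ⟨g', hg', rfl⟩ | ⟨e', he', rfl⟩
    · obtain ⟨i, a⟩ := g
      obtain ⟨i', a'⟩ := g'
      simp only [Sum.elim_inl, Prod.mk.injEq] at heq
      obtain ⟨rfl, heq⟩ := heq
      rw [eq_of_next_eq (mem_visibleGaps.1 (hd _ hg).1).1 (mem_visibleGaps.1 (hd _ hg').1).1 heq]
    · exact absurd heq (hdis g hg e' he')
    · exact absurd heq.symm (hdis g' hg' e he)
    · obtain ⟨i, j⟩ := e
      obtain ⟨i', j'⟩ := e'
      simp only [Sum.elim_inr, Prod.mk.injEq] at heq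
      obtain ⟨rfl, heq⟩ := heq
      have h1 := (ht _ he).1.2.1
      have h2 := (ht _ he').1.2.1
      rw [← heq] at h2
      have : j = j' := eq_of_mem_three (mem_crossPairs.1 he).1 (mem_crossPairs.1 he').1
        (A.mem_curve (ht _ he).1.1.1) h1 h2
      rw [this]

lemma card_crossMarks_le :
    A.crossMarks.card ≤ 2 * (A.innerCrossings.card + A.outerCrossings.card) := by
  classical
  refine le_trans ?_ (Nat.mul_le_mul_left 2 (Finset.card_union_le _ _))
  rw [mul_comm, ← mul_one A.crossMarks.card]
  refine Finset.card_mul_le_card_mul (fun (e : Fin n × ℝ) (p : Pt) => A.f e.1 e.2 = p) ?_ ?_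
  · intro e he
    obtain ⟨-, hX, hF⟩ := mem_crossMarks.1 he
    refine Finset.card_pos.2 ⟨A.f e.1 e.2, Finset.mem_filter.2 ⟨?_, rfl⟩⟩
    rw [Finset.mem_union, mem_innerCrossings, mem_outerCrossings]
    by_cases hW : A.f e.1 e.2 ∈ interior A.F
    · exact Or.inl ⟨hX, hW⟩
    · exact Or.inr ⟨hX, mem_frontier_F hF hW⟩
  · intro p _
    rw [← Fintype.card_bool, ← Finset.card_univ]
    refine Finset.card_le_card_of_injOn (fun e => A.color e.1) (fun _ _ => Finset.mem_univ _) ?_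
    rintro ⟨i, t⟩ he ⟨i', t'⟩ he' heq
    simp only [Finset.coe_bipartiteBelow, mem_ofPred_eq, mem_crossMarks] at he he'
    obtain ⟨⟨h1, -, -⟩, rfl⟩ := he
    obtain ⟨⟨h2, -, -⟩, h3⟩ := he'
    obtain rfl := eq_of_color_eq (A.mem_curve h1.1) (h3 ▸ A.mem_curve h2.1) heq
    rw [A.inj _ h1.1 h2.1 h3.symm]

lemma two_mul_card_visibleGaps_add_le : 2 * A.visibleGaps.card + A.crossPairs.card ≤
    A.gapIncidences.card + A.looseEnds.card +
      2 * (A.innerCrossings.card + A.outerCrossings.card) := by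
  classical
  have h1 := A.card_gapEnds_notMem_X_le
  have h2 := A.card_gapEnds_mem_X_le
  have h3 := A.card_doubleGaps_add_le
  have h4 := A.card_crossMarks_le
  have h5 := Finset.card_filter_add_card_filter_not (s := A.gapEnds)
    (fun e => A.endPt e.1 e.2 ∈ A.X)
  have h6 : A.gapEnds.card = A.visibleGaps.card * 2 := by
    rw [gapEnds, Finset.card_product]; simp
  omega

end Arrangement

lemma card_edges_add_two_le_of_forall {V K : Type*} [Fintype V] [Fintype K] (a b : K → V)
    (hab : ∀ k, a k ≠ b k) (hinj : ∀ k l, s(a k, b k) = s(a l, b l) → k = l)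
    (X : V → Set Pt) (P : K → Set Pt) (hX : ∀ v, IsPathConnected (X v))
    (hXX : ∀ v w, ∀ x ∈ X v, x ∈ X w → v = w) (hP : ∀ k, IsPathConnected (P k))
    (hPa : ∀ k, ∃ x ∈ P k, x ∈ X (a k)) (hPb : ∀ k, ∃ x ∈ P k, x ∈ X (b k))
    (hPX : ∀ k w, ∀ x ∈ P k, x ∈ X w → w = a k ∨ w = b k)
    (hPP : ∀ k l, ∀ x ∈ P k, x ∈ P l → (∀ v, x ∉ X v) →
      a k = a l ∨ a k = b l ∨ b k = a l ∨ b k = b l) :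
    (1 ≤ Fintype.card V → Fintype.card K + 2 ≤ 3 * Fintype.card V) ∧
      (2 ≤ Fintype.card V → Fintype.card K + 5 ≤ 3 * Fintype.card V) := by
  have h1 : ∀ v w, v ≠ w → Disjoint (X v) (X w) := fun v w hvw =>
    Set.disjoint_left.2 fun x hx hx' => hvw (hXX v w x hx hx')
  have h2 : ∀ k, (X (a k) ∩ P k).Nonempty := fun k =>
    let ⟨x, h, h'⟩ := hPa k; ⟨x, h', h⟩
  have h3 : ∀ k, (P k ∩ X (b k)).Nonempty := fun k =>
    let ⟨x, h, h'⟩ := hPb k; ⟨x, h, h'⟩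
  have h4 : ∀ k w, w ≠ a k → w ≠ b k → Disjoint (P k) (X w) := fun k w ha hb =>
    Set.disjoint_left.2 fun x hx hx' => (hPX k w x hx hx').elim ha hb
  have h5 : ∀ k l, a k ≠ a l → a k ≠ b l → b k ≠ a l → b k ≠ b l → Disjoint (P k) (P l) := by
    intro k l haa hab' hba hbb
    refine Set.disjoint_left.2 fun x hx hx' => ?_
    by_cases h : ∃ v, x ∈ X v
    · obtain ⟨v, hv⟩ := h
      have := hPX k v x hx hv
      have := hPX l v x hx' hv
      grind
    · push Not at h
      have := hPP k l x hx hx' h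
      tauto
  exact ⟨card_edges_add_two_le a b hab hinj X P hX h1 hP h2 h3 h4 h5,
    card_edges_add_five_le a b hab hinj X P hX h1 hP h2 h3 h4 h5⟩

namespace Arrangement

variable {n : ℕ} {A : Arrangement n}

lemma isPathConnected_image {i : Fin n} {a b : ℝ} {D : Set ℝ} (hab : a < b) (h1 : Ioo a b ⊆ D)
    (h2 : D ⊆ Icc a b) (h : D ⊆ Icc 0 1) : IsPathConnected (A.f i '' D) := by
  have hconv : Convex ℝ D := by
    refine OrdConnected.convex ⟨fun x hx y hy z hz => ?_⟩
    rcases hz.1.eq_or_lt with rfl | hxz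
    · exact hx
    rcases hz.2.eq_or_lt with rfl | hzy
    · exact hy
    exact h1 ⟨(h2 hx).1.trans_lt hxz, hzy.trans_le (h2 hy).2⟩
  exact (hconv.isPathConnected ((nonempty_Ioo.2 hab).mono h1)).image' ((A.cont i).mono h)

variable (A) in
/-- A gap together with those of its ends that are not crossings. -/
def piece (g : Fin n × ℝ) : Set Pt := A.f g.1 '' Icc g.2 (A.next g.1 g.2) \ A.X

lemma notMem_X_of_mem_piece {g : Fin n × ℝ} {x : Pt} (hx : x ∈ A.piece g) : x ∉ A.X := hx.2

lemma piece_subset_curve {g : Fin n × ℝ} (hg : g ∈ A.gapSet) : A.piece g ⊆ A.curve g.1 := by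
  rintro _ ⟨⟨t, ht, rfl⟩, -⟩
  exact A.mem_curve (gapSet_Icc hg ht)

lemma arc_subset_piece {g : Fin n × ℝ} (hg : g ∈ A.gapSet) : A.arc g ⊆ A.piece g := fun _ hx =>
  ⟨image_mono Ioo_subset_Icc_self hx, (disjoint_arc_X hg).notMem_of_mem_left hx⟩

lemma piece_subset_F {g : Fin n × ℝ} (hg : g ∈ A.visibleGaps) : A.piece g ⊆ A.F :=
  sdiff_subset.trans (mem_visibleGaps.1 hg).2

lemma isPathConnected_piece_union {g : Fin n × ℝ} (hg : g ∈ A.gapSet) (E : Set Pt) :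
    IsPathConnected (A.piece g ∪
      A.f g.1 '' {t | t ∈ Icc g.2 (A.next g.1 g.2) ∧ A.f g.1 t ∈ E}) := by
  have : A.piece g ∪ A.f g.1 '' {t | t ∈ Icc g.2 (A.next g.1 g.2) ∧ A.f g.1 t ∈ E} =
      A.f g.1 '' {t | t ∈ Icc g.2 (A.next g.1 g.2) ∧ (A.f g.1 t ∉ A.X ∨ A.f g.1 t ∈ E)} := by
    ext x
    constructor
    · rintro (⟨⟨t, ht, rfl⟩, h⟩ | ⟨t, ⟨ht, h⟩, rfl⟩)
      · exact ⟨t, ⟨ht, Or.inl h⟩, rfl⟩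
      · exact ⟨t, ⟨ht, Or.inr h⟩, rfl⟩
    · rintro ⟨t, ⟨ht, h | h⟩, rfl⟩
      · exact Or.inl ⟨⟨t, ht, rfl⟩, h⟩
      · exact Or.inr ⟨t, ⟨ht, h⟩, rfl⟩
  rw [this]
  refine isPathConnected_image (lt_next_of_gap hg) (fun t ht => ⟨Ioo_subset_Icc_self ht, Or.inl ?_⟩)
    (fun t ht => ht.1) fun t ht => gapSet_Icc hg ht.1
  exact (disjoint_arc_X hg).notMem_of_mem_left (mem_image_of_mem _ ht)

lemma isPathConnected_piece {g : Fin n × ℝ} (hg : g ∈ A.gapSet) : IsPathConnected (A.piece g) := by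
  simpa using isPathConnected_piece_union hg ∅

lemma eq_of_mem_piece {g g' : Fin n × ℝ} (hg : g ∈ A.gapSet) (hg' : g' ∈ A.gapSet) {x : Pt}
    (hx : x ∈ A.piece g) (hx' : x ∈ A.piece g') : g = g' := by
  have hX := hx.2
  have h := eq_of_mem_X hX (piece_subset_curve hg hx) (piece_subset_curve hg' hx')
  obtain ⟨i, a⟩ := g
  obtain ⟨i', a'⟩ := g'
  obtain rfl : i = i' := h
  obtain ⟨⟨t, ht, rfl⟩, -⟩ := hx
  obtain ⟨⟨t', ht', heq⟩, -⟩ := hx'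
  obtain rfl := A.inj _ (gapSet_Icc hg' ht') (gapSet_Icc hg ht) heq
  have key : ∀ {a a' : ℝ}, (i, a) ∈ A.gapSet → (i, a') ∈ A.gapSet → t' ∈ Icc a (A.next i a) →
      t' ∈ Icc a' (A.next i a') → ¬ a < a' := by
    intro a a' hg hg' ht ht' hlt
    have h1 := A.next_le hg'.1 hlt
    have h2 : t' = a' := le_antisymm (ht.2.trans h1) ht'.1
    have h3 := hg.1.1.1
    have h4 := hg'.2
    rcases hg'.1.2 with h | h | h
    · linarith
    · linarith
    · rw [h2] at hX; exact hX h
  rcases lt_trichotomy a a' with h | h | h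
  · exact absurd h (key hg hg' ht ht')
  · rw [h]
  · exact absurd h (key hg' hg ht' ht)

lemma exists_visibleGap {i : Fin n} {x : Pt} (hx : x ∈ A.curve i) (hX : x ∉ A.X) (hF : x ∈ A.F) :
    ∃ g ∈ A.visibleGaps, g.1 = i ∧ x ∈ A.piece g := by
  obtain ⟨t, ht, rfl⟩ := exists_param hx
  have hvis : ∀ a, (i, a) ∈ A.gapSet → (A.arc (i, a) ∩ A.F).Nonempty →
      (i, a) ∈ A.visibleGaps := by
    rintro a ha ⟨y, hy, hyF⟩
    refine mem_visibleGaps.2 ⟨ha, image_Icc_subset_F ha ?_⟩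
    rcases arc_trichotomy ha with h | h | h
    · exact h.trans interior_subset
    · exact h.trans A.isClosed_F.frontier_subset
    · exact absurd hyF (h hy)
  by_cases hm : t ∈ A.marks i
  · have hW := mem_interior_of_end (hm.2.imp_right fun h => h.resolve_right hX) hX hF
    have hmeet : ∀ a, (i, a) ∈ A.gapSet → t ∈ Icc a (A.next i a) →
        (A.arc (i, a) ∩ A.F).Nonempty := by
      intro a ha hta
      have := ends_subset_closure_arc ha (mem_image_of_mem _ hta)
      obtain ⟨y, hy, hy'⟩ := mem_closure_iff.1 this _ isOpen_interior hW
      exact ⟨y, hy', interior_subset hy⟩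
    rcases hm.2.imp_right fun h => h.resolve_right hX with rfl | rfl
    · have hg : (i, (0 : ℝ)) ∈ A.gapSet := ⟨hm, zero_lt_one⟩
      have h0 := left_mem_Icc.2 (lt_next_of_gap hg).le
      exact ⟨_, hvis _ hg (hmeet _ hg h0), rfl, mem_image_of_mem _ h0, hX⟩
    · obtain ⟨a, ha, ha1, hb⟩ := A.exists_next_eq hm zero_lt_one
      have hg : (i, a) ∈ A.gapSet := ⟨ha, ha1⟩
      have h1 : (1 : ℝ) ∈ Icc a (A.next i a) := ⟨ha1.le, hb.ge⟩
      exact ⟨_, hvis _ hg (hmeet _ hg h1), rfl, mem_image_of_mem _ h1, hX⟩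
  · obtain ⟨a, ha, hta⟩ := exists_gap_of_notMem_marks ht hm
    have hmem : A.f i t ∈ A.arc (i, a) := mem_image_of_mem _ hta
    exact ⟨_, hvis a ha ⟨_, hmem, hF⟩, rfl, arc_subset_piece ha hmem⟩

lemma isPathConnected_curve (i : Fin n) : IsPathConnected (A.curve i) :=
  isPathConnected_image zero_lt_one Ioo_subset_Icc_self Subset.rfl Subset.rfl

variable (A) in
/-- Pairwise disjoint paths that join pairs of arcs of an arrangement which do not cross in the
face. -/
structure Links (κ : Type*) where
  path : κ → Set Pt
  src : κ → Fin n
  tgt : κ → Fin n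
  p : κ → Pt
  q : κ → Pt
  isPathConnected_path : ∀ k, IsPathConnected (path k)
  p_mem : ∀ k, p k ∈ path k
  q_mem : ∀ k, q k ∈ path k
  p_mem_curve : ∀ k, p k ∈ A.curve (src k)
  q_mem_curve : ∀ k, q k ∈ A.curve (tgt k)
  p_mem_F : ∀ k, p k ∈ A.F
  src_ne_tgt : ∀ k, src k ≠ tgt k
  eq_of_mem : ∀ k l, ∀ x ∈ path k, x ∈ path l → k = l
  notMem_X : ∀ k, ∀ x ∈ path k, x ∉ A.X
  eq_or_eq : ∀ k, ∀ x ∈ path k, ∀ l, x ∈ A.curve l → l = src k ∨ l = tgt k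
  eq_p : ∀ k, ∀ x ∈ path k, x ∈ A.curve (src k) → x ∈ A.F → x = p k
  eq_q : ∀ k, ∀ x ∈ path k, x ∈ A.curve (tgt k) → x ∈ A.F → x = q k
  eq_p_of_mem_F : ∀ k, q k ∉ A.F → ∀ x ∈ path k, x ∈ A.F → x = p k
  eq_of_pair_eq : ∀ k l, s(src k, tgt k) = s(src l, tgt l) → k = l
  not_cross : ∀ k, ∀ x ∈ A.curve (src k), x ∈ A.curve (tgt k) → x ∉ A.F

variable (A) in
/-- The vertices of the graph formed by the arcs of color `!β` and the visible gaps of color `β`. -/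
abbrev GapVertex (β : Bool) : Type :=
  {i : Fin n // A.color i = !β} ⊕ {g : Fin n × ℝ // g ∈ A.visibleGaps ∧ A.color g.1 = β}

namespace GapVertex

variable {β : Bool}

/-- The points of a vertex. -/
def carrier (v : A.GapVertex β) : Set Pt := v.elim (fun i => A.curve i.1) fun g => A.piece g.1

/-- The arc that contains a vertex. -/
def owner (v : A.GapVertex β) : Fin n := v.elim (fun i => i.1) fun g => g.1.1

lemma gapSet_of (g : {g : Fin n × ℝ // g ∈ A.visibleGaps ∧ A.color g.1 = β}) :
    (g : Fin n × ℝ) ∈ A.gapSet := (mem_visibleGaps.1 g.2.1).1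

lemma carrier_subset (v : A.GapVertex β) : carrier v ⊆ A.curve (owner v) := by
  rcases v with i | g
  · exact Subset.rfl
  · exact piece_subset_curve (gapSet_of g)

lemma eq_inl_of_color {v : A.GapVertex β} (h : A.color (owner v) = !β) :
    v = Sum.inl ⟨owner v, h⟩ := by
  rcases v with i | g
  · rfl
  · have := g.2.2.symm.trans h
    simp at this

lemma mem_F_of_color {v : A.GapVertex β} (h : A.color (owner v) ≠ !β) {x : Pt}
    (hx : x ∈ carrier v) : x ∈ A.F := by
  rcases v with i | g
  · exact absurd i.2 h
  · exact piece_subset_F g.2.1 hx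

lemma eq_of_mem {v w : A.GapVertex β} {x : Pt} (hv : x ∈ carrier v) (hw : x ∈ carrier w) :
    v = w := by
  rcases v with i | g <;> rcases w with j | h
  · exact congrArg Sum.inl (Subtype.ext (eq_of_color_eq hv hw (i.2.trans j.2.symm)))
  · have h1 := eq_of_mem_X (notMem_X_of_mem_piece hw) hv (carrier_subset _ hw)
    have h2 := i.2.symm.trans ((congrArg A.color h1).trans h.2.2)
    simp at h2
  · have h1 := eq_of_mem_X (notMem_X_of_mem_piece hv) hw (carrier_subset _ hv)
    have h2 := j.2.symm.trans ((congrArg A.color h1).trans g.2.2)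
    simp at h2
  · exact congrArg Sum.inr (Subtype.ext (eq_of_mem_piece (gapSet_of g) (gapSet_of h) hv hw))

lemma isPathConnected_carrier (v : A.GapVertex β) : IsPathConnected (carrier v) := by
  rcases v with i | g
  · exact isPathConnected_curve _
  · exact isPathConnected_piece (gapSet_of g)

lemma exists_of_mem_curve {i : Fin n} {x : Pt} (hx : x ∈ A.curve i) (hX : x ∉ A.X)
    (h : x ∈ A.F ∨ A.color i = !β) : ∃ v : A.GapVertex β, owner v = i ∧ x ∈ carrier v := by
  by_cases hc : A.color i = !β
  · exact ⟨Sum.inl ⟨i, hc⟩, rfl, hx⟩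
  · obtain ⟨g, hg, rfl, hxg⟩ := exists_visibleGap hx hX (h.resolve_right hc)
    exact ⟨Sum.inr ⟨g, hg, by simpa using hc⟩, rfl, hxg⟩

end GapVertex

lemma color_eq_not_of_mem {i j : Fin n} {β : Bool} {x : Pt} (hij : i ≠ j) (hi : x ∈ A.curve i)
    (hj : x ∈ A.curve j) (h : A.color i = β) : A.color j = !β := by
  have := color_ne_of_mem hij hi hj
  rw [h] at this
  revert this
  cases A.color j <;> cases β <;> simp

open GapVertex in
open Classical in
lemma Links.card_add_card_gapIncidences_add_two_le {κ : Type*} [Fintype κ] (L : A.Links κ)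
    (β : Bool) (hne : A.visibleGaps.Nonempty) :
    (Finset.univ.filter fun k => L.q k ∈ A.F ∨ A.color (L.tgt k) = !β).card +
      (A.gapIncidences.filter fun e => A.color e.1.1 = β).card + 2 ≤
      3 * ((Finset.univ.filter fun i => A.color i = !β).card +
        (A.visibleGaps.filter fun g => A.color g.1 = β).card) := by
  let E₁ := {k // L.q k ∈ A.F ∨ A.color (L.tgt k) = !β}
  let E₂ := {e : (Fin n × ℝ) × Fin n // e ∈ A.gapIncidences ∧ A.color e.1.1 = β}
  have hfV : Finite {g : Fin n × ℝ // g ∈ A.visibleGaps ∧ A.color g.1 = β} :=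
    (A.visibleGaps.finite_toSet.subset fun g (hg : g ∈ A.visibleGaps ∧ A.color g.1 = β) => hg.1)
  have hfE : Finite E₂ :=
    (A.gapIncidences.finite_toSet.subset
      fun g (hg : g ∈ A.gapIncidences ∧ A.color g.1.1 = β) => hg.1)
  have := Fintype.ofFinite {g : Fin n × ℝ // g ∈ A.visibleGaps ∧ A.color g.1 = β}
  have := Fintype.ofFinite E₂
  have hV1 : 1 ≤ Fintype.card (A.GapVertex β) := by
    obtain ⟨g, hg⟩ := hne
    by_cases h : A.color g.1 = β
    · exact Fintype.card_pos_iff.2 ⟨Sum.inr ⟨g, hg, h⟩⟩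
    · exact Fintype.card_pos_iff.2
        ⟨Sum.inl ⟨g.1, by revert h; cases A.color g.1 <;> cases β <;> simp⟩⟩
  have hpX := fun k => L.notMem_X k _ (L.p_mem k)
  have hqX := fun k => L.notMem_X k _ (L.q_mem k)
  have hsrc : ∀ k, ∃ v : A.GapVertex β, owner v = L.src k ∧ L.p k ∈ carrier v := fun k =>
    exists_of_mem_curve (L.p_mem_curve k) (hpX k) (Or.inl (L.p_mem_F k))
  choose a ha hpa using hsrc
  have htgt : ∀ k : E₁, ∃ v : A.GapVertex β, owner v = L.tgt k ∧ L.q k ∈ carrier v := fun k =>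
    exists_of_mem_curve (L.q_mem_curve k) (hqX k) k.2
  choose b hb hqb using htgt
  have hE₂ := fun e : E₂ => mem_gapIncidences.1 e.2.1
  have hgE₂ := fun e : E₂ => (mem_visibleGaps.1 (hE₂ e).1).1
  choose s hs using fun e : E₂ => (hE₂ e).2.2
  have hcol : ∀ e : E₂, A.color e.1.2 = !β := fun e =>
    color_eq_not_of_mem (hE₂ e).2.1 (endPt_mem_curve (hgE₂ e) (s e)) (hs e) e.2.2
  let u : E₂ → A.GapVertex β := fun e => Sum.inr ⟨e.1.1, (hE₂ e).1, e.2.2⟩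
  let w : E₂ → A.GapVertex β := fun e => Sum.inl ⟨e.1.2, hcol e⟩
  let Q : E₂ → Set Pt := fun e => A.piece e.1.1 ∪ A.f e.1.1.1 ''
    {t | t ∈ Icc e.1.1.2 (A.next e.1.1.1 e.1.1.2) ∧ A.f e.1.1.1 t ∈ A.curve e.1.2}
  have hQ : ∀ e : E₂, ∀ x ∈ Q e, x ∈ A.piece e.1.1 ∨ x ∈ A.curve e.1.2 := by
    rintro e x (hx | ⟨t, ht, rfl⟩)
    · exact Or.inl hx
    · exact Or.inr ht.2
  have hown : ∀ v w : A.GapVertex β, owner v ≠ owner w → v ≠ w := fun v w h h' => h (by rw [h'])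
  have key := (card_edges_add_two_le_of_forall (V := A.GapVertex β) (K := E₁ ⊕ E₂)
    (Sum.elim (fun k => a k) u) (Sum.elim b w) ?_ ?_ carrier
    (Sum.elim (fun k => L.path k) Q) isPathConnected_carrier (fun _ _ _ => GapVertex.eq_of_mem)
    ?_ ?_ ?_ ?_ ?_).1 hV1
  · have e1 : Fintype.card E₁ = _ := Fintype.card_subtype _
    have e2 : Fintype.card E₂ = (A.gapIncidences.filter fun e => A.color e.1.1 = β).card :=
      Fintype.card_of_subtype _ (by simp)
    have e3 : Fintype.card {i : Fin n // A.color i = !β} = _ := Fintype.card_subtype _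
    have e4 : Fintype.card {g : Fin n × ℝ // g ∈ A.visibleGaps ∧ A.color g.1 = β} =
        (A.visibleGaps.filter fun g => A.color g.1 = β).card :=
      Fintype.card_of_subtype _ (by simp)
    rwa [Fintype.card_sum, Fintype.card_sum, e1, e2, e3, e4] at key
  · rintro (k | e)
    · exact hown _ _ (by simp only [Sum.elim_inl]; rw [ha, hb]; exact L.src_ne_tgt k)
    · exact Sum.inr_ne_inl
  · have hne12 : ∀ (k : E₁) (e : E₂), s(a k, b k) ≠ s(u e, w e) := by
      intro k e h
      have h' := congrArg (Sym2.map owner) h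
      simp only [Sym2.map_mk, ha, hb] at h'
      have hcr := endPt_mem_curve (hgE₂ e) (s e)
      have hF := endPt_mem_F (hE₂ e).1 (s e)
      rcases Sym2.eq_iff.1 h' with ⟨h1, h2⟩ | ⟨h1, h2⟩
      · exact L.not_cross k _ (by rw [h1]; exact hcr) (by rw [h2]; exact hs e) hF
      · exact L.not_cross k _ (by rw [h1]; exact hs e) (by rw [h2]; exact hcr) hF
    rintro (k | e) (l | e') h
    · have h' := congrArg (Sym2.map owner) h
      simp only [Sum.elim_inl, Sym2.map_mk, ha, hb] at h'
      exact congrArg Sum.inl (Subtype.ext (L.eq_of_pair_eq _ _ h'))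
    · exact absurd h (hne12 k e')
    · exact absurd h.symm (hne12 l e)
    · simp only [Sum.elim_inr, u, w, Sym2.eq_iff, Sum.inr.injEq, Sum.inl.injEq, reduceCtorEq,
        false_and, or_false, Subtype.mk.injEq] at h
      exact congrArg Sum.inr (Subtype.ext (Prod.ext h.1 h.2))
  · rintro (k | e)
    · exact L.isPathConnected_path k
    · exact isPathConnected_piece_union (hgE₂ e) _
  · rintro (k | e)
    · exact ⟨_, L.p_mem k, hpa k⟩
    · obtain ⟨x, hx⟩ := (isPathConnected_piece (hgE₂ e)).nonempty
      exact ⟨x, Or.inl hx, hx⟩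
  · rintro (k | e)
    · exact ⟨_, L.q_mem k, hqb k⟩
    · exact ⟨_, Or.inr ⟨_, ⟨endParam_mem_Icc (hgE₂ e) (s e), hs e⟩, rfl⟩, hs e⟩
  · rintro (k | e) v x hx hv
    · have hvx := carrier_subset v hv
      have hcase : ∀ {i y v'}, owner v = i → x ∈ A.curve i → owner v' = i → y ∈ carrier v' →
          (x ∈ A.F → x = y) → v = v' := by
        intro i y v' hi hxi hi' hy heq
        by_cases hc : A.color (owner v) = !β
        · have hc' : A.color (owner v') = !β := by rwa [hi', ← hi]
          rw [eq_inl_of_color hc, eq_inl_of_color hc']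
          simp [hi, hi']
        · rw [← heq (mem_F_of_color hc hv)] at hy
          exact GapVertex.eq_of_mem hv hy
      refine (L.eq_or_eq k x hx _ hvx).imp (fun h => ?_) fun h => ?_
      · exact hcase h (h ▸ hvx) (ha k) (hpa k) (L.eq_p k x hx (h ▸ hvx))
      · exact hcase h (h ▸ hvx) (hb k) (hqb k) (L.eq_q k x hx (h ▸ hvx))
    · rcases hQ e x hx with h | h
      · exact Or.inl (GapVertex.eq_of_mem hv (show x ∈ carrier (u e) from h))
      · exact Or.inr (GapVertex.eq_of_mem hv (show x ∈ carrier (w e) from h))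
  · have hQv : ∀ (e : E₂), ∀ x ∈ Q e, ∃ v : A.GapVertex β, x ∈ carrier v := by
      intro e x hx
      rcases hQ e x hx with h | h
      · exact ⟨u e, h⟩
      · exact ⟨w e, h⟩
    rintro (k | e) (l | e') x hx hx' hnot
    · obtain rfl := Subtype.ext (L.eq_of_mem k l x hx hx')
      exact Or.inl rfl
    · obtain ⟨v, hv⟩ := hQv e' x hx'
      exact absurd hv (hnot v)
    · obtain ⟨v, hv⟩ := hQv e x hx
      exact absurd hv (hnot v)
    · obtain ⟨v, hv⟩ := hQv e x hx
      exact absurd hv (hnot v)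

end Arrangement

/-- Near every boundary point of a region there is a point of the boundary that is accessible by a
segment. -/
lemma IsRegion.exists_isPathConnected_insert {s U : Set Pt} (h : IsRegion s U) (hs : IsClosed s)
    {p : Pt} (hp : p ∈ closure U) (hps : p ∈ s) {ε : ℝ} (hε : 0 < ε) :
    ∃ y ∈ s, dist y p < ε ∧ IsPathConnected (insert y U) := by
  obtain ⟨u, hu, hup⟩ := Metric.mem_closure_iff.1 hp ε hε
  let φ : ℝ → Pt := AffineMap.lineMap u p
  have hφ : Continuous φ := AffineMap.lineMap_continuous
  let T := {t | t ∈ Icc (0 : ℝ) 1 ∧ φ t ∈ s}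
  have hT : IsClosed T := isClosed_Icc.inter (hs.preimage hφ)
  have hTb : BddBelow T := ⟨0, fun t ht => ht.1.1⟩
  have hTn : T.Nonempty := ⟨1, by simp [T, φ, hps]⟩
  set t := sInf T
  have ht : t ∈ T := hT.csInf_mem hTn hTb
  have hlt : ∀ r ∈ Ico 0 t, φ r ∉ s := fun r hr hrs =>
    absurd (csInf_le hTb (⟨⟨hr.1, hr.2.le.trans ht.1.2⟩, hrs⟩ : r ∈ T)) (not_le.2 hr.2)
  have hφ0 : φ 0 = u := AffineMap.lineMap_apply_zero _ _
  have ht0 : 0 < t := by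
    refine ht.1.1.lt_of_ne fun h0 => ?_
    have := ht.2
    rw [← h0, hφ0] at this
    exact disjoint_left.1 h.disjoint hu this
  have h0 : (0 : ℝ) ∈ Ico 0 t := ⟨le_rfl, ht0⟩
  have hsub : φ '' Ico 0 t ⊆ U := by
    refine h.subset_of_isPreconnected _ (isPreconnected_Ico.image _ hφ.continuousOn) ?_
      ⟨u, ⟨0, h0, hφ0⟩, hu⟩
    rw [disjoint_left]
    rintro _ ⟨r, hr, rfl⟩
    exact hlt r hr
  refine ⟨φ t, ht.2, ?_, ?_⟩
  · have : dist (φ t) p = (1 - t) * dist u p := by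
      rw [dist_lineMap_right, Real.norm_eq_abs, abs_of_nonneg (by linarith [ht.1.2])]
    rw [this, dist_comm u p]
    nlinarith [dist_nonneg (x := p) (y := u), ht.1.1]
  · have : insert (φ t) U = U ∪ φ '' Icc 0 t := by
      rw [← Ico_insert_right ht0.le, image_insert_eq, union_insert, union_eq_left.2 hsub]
    rw [this]
    exact h.isPathConnected.union
      (((convex_Icc 0 t).isPathConnected ⟨0, le_rfl, ht0.le⟩).image hφ)
      ⟨u, hu, 0, ⟨le_rfl, ht0.le⟩, hφ0⟩

namespace Arrangement

variable {n : ℕ} {A : Arrangement n}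

lemma exists_accessible {i : Fin n} {t₀ : ℝ} (ht₀ : t₀ ∈ Icc (0 : ℝ) 1) (hX : A.f i t₀ ∉ A.X)
    (hF : A.f i t₀ ∈ A.F) {D : Set ℝ} (hD : IsOpen D) (htD : t₀ ∈ D) :
    ∃ t ∈ Icc (0 : ℝ) 1, t ∈ D ∧ IsPathConnected (insert (A.f i t) A.U) := by
  obtain ⟨η, hη, hηD⟩ := Metric.isOpen_iff.1 hD t₀ htD
  obtain ⟨ε, hε, hg⟩ := A.exists_germ (A.f i t₀) (η := fun _ => η) fun _ => hη
  obtain ⟨y, hy, hyd, hyU⟩ := A.isRegion.exists_isPathConnected_insert A.isClosed_support hF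
    (A.mem_support ht₀) hε
  obtain ⟨j, u₀, hu₀, t, ht, h1, h2, h3⟩ := hg y hy hyd
  obtain rfl : j = i := eq_of_mem_X hX (h1 ▸ A.mem_curve hu₀) (A.mem_curve ht₀)
  obtain rfl := A.inj _ hu₀ ht₀ h1
  exact ⟨t, ht, hηD h3, h2 ▸ hyU⟩

namespace Links

variable {κ : Type*} (L : A.Links κ)

lemma p_mem_frontier {k : κ} (hk : L.q k ∉ A.F) : L.p k ∈ frontier A.F := by
  refine mem_frontier_F (L.p_mem_F k) fun hint => ?_
  have hqp : L.q k ≠ L.p k := fun h => hk (h ▸ L.p_mem_F k)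
  obtain ⟨x, hx, hxF, hxp⟩ := (L.isPathConnected_path k).isConnected.isPreconnected
    (interior A.F) {L.p k}ᶜ isOpen_interior isOpen_compl_singleton
    (fun x _ => by
      rcases eq_or_ne x (L.p k) with rfl | h
      exacts [Or.inl hint, Or.inr h]) ⟨_, L.p_mem k, hint⟩
    ⟨_, L.q_mem k, hqp⟩
  exact hxp (L.eq_p_of_mem_F k hk x hx (interior_subset hxF))

lemma path_subset_compl {k : κ} (hk : L.q k ∉ A.F) : L.path k ⊆ (interior A.F)ᶜ := by
  intro x hx hint
  have h := L.p_mem_frontier hk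
  rw [← L.eq_p_of_mem_F k hk x hx (interior_subset hint), A.isClosed_F.frontier_eq] at h
  exact h.2 hint

lemma exists_outerGap {k : κ} (hk : L.q k ∉ A.F) :
    ∃ g ∈ A.outerGaps, g.1 = L.src k ∧ L.p k ∈ A.arc g := by
  obtain ⟨t, ht, htp⟩ := exists_param (L.p_mem_curve k)
  have hfr := L.p_mem_frontier hk
  have hm : t ∉ A.marks (L.src k) := fun h =>
    L.notMem_X k _ (L.p_mem k) (htp ▸ mem_X_of_mem_frontier h (htp ▸ hfr))
  obtain ⟨a, ha, hta⟩ := exists_gap_of_notMem_marks ht hm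
  have hp : L.p k ∈ A.arc (L.src k, a) := ⟨t, hta, htp⟩
  exact ⟨_, mem_outerGaps.2 ⟨ha, arc_subset_of_mem_frontier ha hp hfr⟩, rfl, hp⟩

/-- The component of the complement of the interior of the face that contains the path. -/
def blob (k : κ) : Set Pt :=
  connectedComponentIn (interior A.F)ᶜ (L.p k)

lemma image_Icc_subset_compl {g : Fin n × ℝ} (hg : g ∈ A.outerGaps) :
    A.f g.1 '' Icc g.2 (A.next g.1 g.2) ⊆ (interior A.F)ᶜ := by
  obtain ⟨h1, h2⟩ := mem_outerGaps.1 hg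
  refine (arc_subset_or_subset_compl h1).resolve_left fun h => ?_
  obtain ⟨x, hx⟩ := (isConnected_arc h1).nonempty
  have := h2 hx
  rw [A.isClosed_F.frontier_eq] at this
  exact this.2 (h hx)

end Links

lemma endPt_mem_X {g : Fin n × ℝ} (hg : g ∈ A.outerGaps) (s : Bool) : A.endPt g s ∈ A.X := by
  obtain ⟨h1, h2⟩ := mem_outerGaps.1 hg
  refine mem_X_of_mem_frontier (endParam_mem_marks h1 s) (mem_frontier_F
    (image_Icc_subset_F h1 (h2.trans A.isClosed_F.frontier_subset)
      (mem_image_of_mem _ (endParam_mem_Icc h1 s)))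
    (Links.image_Icc_subset_compl hg (mem_image_of_mem _ (endParam_mem_Icc h1 s))))

namespace Links

variable {κ : Type*} (L : A.Links κ)

lemma mem_blob {k : κ} (hk : L.q k ∉ A.F) : L.p k ∈ L.blob k :=
  mem_connectedComponentIn (L.path_subset_compl hk (L.p_mem k))

lemma image_Icc_subset_blob {k : κ} {g : Fin n × ℝ} (hg : g ∈ A.outerGaps)
    (hp : L.p k ∈ A.arc g) : A.f g.1 '' Icc g.2 (A.next g.1 g.2) ⊆ L.blob k :=
  (isPreconnected_image_Icc (mem_outerGaps.1 hg).1).subset_connectedComponentIn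
    (image_mono Ioo_subset_Icc_self hp) (image_Icc_subset_compl hg)

lemma path_subset_blob {k : κ} (hk : L.q k ∉ A.F) : L.path k ⊆ L.blob k :=
  (L.isPathConnected_path k).isConnected.isPreconnected.subset_connectedComponentIn (L.p_mem k)
    (L.path_subset_compl hk)

lemma blob_mem_blobs {k : κ} (hk : L.q k ∉ A.F) : L.blob k ∈ A.blobs := by
  obtain ⟨g, hg, -, hp⟩ := L.exists_outerGap hk
  have hI := endParam_mem_Icc (mem_outerGaps.1 hg).1 false
  have hm := L.image_Icc_subset_blob hg hp (mem_image_of_mem _ hI)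
  refine mem_blobs.2 ⟨A.endPt g false, endPt_mem_X hg false, ?_, (connectedComponentIn_eq hm).symm⟩
  obtain ⟨h1, h2⟩ := mem_outerGaps.1 hg
  exact mem_frontier_F (image_Icc_subset_F h1 (h2.trans A.isClosed_F.frontier_subset)
    (mem_image_of_mem _ hI)) (image_Icc_subset_compl hg (mem_image_of_mem _ hI))

end Links

/-- Arcs of both colors meet every blob. -/
lemma exists_color_of_mem_blobs {Q : Set Pt} (hQ : Q ∈ A.blobs) (β : Bool) :
    ∃ i, A.color i = β ∧ (A.curve i ∩ Q).Nonempty := by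
  obtain ⟨x, ⟨i, j, hij, hi, hj⟩, hx, rfl⟩ := mem_blobs.1 hQ
  have hxQ : x ∈ connectedComponentIn (interior A.F)ᶜ x := by
    refine mem_connectedComponentIn fun h => ?_
    rw [A.isClosed_F.frontier_eq] at hx
    exact hx.2 h
  by_cases h : A.color i = β
  · exact ⟨i, h, x, hi, hxQ⟩
  · refine ⟨j, ?_, x, hj, hxQ⟩
    have := color_ne_of_mem hij hi hj
    revert h this
    cases A.color i <;> cases A.color j <;> cases β <;> simp

lemma isPathConnected_image_of_uIoo {g : Fin n × ℝ} (hg : g ∈ A.gapSet) {t e : ℝ} (hte : t ≠ e)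
    (ht : t ∈ Icc g.2 (A.next g.1 g.2)) (he : e ∈ Icc g.2 (A.next g.1 g.2)) {D : Set ℝ}
    (h1 : uIoo t e ⊆ D) (h2 : D ⊆ uIcc t e) : IsPathConnected (A.f g.1 '' D) := by
  have h3 : uIcc t e ⊆ Icc g.2 (A.next g.1 g.2) := uIcc_subset_Icc ht he
  exact isPathConnected_image (inf_lt_sup.2 hte) h1 h2 fun x hx => gapSet_Icc hg (h3 (h2 hx))

variable (A) in
/-- The part of a gap that lies strictly between a parameter and an end. -/
def half (g : Fin n × ℝ) (t : ℝ) (s : Bool) : Set Pt := A.f g.1 '' uIoo t (A.endParam g s)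

lemma uIoo_endParam_subset {g : Fin n × ℝ} {t : ℝ} (ht : t ∈ Ioo g.2 (A.next g.1 g.2)) (s : Bool) :
    uIoo t (A.endParam g s) ⊆ Ioo g.2 (A.next g.1 g.2) := by
  cases s
  · simp only [endParam, Bool.false_eq_true, if_false, uIoo_of_gt ht.1]
    exact Ioo_subset_Ioo_right ht.2.le
  · simp only [endParam, if_true, uIoo_of_lt ht.2]
    exact Ioo_subset_Ioo_left ht.1.le

lemma half_subset_arc {g : Fin n × ℝ} {t : ℝ} (ht : t ∈ Ioo g.2 (A.next g.1 g.2)) (s : Bool) :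
    A.half g t s ⊆ A.arc g := image_mono (uIoo_endParam_subset ht s)

lemma endParam_ne {g : Fin n × ℝ} {t : ℝ} (ht : t ∈ Ioo g.2 (A.next g.1 g.2)) (s : Bool) :
    t ≠ A.endParam g s := by
  cases s
  · exact ht.1.ne'
  · exact ht.2.ne

lemma eq_of_mem_half {g : Fin n × ℝ} (hg : g ∈ A.gapSet) {t : ℝ}
    (ht : t ∈ Ioo g.2 (A.next g.1 g.2)) {s s' : Bool} {x : Pt} (hx : x ∈ A.half g t s)
    (hx' : x ∈ A.half g t s') : s = s' := by
  have key : ∀ x, x ∈ A.half g t false → x ∉ A.half g t true := by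
    rintro _ ⟨u, hu, rfl⟩ ⟨v, hv, h⟩
    obtain rfl := A.inj _
      (gapSet_Icc hg (Ioo_subset_Icc_self (uIoo_endParam_subset ht true hv)))
      (gapSet_Icc hg (Ioo_subset_Icc_self (uIoo_endParam_subset ht false hu))) h
    simp only [endParam, Bool.false_eq_true, if_false, uIoo_of_gt ht.1] at hu
    simp only [endParam, if_true, uIoo_of_lt ht.2] at hv
    exact lt_asymm hu.2 hv.1
  cases s <;> cases s' <;> first | rfl | exact absurd hx' (key _ hx) | exact absurd hx (key _ hx')

lemma notMem_half {g : Fin n × ℝ} (hg : g ∈ A.gapSet) {t : ℝ}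
    (ht : t ∈ Ioo g.2 (A.next g.1 g.2)) (s : Bool) : A.f g.1 t ∉ A.half g t s := by
  rintro ⟨u, hu, h⟩
  obtain rfl := A.inj _ (gapSet_Icc hg (Ioo_subset_Icc_self (uIoo_endParam_subset ht s hu)))
    (gapSet_Icc hg (Ioo_subset_Icc_self ht)) h
  simp only [uIoo, mem_Ioo, inf_lt_left, left_lt_sup, not_le] at hu
  exact lt_asymm hu.1 hu.2

lemma exists_mem_half {g : Fin n × ℝ} {t : ℝ} (ht : t ∈ Ioo g.2 (A.next g.1 g.2)) {x : Pt}
    (hx : x ∈ A.arc g) : x = A.f g.1 t ∨ ∃ s, x ∈ A.half g t s := by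
  obtain ⟨u, hu, rfl⟩ := hx
  rcases lt_trichotomy u t with h | rfl | h
  · exact Or.inr ⟨false, u, by simp [endParam, uIoo_of_gt ht.1, hu.1, h], rfl⟩
  · exact Or.inl rfl
  · exact Or.inr ⟨true, u, by simp [endParam, uIoo_of_lt ht.2, hu.2, h], rfl⟩

lemma nonempty_half {g : Fin n × ℝ} {t : ℝ} (ht : t ∈ Ioo g.2 (A.next g.1 g.2)) (s : Bool) :
    ∃ u ∈ Ioo g.2 (A.next g.1 g.2), u ∈ uIoo t (A.endParam g s) := by
  obtain ⟨u, hu⟩ := (nonempty_Ioo.2 (inf_lt_sup.2 (endParam_ne ht s)))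
  exact ⟨u, uIoo_endParam_subset ht s hu, hu⟩

lemma exists_accessible_half {g : Fin n × ℝ} (hg : g ∈ A.outerGaps) {t : ℝ}
    (ht : t ∈ Ioo g.2 (A.next g.1 g.2)) (s : Bool) :
    ∃ y ∈ A.half g t s, IsPathConnected (insert y A.U) := by
  obtain ⟨u, hu, hus⟩ := nonempty_half ht s
  obtain ⟨h1, h2⟩ := mem_outerGaps.1 hg
  have hm : A.f g.1 u ∈ A.arc g := mem_image_of_mem _ hu
  obtain ⟨v, -, hvD, h⟩ := exists_accessible (gapSet_Icc h1 (Ioo_subset_Icc_self hu))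
    ((disjoint_arc_X h1).notMem_of_mem_left hm) (A.isClosed_F.frontier_subset (h2 hm))
    isOpen_Ioo hus
  exact ⟨_, mem_image_of_mem _ hvD, h⟩

lemma exists_other_color_of_mem_X {i : Fin n} {β : Bool} {x : Pt} (hX : x ∈ A.X)
    (hi : x ∈ A.curve i) (h : A.color i = β) :
    ∃ j, A.color j = !β ∧ x ∈ A.curve j := by
  obtain ⟨j, k, hjk, hj, hk⟩ := hX
  by_cases hij : i = j
  · subst hij
    exact ⟨k, color_eq_not_of_mem hjk hj hk h, hk⟩
  · exact ⟨j, color_eq_not_of_mem hij hi hj h, hj⟩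

open Classical in
lemma Links.card_weak_add_two_le {κ : Type*} [Fintype κ] (L : A.Links κ) (β : Bool) {Q : Set Pt}
    (hQ : Q ∈ A.blobs) :
    (Finset.univ.filter fun k => (L.q k ∉ A.F ∧ L.blob k = Q) ∧ A.color (L.tgt k) = !β).card + 2 ≤
      3 * (Finset.univ.filter fun i => A.color i = (!β) ∧ (A.curve i ∩ Q).Nonempty).card := by
  let B : κ → Prop := fun k => (L.q k ∉ A.F ∧ L.blob k = Q) ∧ A.color (L.tgt k) = !β
  let G := {g : Fin n × ℝ // g ∈ A.outerGaps ∧ A.color g.1 = β ∧ ∃ k, B k ∧ L.p k ∈ A.arc g}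
  have hfG : Finite G := A.outerGaps.finite_toSet.subset
    fun g (hg : g ∈ A.outerGaps ∧ _) => hg.1
  have := Fintype.ofFinite G
  choose sp hspB hspp using fun g : G => g.2.2.2
  choose τ hτ hτp using hspp
  have hgap : ∀ g : G, (g : Fin n × ℝ) ∈ A.gapSet := fun g => (mem_outerGaps.1 g.2.1).1
  have harcF : ∀ g : G, A.arc g ⊆ A.F := fun g =>
    (mem_outerGaps.1 g.2.1).2.trans A.isClosed_F.frontier_subset
  have harcX : ∀ g : G, ∀ x ∈ A.arc g, x ∉ A.X := fun g x hx =>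
    (disjoint_arc_X (hgap g)).notMem_of_mem_left hx
  have hhalf : ∀ (g : G) s, A.half g (τ g) s ⊆ A.arc g := fun g s => half_subset_arc (hτ g) s
  have hcurve : ∀ g : G, A.arc g ⊆ A.curve g.1.1 := fun g => arc_subset_curve (hgap g)
  have hcolG : ∀ g : G, A.color g.1.1 = β := fun g => g.2.2.1
  have hsrc : ∀ (k : κ) (g : G), L.p k ∈ A.arc g → L.src k = g.1.1 := fun k g h =>
    eq_of_mem_X (harcX g _ h) (L.p_mem_curve k) (hcurve g h)
  have hGeq : ∀ (g g' : G) x, x ∈ A.arc g → x ∈ A.arc g' → g = g' := fun g g' x h h' =>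
    Subtype.ext (eq_of_mem_piece (hgap g) (hgap g') (arc_subset_piece (hgap g) h)
      (arc_subset_piece (hgap g') h'))
  have hsparc : ∀ g : G, L.p (sp g) ∈ A.arc g := fun g => ⟨_, hτ g, hτp g⟩
  have hspinj : Function.Injective sp := fun g g' h =>
    hGeq g g' (L.p (sp g)) (hsparc g) (h ▸ hsparc g')
  have hsp_half : ∀ (g g' : G) s, L.p (sp g) ∉ A.half g' (τ g') s := by
    intro g g' s h
    obtain rfl := hGeq g g' _ (hsparc g) (hhalf _ _ h)
    rw [← hτp g] at h
    exact notMem_half (hgap g) (hτ g) s h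
  have hendX : ∀ (g : G) s, A.endPt g s ∈ A.X := fun g s => endPt_mem_X g.2.1 s
  have hendF : ∀ (g : G) s, A.endPt g s ∈ A.F := fun g s =>
    image_Icc_subset_F (hgap g) (harcF g) (mem_image_of_mem _ (endParam_mem_Icc (hgap g) s))
  have hblob : ∀ g : G, A.f g.1.1 '' Icc g.1.2 (A.next g.1.1 g.1.2) ⊆ Q := fun g => by
    rw [← (hspB g).1.2]
    exact L.image_Icc_subset_blob g.2.1 (hsparc g)
  choose o hcolo hocurve using fun (e : G × Bool) =>
    exists_other_color_of_mem_X (hendX e.1 e.2) (endPt_mem_curve (hgap e.1) e.2) (hcolG e.1)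
  choose y hy hyU using fun (e : G × Bool) => exists_accessible_half e.1.2.1 (hτ e.1) e.2
  have hUs : ∀ x ∈ A.U, ∀ i, x ∉ A.curve i := fun x hx i h =>
    disjoint_left.1 A.isRegion.disjoint hx (A.curve_subset_support i h)
  let I := {i // A.color i = (!β) ∧ (A.curve i ∩ Q).Nonempty}
  let V := I ⊕ (G × Bool) ⊕ Unit
  let X : V → Set Pt := Sum.elim (fun i => A.curve i.1)
    (Sum.elim (fun e => A.half e.1 (τ e.1) e.2) fun _ => A.U)
  let owner : V → Option (Fin n) := Sum.elim (fun i => some i.1)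
    (Sum.elim (fun e => some e.1.1.1) fun _ => none)
  have hXX : ∀ v w, ∀ x ∈ X v, x ∈ X w → v = w := by
    have h1 : ∀ (i : I) (e : G × Bool) x, x ∈ A.curve i.1 → x ∉ A.half e.1 (τ e.1) e.2 := by
      intro i e x hi he
      have := eq_of_mem_X (harcX _ _ (hhalf _ _ he)) hi (hcurve _ (hhalf _ _ he))
      have h2 := i.2.1
      rw [this, hcolG] at h2
      simp at h2
    rintro (i | e | u) (j | e' | u') x hx hx'
    · exact congrArg Sum.inl (Subtype.ext (eq_of_color_eq hx hx' (i.2.1.trans j.2.1.symm)))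
    · exact absurd hx' (h1 _ _ _ hx)
    · exact absurd hx (hUs _ hx' _)
    · exact absurd hx (h1 _ _ _ hx')
    · obtain ⟨g, s⟩ := e
      obtain ⟨g', s'⟩ := e'
      obtain rfl := hGeq g g' x (hhalf _ _ hx) (hhalf _ _ hx')
      obtain rfl := eq_of_mem_half (hgap g) (hτ g) hx hx'
      rfl
    · exact absurd (hcurve _ (hhalf _ _ hx)) (hUs _ hx' _)
    · exact absurd hx' (hUs _ hx _)
    · exact absurd (hcurve _ (hhalf _ _ hx')) (hUs _ hx _)
    · rfl
  let K₁ := {k // B k ∧ ∀ g, sp g ≠ k}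
  let tgt : ∀ k, B k → I := fun k hk => ⟨L.tgt k, hk.2, L.q k, L.q_mem_curve k, by
    rw [← hk.1.2]; exact L.path_subset_blob hk.1.1 (L.q_mem k)⟩
  have ha : ∀ k : K₁, ∃ v : V, owner v = some (L.src k) ∧ L.p k ∈ X v := by
    intro k
    have hpQ : L.p k ∈ Q := by rw [← k.2.1.1.2]; exact L.mem_blob k.2.1.1.1
    by_cases hc : A.color (L.src k) = !β
    · exact ⟨Sum.inl ⟨L.src k, hc, L.p k, L.p_mem_curve k, hpQ⟩, rfl, L.p_mem_curve k⟩
    · obtain ⟨g, hg, hgs, hp⟩ := L.exists_outerGap k.2.1.1.1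
      let g' : G := ⟨g, hg, by rw [hgs]; simpa using hc, k, k.2.1, hp⟩
      rcases exists_mem_half (hτ g') hp with h | ⟨s, hs⟩
      · refine absurd (L.eq_of_mem (sp g') k (L.p k) ?_ (L.p_mem k)) (k.2.2 g')
        rw [h, hτp g']
        exact L.p_mem _
      · exact ⟨Sum.inr (Sum.inl (g', s)), congrArg some hgs, hs⟩
  choose a hao hap using ha
  let H : G × Bool → V := fun e => Sum.inr (Sum.inl e)
  let ot : G × Bool → V := fun e => Sum.inl ⟨o e, hcolo e, A.endPt e.1 e.2, hocurve e,
    hblob _ (mem_image_of_mem _ (endParam_mem_Icc (hgap e.1) e.2))⟩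
  let P₂ : G × Bool → Set Pt := fun e => L.path (sp e.1) ∪
    A.f e.1.1.1 '' insert (τ e.1) (uIoo (τ e.1) (A.endParam e.1 e.2))
  let P₄ : G × Bool → Set Pt := fun e =>
    A.f e.1.1.1 '' insert (A.endParam e.1 e.2) (uIoo (τ e.1) (A.endParam e.1 e.2))
  have hP₂ : ∀ e, ∀ x ∈ P₂ e, x ∈ L.path (sp e.1) ∨ x ∈ X (H e) := by
    rintro e x (h | ⟨t, rfl | ht, rfl⟩)
    · exact Or.inl h
    · rw [hτp]
      exact Or.inl (L.p_mem _)
    · exact Or.inr (mem_image_of_mem _ ht)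
  have hP₄ : ∀ e, ∀ x ∈ P₄ e, x ∈ X (ot e) ∨ x ∈ X (H e) := by
    rintro e x ⟨t, rfl | ht, rfl⟩
    · exact Or.inl (hocurve e)
    · exact Or.inr (mem_image_of_mem _ ht)
  have hLP : ∀ k (hk : B k), ∀ x ∈ L.path k, ∀ v, x ∈ X v → v = Sum.inl (tgt k hk) ∨
      (x = L.p k ∧ ∃ e, v = H e) ∨ ∃ i : I, v = Sum.inl i ∧ i.1 = L.src k := by
    rintro k hk x hx (i | e | u) hv
    · rcases L.eq_or_eq k x hx _ hv with h | h
      · exact Or.inr (Or.inr ⟨i, rfl, h⟩)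
      · exact Or.inl (congrArg Sum.inl (Subtype.ext h))
    · exact Or.inr (Or.inl ⟨L.eq_p_of_mem_F k hk.1.1 x hx (harcF _ (hhalf _ _ hv)), e, rfl⟩)
    · have h := L.eq_p_of_mem_F k hk.1.1 x hx (subset_closure hv)
      exact absurd (h ▸ L.p_mem_curve k) (hUs _ hv _)
  have hown : ∀ (v : V) i, owner v = some i → A.color i = (!β) → ∃ h, v = Sum.inl ⟨i, h⟩ := by
    rintro (i | e | u) j h hj
    · obtain rfl := Option.some_injective _ h
      exact ⟨i.2, rfl⟩
    · obtain rfl := Option.some_injective _ h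
      rw [hcolG] at hj
      simp at hj
    · cases h
  have hsps : ∀ g, L.src (sp g) = g.1.1 := fun g => hsrc _ g (hsparc g)
  let K := K₁ ⊕ (G × Bool) ⊕ G ⊕ (G × Bool) ⊕ (G × Bool)
  let eA : K → V := Sum.elim a (Sum.elim H (Sum.elim (fun g => H (g, false))
    (Sum.elim H fun _ => Sum.inr (Sum.inr ()))))
  let eB : K → V := Sum.elim (fun k => Sum.inl (tgt k k.2.1))
    (Sum.elim (fun e => Sum.inl (tgt (sp e.1) (hspB e.1))) (Sum.elim (fun g => H (g, true))
    (Sum.elim ot H)))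
  let P : K → Set Pt := Sum.elim (fun k => L.path k) (Sum.elim P₂ (Sum.elim (fun g => A.arc g)
    (Sum.elim P₄ fun e => insert (y e) A.U)))
  have hPout : ∀ e, ∀ x ∈ P e, (∀ v, x ∉ X v) → (∃ k, e = Sum.inl k ∧ x ∈ L.path k) ∨
      (∃ d, e = Sum.inr (Sum.inl d) ∧ x ∈ L.path (sp d.1)) ∨
      ∃ g, e = Sum.inr (Sum.inr (Sum.inl g)) ∧ x ∈ L.path (sp g) := by
    rintro (k | e | g | e | e) x hx hnot
    · exact Or.inl ⟨k, rfl, hx⟩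
    · exact Or.inr (Or.inl ⟨e, rfl, (hP₂ e x hx).resolve_right (hnot _)⟩)
    · refine Or.inr (Or.inr ⟨g, rfl, ?_⟩)
      rcases exists_mem_half (hτ g) hx with h | ⟨s, h⟩
      · rw [h, hτp]
        exact L.p_mem _
      · exact absurd h (hnot (H (g, s)))
    · exact ((hP₄ e x hx).elim (hnot _) (hnot _)).elim
    · rcases hx with rfl | hx
      · exact absurd (hy e) (hnot (H e))
      · exact absurd hx (hnot (Sum.inr (Sum.inr ())))
  have hIne : Nonempty I := by
    obtain ⟨i, hi, h⟩ := exists_color_of_mem_blobs hQ (!β)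
    exact ⟨⟨i, hi, h⟩⟩
  have hcross : ∀ k (e : G × Bool), s(L.src k, L.tgt k) ≠ s(e.1.1.1, o e) := by
    intro k e h
    have h1 := endPt_mem_curve (hgap e.1) e.2
    rcases Sym2.eq_iff.1 h with ⟨h2, h3⟩ | ⟨h2, h3⟩
    · exact L.not_cross k _ (h2 ▸ h1) (h3 ▸ hocurve e) (hendF e.1 e.2)
    · exact L.not_cross k _ (h2 ▸ hocurve e) (h3 ▸ h1) (hendF e.1 e.2)
  have key := (card_edges_add_two_le_of_forall (V := V) (K := K) eA eB ?_ ?_ X P ?_ hXX ?_ ?_ ?_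
    ?_ ?_).2 ?_
  · have e1 : Fintype.card I = _ := Fintype.card_subtype _
    have e2 : (Finset.univ.filter B).card ≤ Fintype.card K₁ + Fintype.card G := by
      have e3 : Fintype.card K₁ = (Finset.univ.filter fun k => B k ∧ ∀ g, sp g ≠ k).card :=
        Fintype.card_subtype _
      have e4 : (Finset.univ.image sp).card ≤ Fintype.card G := Finset.card_image_le
      rw [e3]
      refine (Finset.card_le_card fun k hk => ?_).trans
        ((Finset.card_union_le _ _).trans (Nat.add_le_add_left e4 _))
      simp only [Finset.mem_union, Finset.mem_filter, Finset.mem_univ, true_and,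
        Finset.mem_image] at hk ⊢
      by_cases h : ∃ g, sp g = k
      · exact Or.inr h
      · push Not at h
        exact Or.inl ⟨hk, h⟩
    simp only [K, V, Fintype.card_sum, Fintype.card_prod, Fintype.card_bool, Fintype.card_unit,
      e1] at key
    change (Finset.univ.filter B).card + 2 ≤ _
    omega
  · rintro (k | e | g | e | e) h
    · have h' := congrArg owner h
      exact L.src_ne_tgt k (Option.some_injective _ ((hao k).symm.trans h'))
    · exact Sum.inr_ne_inl h
    · have := Sum.inl_injective (Sum.inr_injective h)
      simp at this
    · exact Sum.inr_ne_inl h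
    · exact Sum.inr_ne_inl (Sum.inr_injective h)
  · have hω : ∀ d e, s(eA d, eB d) = s(eA e, eB e) →
        s(owner (eA d), owner (eB d)) = s(owner (eA e), owner (eB e)) := fun d e h =>
      congrArg (Sym2.map owner) h
    have hinj : Function.Injective (Sym2.map (some : Fin n → Option (Fin n))) :=
      Sym2.map.injective (Option.some_injective _)
    have hω₁ : ∀ k : K₁, s(owner (eA (Sum.inl k)), owner (eB (Sum.inl k))) =
        Sym2.map some s(L.src k, L.tgt k) := fun k => by
      change s(owner (a k), some (L.tgt k)) = _
      rw [hao]
      rfl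
    have hHinj : ∀ {d e}, H d = H e → d = e := fun h => Sum.inl_injective (Sum.inr_injective h)
    have hH : ∀ {e i}, H e ≠ Sum.inl i := Sum.inr_ne_inl
    have h15 : ∀ {x y z : Fin n}, s(some x, some y) ≠ s(none, some z) := by simp
    have n12 : ∀ (k : K₁) e, s(eA (Sum.inl k), eB (Sum.inl k)) ≠
        s(eA (Sum.inr (Sum.inl e)), eB (Sum.inr (Sum.inl e))) := by
      intro k e h
      have h' := hinj ((hω₁ k).symm.trans (hω _ _ h) : _ = Sym2.map some s(e.1.1.1, L.tgt (sp e.1)))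
      rw [← hsps e.1] at h'
      exact k.2.2 e.1 (L.eq_of_pair_eq _ _ h').symm
    have n13 : ∀ (k : K₁) g, s(eA (Sum.inl k), eB (Sum.inl k)) ≠
        s(eA (Sum.inr (Sum.inr (Sum.inl g))), eB (Sum.inr (Sum.inr (Sum.inl g)))) := by
      intro k g h
      have h' := hinj ((hω₁ k).symm.trans (hω _ _ h) : _ = Sym2.map some s(g.1.1, g.1.1))
      rcases Sym2.eq_iff.1 h' with ⟨h1, h2⟩ | ⟨h1, h2⟩ <;> exact L.src_ne_tgt k (h1.trans h2.symm)
    have n14 : ∀ (k : K₁) e, s(eA (Sum.inl k), eB (Sum.inl k)) ≠ s(H e, ot e) := fun k e h =>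
      hcross k e (hinj ((hω₁ k).symm.trans (congrArg (Sym2.map owner) h)))
    have n15 : ∀ (k : K₁) e, s(eA (Sum.inl k), eB (Sum.inl k)) ≠ s(Sum.inr (Sum.inr ()), H e) :=
      fun k e h => h15 ((hω₁ k).symm.trans (congrArg (Sym2.map owner) h))
    have n23 : ∀ d g i, s(H d, Sum.inl i) ≠ s(H (g, false), H (g, true)) := by
      intro d g i h
      rcases Sym2.eq_iff.1 h with ⟨-, h⟩ | ⟨-, h⟩ <;> exact hH h.symm
    have n24 : ∀ d e, s(H d, Sum.inl (tgt (sp d.1) (hspB d.1))) ≠ s(H e, ot e) := by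
      intro d e h
      have h' : Sym2.map some s(d.1.1.1, L.tgt (sp d.1)) = Sym2.map some s(e.1.1.1, o e) :=
        congrArg (Sym2.map owner) h
      replace h' := hinj h'
      rw [← hsps d.1] at h'
      exact hcross _ _ h'
    have n45 : ∀ d e i, s(H d, Sum.inl i) ≠ s(Sum.inr (Sum.inr ()), H e) := fun d e i h =>
      h15 (congrArg (Sym2.map owner) h)
    have n35 : ∀ g e, s(H (g, false), H (g, true)) ≠ s(Sum.inr (Sum.inr ()), H e) := fun g e h =>
      h15 (congrArg (Sym2.map owner) h)
    have n22 : ∀ d e i j, s(H d, Sum.inl i) = s(H e, Sum.inl j) → d = e := by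
      intro d e i j h
      rcases Sym2.eq_iff.1 h with ⟨h, -⟩ | ⟨h, -⟩
      · exact hHinj h
      · exact absurd h hH
    rintro (k | d | g | d | d) (k' | e | g' | e | e) h
    · exact congrArg Sum.inl (Subtype.ext (L.eq_of_pair_eq _ _
        (hinj ((hω₁ k).symm.trans ((hω _ _ h).trans (hω₁ k'))))))
    · exact absurd h (n12 _ _)
    · exact absurd h (n13 _ _)
    · exact absurd h (n14 _ _)
    · exact absurd h (n15 _ _)
    · exact absurd h.symm (n12 _ _)
    · obtain rfl := n22 _ _ _ _ h
      rfl
    · exact absurd h (n23 _ _ _)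
    · exact absurd h (n24 _ _)
    · exact absurd h (n45 _ _ _)
    · exact absurd h.symm (n13 _ _)
    · exact absurd h.symm (n23 _ _ _)
    · rcases Sym2.eq_iff.1 h with ⟨h, -⟩ | ⟨h, -⟩
      · obtain rfl := congrArg Prod.fst (hHinj h)
        rfl
      · have := congrArg Prod.snd (hHinj h)
        simp at this
    · exact absurd h.symm (n23 _ _ _)
    · exact absurd h (n35 _ _)
    · exact absurd h.symm (n14 _ _)
    · exact absurd h.symm (n24 _ _)
    · exact absurd h (n23 _ _ _)
    · obtain rfl := n22 _ _ _ _ h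
      rfl
    · exact absurd h (n45 _ _ _)
    · exact absurd h.symm (n15 _ _)
    · exact absurd h.symm (n45 _ _ _)
    · exact absurd h.symm (n35 _ _)
    · exact absurd h.symm (n45 _ _ _)
    · rcases Sym2.eq_iff.1 h with ⟨-, h⟩ | ⟨h, -⟩
      · obtain rfl := hHinj h
        rfl
      · exact absurd (Sum.inr_injective h) Sum.inr_ne_inl
  · rintro (i | e | -)
    · exact isPathConnected_curve _
    · exact isPathConnected_image_of_uIoo (hgap _) (endParam_ne (hτ _) _)
        (Ioo_subset_Icc_self (hτ _)) (endParam_mem_Icc (hgap _) _) Subset.rfl Ioo_subset_Icc_self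
    · exact A.isRegion.isPathConnected
  · rintro (k | e | g | e | e)
    · exact L.isPathConnected_path k
    · refine (L.isPathConnected_path _).union (isPathConnected_image_of_uIoo (hgap _)
        (endParam_ne (hτ _) _) (Ioo_subset_Icc_self (hτ _)) (endParam_mem_Icc (hgap _) _)
        (subset_insert _ _) (insert_subset left_mem_uIcc Ioo_subset_Icc_self))
        ⟨_, L.p_mem (sp e.1), τ e.1, mem_insert _ _, hτp _⟩
    · exact isPathConnected_image (lt_next_of_gap (hgap g)) Subset.rfl Ioo_subset_Icc_self
        fun t ht => gapSet_Icc (hgap g) (Ioo_subset_Icc_self ht)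
    · exact isPathConnected_image_of_uIoo (hgap _)
        (endParam_ne (hτ _) _) (Ioo_subset_Icc_self (hτ _)) (endParam_mem_Icc (hgap _) _)
        (subset_insert _ _) (insert_subset right_mem_uIcc Ioo_subset_Icc_self)
    · exact hyU e
  · have hin : ∀ e : G × Bool, ∃ t, t ∈ uIoo (τ e.1) (A.endParam e.1 e.2) := fun e =>
      let ⟨t, _, h⟩ := nonempty_half (hτ e.1) e.2
      ⟨t, h⟩
    rintro (k | e | g | e | e)
    · exact ⟨_, L.p_mem k, hap k⟩
    · obtain ⟨t, ht⟩ := hin e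
      exact ⟨_, Or.inr (mem_image_of_mem _ (Or.inr ht)), mem_image_of_mem _ ht⟩
    · obtain ⟨t, ht⟩ := hin (g, false)
      exact ⟨_, hhalf g false (mem_image_of_mem _ ht), mem_image_of_mem _ ht⟩
    · obtain ⟨t, ht⟩ := hin e
      exact ⟨_, mem_image_of_mem _ (Or.inr ht), mem_image_of_mem _ ht⟩
    · obtain ⟨u, hu⟩ := A.isRegion.isConnected.nonempty
      exact ⟨u, Or.inr hu, hu⟩
  · rintro (k | e | g | e | e)
    · exact ⟨_, L.q_mem k, L.q_mem_curve k⟩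
    · exact ⟨_, Or.inl (L.q_mem _), L.q_mem_curve _⟩
    · obtain ⟨t, -, ht⟩ := nonempty_half (hτ g) true
      exact ⟨_, hhalf g true (mem_image_of_mem _ ht), mem_image_of_mem _ ht⟩
    · exact ⟨_, mem_image_of_mem _ (mem_insert _ _), hocurve e⟩
    · exact ⟨y e, mem_insert _ _, hy e⟩
  · rintro (k | e | g | e | e) v x hx hv
    · rcases hLP k k.2.1 x hx v hv with h | ⟨rfl, -⟩ | ⟨i, rfl, hi⟩
      · exact Or.inr h
      · exact Or.inl (hXX _ _ _ hv (hap k))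
      · obtain ⟨h, h'⟩ := hown _ _ (hao k) (hi ▸ i.2.1)
        refine Or.inl (Eq.trans ?_ h'.symm)
        exact congrArg Sum.inl (Subtype.ext hi)
    · rcases hP₂ e x hx with h | h
      · rcases hLP _ (hspB e.1) x h v hv with h | ⟨rfl, d, rfl⟩ | ⟨i, rfl, hi⟩
        · exact Or.inr h
        · exact absurd hv (hsp_half _ _ _)
        · have := i.2.1
          rw [hi, hsps, hcolG] at this
          simp at this
      · exact Or.inl (hXX _ _ _ hv h)
    · rcases v with i | ⟨g', s⟩ | u
      · have h := eq_of_mem_X (harcX _ _ hx) hv (hcurve _ hx)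
        have := i.2.1
        rw [h, hcolG] at this
        simp at this
      · obtain rfl := hGeq _ _ _ hx (hhalf _ _ hv)
        cases s
        · exact Or.inl rfl
        · exact Or.inr rfl
      · exact absurd (hcurve _ hx) (hUs _ hv _)
    · rcases hP₄ e x hx with h | h
      · exact Or.inr (hXX _ _ _ hv h)
      · exact Or.inl (hXX _ _ _ hv h)
    · rcases hx with rfl | hx
      · exact Or.inr (hXX _ _ _ hv (hy e))
      · exact Or.inl (hXX _ (Sum.inr (Sum.inr ())) _ hv hx)
  · intro d e x hd he hnot
    have h12 : ∀ (k : K₁) g, x ∈ L.path k → x ∉ L.path (sp g) := fun k g h h' =>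
      k.2.2 g (L.eq_of_mem _ _ _ h' h)
    have h22 : ∀ g g', x ∈ L.path (sp g) → x ∈ L.path (sp g') → g = g' := fun g g' h h' =>
      hspinj (L.eq_of_mem _ _ _ h h')
    rcases hPout d x hd hnot with ⟨k, rfl, h⟩ | ⟨⟨g, s⟩, rfl, h⟩ | ⟨g, rfl, h⟩ <;>
      rcases hPout e x he hnot with ⟨k', rfl, h'⟩ | ⟨⟨g', s'⟩, rfl, h'⟩ | ⟨g', rfl, h'⟩
    · obtain rfl := Subtype.ext (L.eq_of_mem _ _ _ h h')
      exact Or.inl rfl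
    · exact absurd h' (h12 _ _ h)
    · exact absurd h' (h12 _ _ h)
    · exact absurd h (h12 _ _ h')
    · obtain rfl := h22 _ _ h h'
      exact Or.inr (Or.inr (Or.inr rfl))
    · obtain rfl := h22 _ _ h h'
      cases s
      · exact Or.inl rfl
      · exact Or.inr (Or.inl rfl)
    · exact absurd h (h12 _ _ h')
    · obtain rfl := h22 _ _ h h'
      cases s'
      · exact Or.inl rfl
      · exact Or.inr (Or.inr (Or.inl rfl))
    · obtain rfl := h22 _ _ h h'
      exact Or.inl rfl
  · have : 1 ≤ Fintype.card I := Fintype.card_pos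
    simp only [V, Fintype.card_sum, Fintype.card_unit]
    omega

lemma card_filter_add_card_filter_not {α : Type*} (s : Finset α) (c : α → Bool) (β : Bool) :
    (s.filter fun x => c x = β).card + (s.filter fun x => c x = !β).card = s.card := by
  rw [← Finset.card_filter_add_card_filter_not (s := s) fun x => c x = β]
  congr 2
  refine Finset.filter_congr fun x _ => ?_
  cases c x <;> cases β <;> simp

namespace Links

variable {κ : Type*} [Fintype κ]

open Classical in
lemma card_weak_add_le (L : A.Links κ) :
    (Finset.univ.filter fun k => L.q k ∉ A.F).card + 4 * A.blobs.card ≤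
      3 * A.blobIncidences.card := by
  have h1 : (Finset.univ.filter fun k => L.q k ∉ A.F).card =
      ∑ Q ∈ A.blobs, (Finset.univ.filter fun k => L.q k ∉ A.F ∧ L.blob k = Q).card := by
    rw [Finset.card_eq_sum_card_fiberwise (f := L.blob) (t := A.blobs)]
    · simp only [Finset.filter_filter]
    · intro k hk
      exact L.blob_mem_blobs (by simpa using hk)
  have h2 : A.blobIncidences.card =
      ∑ Q ∈ A.blobs, (Finset.univ.filter fun i => (A.curve i ∩ Q).Nonempty).card := by
    rw [Finset.card_eq_sum_card_fiberwise (f := Prod.snd) (t := A.blobs)]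
    · refine Finset.sum_congr rfl fun Q hQ => ?_
      refine Finset.card_bij' (fun e _ => e.1) (fun i _ => (i, Q)) ?_ ?_ ?_ ?_
      · intro e he
        simp only [Finset.mem_filter, mem_blobIncidences, Finset.mem_univ, true_and] at he ⊢
        exact he.2 ▸ he.1.2
      · intro i hi
        simpa [mem_blobIncidences, hQ] using hi
      · intro e he
        exact Prod.ext rfl (Finset.mem_filter.1 he).2.symm
      · intro i _
        rfl
    · intro e he
      exact (mem_blobIncidences.1 he).1
  rw [h1, h2, Finset.mul_sum, mul_comm 4, ← smul_eq_mul, ← Finset.sum_const,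
    ← Finset.sum_add_distrib]
  refine Finset.sum_le_sum fun Q hQ => ?_
  have h3 := L.card_weak_add_two_le true hQ
  have h4 := L.card_weak_add_two_le false hQ
  have h5 := card_filter_add_card_filter_not
    (Finset.univ.filter fun k => L.q k ∉ A.F ∧ L.blob k = Q) (fun k => A.color (L.tgt k)) true
  have h6 := card_filter_add_card_filter_not
    (Finset.univ.filter fun i => (A.curve i ∩ Q).Nonempty) A.color true
  simp only [Finset.filter_filter, Bool.not_true, Bool.not_false] at h3 h4 h5 h6
  simp only [and_comm (b := (A.curve _ ∩ Q).Nonempty)] at h3 h4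
  omega

open Classical in
lemma card_strong_add_le (L : A.Links κ) (hne : A.visibleGaps.Nonempty) :
    2 * (Finset.univ.filter fun k => L.q k ∈ A.F).card +
      (Finset.univ.filter fun k => L.q k ∉ A.F).card + A.gapIncidences.card + 4 ≤
      3 * (n + A.visibleGaps.card) := by
  have h1 := L.card_add_card_gapIncidences_add_two_le true hne
  have h2 := L.card_add_card_gapIncidences_add_two_le false hne
  have h3 := card_filter_add_card_filter_not A.gapIncidences (fun e => A.color e.1.1) true
  have h4 := card_filter_add_card_filter_not A.visibleGaps (fun e => A.color e.1) true
  have h5 := card_filter_add_card_filter_not (Finset.univ : Finset (Fin n)) A.color true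
  have h6 := card_filter_add_card_filter_not
    (Finset.univ.filter fun k => L.q k ∉ A.F) (fun k => A.color (L.tgt k)) true
  have h7 : ∀ β, (Finset.univ.filter fun k => L.q k ∈ A.F ∨ A.color (L.tgt k) = β).card =
      (Finset.univ.filter fun k => L.q k ∈ A.F).card +
        (Finset.univ.filter fun k => L.q k ∉ A.F ∧ A.color (L.tgt k) = β).card := by
    intro β
    rw [← Finset.card_union_of_disjoint]
    · congr 1
      ext k
      simp only [Finset.mem_filter, Finset.mem_univ, true_and, Finset.mem_union]
      tauto
    · rw [Finset.disjoint_filter]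
      tauto
  simp only [Finset.filter_filter, Bool.not_true, Bool.not_false, Finset.card_univ,
    Fintype.card_fin, h7] at h1 h2 h3 h4 h5 h6
  omega

lemma two_mul_card_add_card_crossPairs_le (L : A.Links κ) (hne : A.visibleGaps.Nonempty) :
    2 * Fintype.card κ + A.crossPairs.card + 8 ≤
      10 * n + 3 * (FaceEdges A.curve A.F).ncard := by
  classical
  have hF : (A.support ∩ A.F).Nonempty := by
    obtain ⟨g, hg⟩ := hne
    have h := (mem_visibleGaps.1 hg).1
    exact ⟨A.endPt g true, A.curve_subset_support _ (endPt_mem_curve h true), endPt_mem_F hg true⟩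
  have h1 := L.card_weak_add_le
  have h2 := L.card_strong_add_le hne
  have h3 := A.card_innerGaps_lt hF
  have h4 := A.two_mul_card_innerCrossings_add_le
  have h5 := A.card_blobIncidences_add_le
  have h6 := A.two_mul_card_visibleGaps_add_le
  have h7 := A.card_visibleGaps
  have h8 := A.card_looseEnds_le
  have h9 := A.card_outerGaps_le
  have h10 := A.card_outerCrossings_le
  have h11 := Finset.card_filter_add_card_filter_not (s := (Finset.univ : Finset κ))
    fun k => L.q k ∈ A.F
  rw [Finset.card_univ] at h11
  omega

end Links

end Arrangement

lemma exists_forall_abs_sub_le {s t : Set ℝ} (hs : IsCompact s) (ht : IsCompact t)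
    (hs' : s.Nonempty) (ht' : t.Nonempty) :
    ∃ a ∈ s, ∃ b ∈ t, ∀ a' ∈ s, ∀ b' ∈ t, |a - b| ≤ |a' - b'| := by
  obtain ⟨⟨a, b⟩, ⟨ha, hb⟩, h⟩ := (hs.prod ht).exists_isMinOn (hs'.prod ht')
    (f := fun p : ℝ × ℝ => |p.1 - p.2|) (by fun_prop)
  exact ⟨a, ha, b, hb, fun a' ha' b' hb' => h (a := (a', b')) ⟨ha', hb'⟩⟩

lemma eq_of_mem_uIcc_of_abs_sub_le {a b x : ℝ} (hx : x ∈ uIcc a b) (h : |a - b| ≤ |x - b|) :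
    x = a := by
  rcases le_total a b with hab | hab
  · rw [uIcc_of_le hab] at hx
    rw [abs_of_nonpos (by linarith), abs_of_nonpos (by linarith [hx.2])] at h
    linarith [hx.1]
  · rw [uIcc_of_ge hab] at hx
    rw [abs_of_nonneg (by linarith), abs_of_nonneg (by linarith [hx.1])] at h
    linarith [hx.2]

namespace Arrangement

variable {n : ℕ} {A : Arrangement n}

lemma exists_mem_support_of_mem_of_notMem {c : ℝ → Pt} (hc : ContinuousOn c (Icc 0 1)) {u t : ℝ}
    (hu : u ∈ Icc (0 : ℝ) 1) (ht : t ∈ Icc (0 : ℝ) 1) (huF : c u ∈ A.F) (htF : c t ∉ A.F) :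
    ∃ w ∈ uIcc u t, c w ∈ A.F ∧ c w ∈ A.support := by
  by_contra! h
  obtain ⟨-, ⟨w, -, rfl⟩, hwU, hwF⟩ := (isPreconnected_uIcc.image c
    (hc.mono (uIcc_subset_Icc hu ht))) A.U A.Fᶜ A.isRegion.isOpen A.isClosed_F.isOpen_compl
    (by
      rintro _ ⟨w, hw, rfl⟩
      by_cases hwF : c w ∈ A.F
      · exact Or.inl (A.isRegion.mem_of_mem_closure A.isClosed_support hwF (h w hw hwF))
      · exact Or.inr hwF)
    ⟨c u, mem_image_of_mem _ left_mem_uIcc,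
      A.isRegion.mem_of_mem_closure A.isClosed_support huF (h u left_mem_uIcc huF)⟩
    ⟨c t, mem_image_of_mem _ right_mem_uIcc, htF⟩
  exact hwF (subset_closure hwU)

lemma exists_link {c : ℝ → Pt} (hc : ContinuousOn c (Icc 0 1)) {i j : Fin n}
    (hi : (c '' Icc 0 1 ∩ A.curve i).Nonempty)
    (hj : (c '' Icc 0 1 ∩ A.curve j).Nonempty)
    (hij : ∀ l, (c '' Icc 0 1 ∩ A.curve l).Nonempty → l = i ∨ l = j)
    (hF : (A.F ∩ c '' Icc 0 1).Nonempty) :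
    ∃ (path : Set Pt) (src tgt : Fin n) (p q : Pt), path ⊆ c '' Icc 0 1 ∧ s(src, tgt) = s(i, j) ∧
      IsPathConnected path ∧ p ∈ path ∧ q ∈ path ∧ p ∈ A.curve src ∧ q ∈ A.curve tgt ∧ p ∈ A.F ∧
      (∀ x ∈ path, x ∈ A.curve src → x ∈ A.F → x = p) ∧
      (∀ x ∈ path, x ∈ A.curve tgt → x ∈ A.F → x = q) ∧
      (q ∉ A.F → ∀ x ∈ path, x ∈ A.F → x = p) := by
  have hcl : ∀ Z : Set Pt, IsClosed Z → IsCompact {t | t ∈ Icc (0 : ℝ) 1 ∧ c t ∈ Z} := fun Z hZ =>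
    isCompact_Icc.of_isClosed_subset (hc.preimage_isClosed_of_isClosed isClosed_Icc hZ)
      fun t ht => ht.1
  have hpath : ∀ s t : ℝ, s ∈ Icc (0 : ℝ) 1 → t ∈ Icc (0 : ℝ) 1 →
      IsPathConnected (c '' uIcc s t) := fun s t hs ht =>
    ((convex_uIcc s t).isPathConnected nonempty_uIcc).image' (hc.mono (uIcc_subset_Icc hs ht))
  have hor : ∀ t ∈ Icc (0 : ℝ) 1, c t ∈ A.support → c t ∈ A.curve i ∨ c t ∈ A.curve j := by
    intro t ht h
    obtain ⟨l, hl⟩ := mem_iUnion.1 h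
    rcases hij l ⟨_, mem_image_of_mem _ ht, hl⟩ with rfl | rfl
    exacts [Or.inl hl, Or.inr hl]
  by_cases hb : (∃ t ∈ Icc (0 : ℝ) 1, c t ∈ A.curve i ∩ A.F) ∧
      ∃ t ∈ Icc (0 : ℝ) 1, c t ∈ A.curve j ∩ A.F
  · obtain ⟨⟨s₀, hs₀⟩, t₀, ht₀⟩ := hb
    obtain ⟨s, hs, t, ht, hmin⟩ := exists_forall_abs_sub_le
      (hcl _ ((A.isClosed_curve i).inter A.isClosed_F))
      (hcl _ ((A.isClosed_curve j).inter A.isClosed_F)) ⟨s₀, hs₀⟩ ⟨t₀, ht₀⟩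
    have hsub := uIcc_subset_Icc hs.1 ht.1
    refine ⟨c '' uIcc s t, i, j, c s, c t, image_mono hsub, rfl, hpath _ _ hs.1 ht.1,
      mem_image_of_mem _ left_mem_uIcc, mem_image_of_mem _ right_mem_uIcc, hs.2.1, ht.2.1, hs.2.2,
      ?_, ?_, fun h => absurd ht.2.2 h⟩
    · rintro _ ⟨u, hu, rfl⟩ h h'
      rw [eq_of_mem_uIcc_of_abs_sub_le hu (hmin u ⟨hsub hu, h, h'⟩ t ht)]
    · rintro _ ⟨u, hu, rfl⟩ h h'
      have := hmin s hs u ⟨hsub hu, h, h'⟩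
      rw [abs_sub_comm s t, abs_sub_comm s u] at this
      rw [eq_of_mem_uIcc_of_abs_sub_le (uIcc_comm s t ▸ hu) this]
  · have hone : ∃ a b, s(a, b) = s(i, j) ∧ (∃ t ∈ Icc (0 : ℝ) 1, c t ∈ A.curve a ∩ A.F) ∧
        ∀ t ∈ Icc (0 : ℝ) 1, c t ∈ A.curve b → c t ∉ A.F := by
      have hex : ∃ t ∈ Icc (0 : ℝ) 1, c t ∈ A.F ∧ c t ∈ A.support := by
        obtain ⟨_, huF, u, hu, rfl⟩ := hF
        obtain ⟨_, ⟨t, ht, rfl⟩, hti⟩ := hi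
        by_cases htF : c t ∈ A.F
        · exact ⟨t, ht, htF, A.curve_subset_support i hti⟩
        · obtain ⟨w, hw, h⟩ := exists_mem_support_of_mem_of_notMem hc hu ht huF htF
          exact ⟨w, uIcc_subset_Icc hu ht hw, h⟩
      obtain ⟨t, ht, htF, hts⟩ := hex
      rcases hor t ht hts with h | h
      · exact ⟨i, j, rfl, ⟨t, ht, h, htF⟩, fun u hu huj huF =>
          hb ⟨⟨t, ht, h, htF⟩, u, hu, huj, huF⟩⟩
      · exact ⟨j, i, Sym2.eq_swap, ⟨t, ht, h, htF⟩, fun u hu hui huF =>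
          hb ⟨⟨u, hu, hui, huF⟩, t, ht, h, htF⟩⟩
    obtain ⟨a, b, hab, ⟨s₀, hs₀⟩, hbF⟩ := hone
    obtain ⟨t, ht, htb⟩ : ∃ t ∈ Icc (0 : ℝ) 1, c t ∈ A.curve b := by
      rcases Sym2.eq_iff.1 hab with ⟨-, rfl⟩ | ⟨-, rfl⟩
      · obtain ⟨_, ⟨t, ht, rfl⟩, h⟩ := hj
        exact ⟨t, ht, h⟩
      · obtain ⟨_, ⟨t, ht, rfl⟩, h⟩ := hi
        exact ⟨t, ht, h⟩
    obtain ⟨s, hs, t', ht', hmin⟩ := exists_forall_abs_sub_le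
      (hcl _ ((A.isClosed_curve a).inter A.isClosed_F)) (isCompact_singleton (x := t)) ⟨s₀, hs₀⟩
      (singleton_nonempty t)
    obtain rfl : t' = t := ht'
    have hsub := uIcc_subset_Icc hs.1 ht
    have hs_eq : ∀ u ∈ uIcc s t', c u ∈ A.curve a → c u ∈ A.F → u = s := fun u hu h h' =>
      eq_of_mem_uIcc_of_abs_sub_le hu (hmin u ⟨hsub hu, h, h'⟩ t' rfl)
    refine ⟨c '' uIcc s t', a, b, c s, c t', image_mono hsub, hab, hpath _ _ hs.1 ht,
      mem_image_of_mem _ left_mem_uIcc, mem_image_of_mem _ right_mem_uIcc, hs.2.1, htb, hs.2.2,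
      ?_, ?_, fun _ => ?_⟩
    · rintro _ ⟨u, hu, rfl⟩ h h'
      rw [hs_eq u hu h h']
    · rintro _ ⟨u, hu, rfl⟩ h h'
      exact absurd h' (hbF u (hsub hu) h)
    · rintro _ ⟨u, hu, rfl⟩ h
      obtain ⟨w, hw, hwF, hws⟩ :=
        exists_mem_support_of_mem_of_notMem hc (hsub hu) ht h (hbF _ ht htb)
      have hw' : w ∈ uIcc s t' := uIcc_subset_uIcc hu right_mem_uIcc hw
      have hwa : c w ∈ A.curve a := by
        have hnb : c w ∉ A.curve b := fun h => hbF w (hsub hw') h hwF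
        rcases Sym2.eq_iff.1 hab with ⟨rfl, rfl⟩ | ⟨rfl, rfl⟩
        · exact (hor w (hsub hw') hws).resolve_right hnb
        · exact (hor w (hsub hw') hws).resolve_left hnb
      obtain rfl := hs_eq w hw' hwa hwF
      rw [eq_of_mem_uIcc_of_mem_uIcc hu hw]

theorem two_mul_card_add_le {κ : Type*} [Fintype κ] [Nonempty κ] (C : κ → Set Pt)
    (hC : ∀ k, IsCurve (C k)) (hdisj : ∀ k l, k ≠ l → Disjoint (C k) (C l))
    (hX : ∀ k, Disjoint (C k) A.X) (i j : κ → Fin n) (hne : ∀ k, i k ≠ j k)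
    (hi : ∀ k, (C k ∩ A.curve (i k)).Nonempty) (hj : ∀ k, (C k ∩ A.curve (j k)).Nonempty)
    (hij : ∀ k l, (C k ∩ A.curve l).Nonempty → l = i k ∨ l = j k)
    (hdist : ∀ k l, s(i k, j k) = s(i l, j l) → k = l) (hF : ∀ k, (A.F ∩ C k).Nonempty) :
    2 * Fintype.card κ + 8 ≤ 10 * n + 3 * (FaceEdges A.curve A.F).ncard := by
  classical
  choose c hc _ hcC using hC
  choose path src tgt p q hsub hpair hconn hp hq hps hqt hpF heqp heqq heqF using fun k =>
    exists_link (hc k) (hcC k ▸ hi k) (hcC k ▸ hj k) (hcC k ▸ hij k) (hcC k ▸ hF k)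
  replace hsub : ∀ k, path k ⊆ C k := fun k => (hcC k).symm ▸ hsub k
  have hXn : ∀ k, ∀ x ∈ path k, x ∉ A.X := fun k x hx =>
    (hX k).notMem_of_mem_left (hsub k hx)
  let N : κ → Prop := fun k => ∀ x ∈ A.curve (src k), x ∈ A.curve (tgt k) → x ∉ A.F
  let L : A.Links {k // N k} :=
    { path := fun k => path k
      src := fun k => src k
      tgt := fun k => tgt k
      p := fun k => p k
      q := fun k => q k
      isPathConnected_path := fun k => hconn k
      p_mem := fun k => hp k
      q_mem := fun k => hq k
      p_mem_curve := fun k => hps k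
      q_mem_curve := fun k => hqt k
      p_mem_F := fun k => hpF k
      src_ne_tgt := fun k h => hne k (Sym2.mk_isDiag_iff.1 (hpair k ▸ Sym2.mk_isDiag_iff.2 h))
      eq_of_mem := fun k l x hx hx' => by
        by_contra h
        exact disjoint_left.1 (hdisj k l fun h' => h (Subtype.ext h')) (hsub _ hx) (hsub _ hx')
      notMem_X := fun k => hXn k
      eq_or_eq := fun k x hx l hl => by
        rw [← Sym2.mem_iff, hpair, Sym2.mem_iff]
        exact hij k l ⟨x, hsub _ hx, hl⟩
      eq_p := fun k => heqp k
      eq_q := fun k => heqq k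
      eq_p_of_mem_F := fun k => heqF k
      eq_of_pair_eq := fun k l h => Subtype.ext
        (hdist k l ((hpair k).symm.trans (h.trans (hpair l))))
      not_cross := fun k => k.2 }
  have hvis : A.visibleGaps.Nonempty := by
    obtain ⟨k⟩ := ‹Nonempty κ›
    obtain ⟨g, hg, -⟩ := exists_visibleGap (hps k) (hXn k _ (hp k)) (hpF k)
    exact ⟨g, hg⟩
  have hcross : 2 * (Finset.univ.filter fun k => ¬ N k).card ≤ A.crossPairs.card := by
    rw [mul_comm, ← Fintype.card_bool, ← Finset.card_univ, ← Finset.card_product]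
    have hsne : ∀ k, src k ≠ tgt k := fun k h =>
      hne k (Sym2.mk_isDiag_iff.1 (hpair k ▸ Sym2.mk_isDiag_iff.2 h))
    refine Finset.card_le_card_of_injOn
      (fun e => if e.2 then (src e.1, tgt e.1) else (tgt e.1, src e.1)) ?_ ?_
    · rintro ⟨k, b⟩ he
      have hk : ¬ N k := by simpa using he
      simp only [N] at hk
      push Not at hk
      obtain ⟨x, hx, hx', hxF⟩ := hk
      simp only [Finset.mem_coe]
      cases b
      · exact mem_crossPairs.2 ⟨(hsne k).symm, x, ⟨hx', hx⟩, hxF⟩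
      · exact mem_crossPairs.2 ⟨hsne k, x, ⟨hx, hx'⟩, hxF⟩
    · rintro ⟨k, b⟩ - ⟨l, b'⟩ - h
      have hpe : ∀ (k : κ) (b : Bool), Function.uncurry Sym2.mk
          (if b then (src k, tgt k) else (tgt k, src k)) = s(i k, j k) := by
        intro k b
        cases b
        · exact Sym2.eq_swap.trans (hpair k)
        · exact hpair k
      obtain rfl : k = l := hdist k l ((hpe k b).symm.trans 
        ((congrArg (Function.uncurry Sym2.mk) h).trans (hpe l b')))
      cases b <;> cases b' <;> simp at h ⊢
      · exact hsne k h.2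
      · exact hsne k h.1
  have hL := L.two_mul_card_add_card_crossPairs_le hvis
  have hcard := Finset.card_filter_add_card_filter_not (s := (Finset.univ : Finset κ)) N
  rw [Fintype.card_of_subtype (Finset.univ.filter N) (by simp)] at hL
  rw [Finset.card_univ] at hcard
  omega

end Arrangement

theorem stmt6 (n m : ℕ) (S : Fin n → Set Pt) (color : Fin n → Bool) (C : Fin m → Set Pt)
    (hScurve : ∀ i, IsPolygonalCurve (S i))
    (hCcurve : ∀ k, IsPolygonalCurve (C k))
    (hSinj : Function.Injective S)
    -- no two curves of the same color intersect
    (hsame : ∀ i j : Fin n, i ≠ j → color i = color j → Disjoint (S i) (S j))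
    -- every pair of curves intersects in finitely many points
    (hSSfin : ∀ i j : Fin n, i ≠ j → (S i ∩ S j).Finite)
    (hSCfin : ∀ i k, (S i ∩ C k).Finite)
    -- no point belongs to more than two of the curves considered
    (htriple : ∀ p : Pt, ({x : Fin n ⊕ Fin m | p ∈ Sum.elim S C x}).encard ≤ 2)
    -- the curves of `C` are pairwise disjoint
    (hCdisj : ∀ k l : Fin m, k ≠ l → Disjoint (C k) (C l))
    -- each `c ∈ C` intersects exactly two members of `S` (possibly each several times)
    (htwo : ∀ k : Fin m, ∃ i j : Fin n, i ≠ j ∧ (C k ∩ S i).Nonempty ∧ (C k ∩ S j).Nonempty ∧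
      ∀ l : Fin n, (C k ∩ S l).Nonempty → l = i ∨ l = j)
    -- distinct members of `C` intersect distinct pairs of members of `S`
    (hdist : ∀ k l : Fin m, k ≠ l →
      {i : Fin n | (C k ∩ S i).Nonempty} ≠ {i : Fin n | (C l ∩ S i).Nonempty})
    -- there is a face `F` of `A_S` intersected by every curve in `C`
    (F : Set Pt) (hF : F ∈ ArrFaces S) (hmeet : ∀ k : Fin m, (F ∩ C k).Nonempty) :
    m ≤ 5 * n + 2 * (FaceEdges S F).ncard - 3 := by
  rcases Nat.eq_zero_or_pos m with rfl | hm
  · exact Nat.zero_le _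
  have : Nonempty (Fin m) := ⟨⟨0, hm⟩⟩
  choose f hfc hfi hfS using fun i => (hScurve i).1
  obtain ⟨x, hx, rfl⟩ := hF
  let A : Arrangement n :=
    { f := f
      color := color
      cont := hfc
      inj := hfi
      poly := fun i => hfS i ▸ (hScurve i).2
      same := fun i j => by rw [← hfS, ← hfS]; exact hsame i j
      fin := fun i j => by rw [← hfS, ← hfS]; exact hSSfin i j
      base := x
      base_notMem := fun i h => hx (mem_iUnion.2 ⟨i, (hfS i).symm ▸ h⟩) }
  have hA : A.curve = S := funext fun i => (hfS i).symm
  have hAF : A.F = closure (connectedComponentIn (⋃ i, S i)ᶜ x) := by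
    rw [← hA]
    rfl
  rw [← hAF] at hmeet ⊢
  rw [← hA] at htwo htriple hdist ⊢
  choose i j hne hi hj hij using htwo
  have hpair : ∀ k, {l | (C k ∩ A.curve l).Nonempty} = {l | l ∈ s(i k, j k)} := by
    intro k
    ext l
    refine ⟨fun h => Sym2.mem_iff.2 (hij k l h), fun h => ?_⟩
    rcases Sym2.mem_iff.1 h with rfl | rfl
    exacts [hi k, hj k]
  have key := A.two_mul_card_add_le C (fun k => (hCcurve k).1) hCdisj ?_ i j hne hi hj hij ?_ hmeet
  · rw [Fintype.card_fin] at key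
    omega
  · intro k
    rw [disjoint_left]
    rintro p hp ⟨a, b, hab, ha, hb⟩
    have h3 : ({Sum.inl a, Sum.inl b, Sum.inr k} : Set (Fin n ⊕ Fin m)).encard = 3 :=
      encard_eq_three.2 ⟨_, _, _, by simpa using hab, by simp, by simp, rfl⟩
    have hsub : ({Sum.inl a, Sum.inl b, Sum.inr k} : Set (Fin n ⊕ Fin m)) ⊆
        {y | p ∈ Sum.elim A.curve C y} := by
      rintro y (rfl | rfl | rfl)
      exacts [ha, hb, hp]
    have hle := (encard_le_encard hsub).trans (htriple p)
    rw [h3] at hle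
    exact absurd hle (by norm_num)
  · intro k l h
    by_contra hkl
    exact hdist k l hkl (by rw [hpair, hpair, h])
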